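/- arXiv:1909.11441 — 2 statements merged into one kernel-verified Lean document; each statement's English description precedes it below -/
import Mathlib

section
/- Let N ≥ 2 and α ∈ (1, N). There exist positive constants ε₀, C₀, C₁, depending only on N (and α), such that the following holds. Let E ⊆ ℝ^N be a measurable set with |E| = |B|, barycenter at the origin, and E = { (1+u(x))·ρ·x : x ∈ ∂B, 0 < ρ < 1 } for some u ∈ L^∞(∂B) with ‖u‖_{L^∞(∂B)} ≤ ε₀. Then 𝔉(B) − 𝔉(E) ≥ C₀ ‖u‖²_{L²(∂B)} ≥ C₁ |E Δ B|². -/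
open MeasureTheory Metric
open scoped symmDiff

noncomputable def rieszEnergy (N : ℕ) (α : ℝ) (E : Set (EuclideanSpace ℝ (Fin N))) : ℝ :=
  ∫ x in E, ∫ y in E, ‖y - x‖ ^ (α - (N : ℝ))

noncomputable def barycenter (N : ℕ) (F : Set (EuclideanSpace ℝ (Fin N))) :
    EuclideanSpace ℝ (Fin N) :=
  ((volume F).toReal)⁻¹ • ∫ x in F, x

namespace FugledeRiesz

open scoped Pointwise

/-- The ambient Euclidean space. -/
abbrev Space (N : ℕ) := EuclideanSpace ℝ (Fin N)

/-- The unit sphere, as a type. -/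
abbrev USphere (N : ℕ) := sphere (0 : Space N) 1

/-- The surface measure on the unit sphere. -/
noncomputable abbrev surf (N : ℕ) : Measure (USphere N) := (volume : Measure (Space N)).toSphere

section Polar

variable {N : ℕ}

theorem norm_coe (x : USphere N) : ‖(x : Space N)‖ = 1 := by simp

theorem finrank_space : Module.finrank ℝ (Space N) = N := by simp

theorem integrable_comp_polar {h : Space N → ℝ} (hh : Integrable h) :
    Integrable (fun p : USphere N × Set.Ioi (0 : ℝ) ↦ h ((p.2 : ℝ) • (p.1 : Space N)))
      ((surf N).prod (Measure.volumeIoiPow (N - 1))) := by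
  have h1 := (volume : Measure (Space N)).measurePreserving_homeomorphUnitSphereProd
  rw [finrank_space] at h1
  have h2 := h1.integrable_comp_emb (g := fun p : USphere N × Set.Ioi (0 : ℝ) ↦
    h ((p.2 : ℝ) • (p.1 : Space N))) (Homeomorph.measurableEmbedding _)
  rw [← h2]
  have h3 : ((fun p : USphere N × Set.Ioi (0 : ℝ) ↦ h ((p.2 : ℝ) • (p.1 : Space N))) ∘
      (homeomorphUnitSphereProd (Space N))) = fun x => h x.1 := by
    funext x
    have hx : ‖x.1‖ ≠ 0 := norm_ne_zero_iff.2 x.2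
    simp [smul_smul, hx]
  rw [h3]
  have := integrableOn_iff_comap_subtypeVal (μ := (volume : Measure (Space N))) (f := h)
    (measurableSet_singleton (0 : Space N)).compl
  exact this.1 hh.integrableOn

theorem integral_polar_pow (n : ℕ) (g : ℝ → ℝ) :
    ∫ r : Set.Ioi (0 : ℝ), g r ∂(Measure.volumeIoiPow n) =
      ∫ r in Set.Ioi (0 : ℝ), r ^ n * g r := by
  simp only [Measure.volumeIoiPow, ENNReal.ofReal]
  rw [integral_withDensity_eq_integral_smul,
    integral_subtype_comap measurableSet_Ioi fun a ↦ Real.toNNReal (a ^ n) • g a]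
  · refine setIntegral_congr_fun measurableSet_Ioi fun x hx ↦ ?_
    simp only [NNReal.smul_def, Real.coe_toNNReal _ (pow_nonneg hx.out.le _), smul_eq_mul]
  · exact (measurable_subtype_coe.pow_const _).real_toNNReal

theorem integrable_polar_pow_iff (n : ℕ) (g : ℝ → ℝ) :
    Integrable (fun r : Set.Ioi (0 : ℝ) ↦ g r) (Measure.volumeIoiPow n) ↔
      IntegrableOn (fun r ↦ r ^ n * g r) (Set.Ioi (0 : ℝ)) := by
  rw [integrableOn_iff_comap_subtypeVal measurableSet_Ioi, Measure.volumeIoiPow,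
    integrable_withDensity_iff_integrable_smul', integrable_congr]
  · refine .of_forall ?_
    rintro ⟨x, hx : 0 < x⟩
    simp (disch := positivity) [ENNReal.toReal_ofReal]
  · fun_prop
  · simp

instance [Fact (2 ≤ N)] : Nontrivial (Space N) := by
  have h : 2 ≤ N := Fact.out
  apply Module.nontrivial_of_finrank_pos (R := ℝ)
  rw [finrank_space]
  omega

/-- Integration in polar coordinates. -/
theorem integral_polar [Fact (2 ≤ N)] {h : Space N → ℝ} (hh : Integrable h) :
    ∫ z, h z =
      ∫ x : USphere N, (∫ r in Set.Ioi (0 : ℝ), r ^ (N - 1) * h (r • (x : Space N))) ∂(surf N) := by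
  have h1 := (volume : Measure (Space N)).measurePreserving_homeomorphUnitSphereProd
  rw [finrank_space] at h1
  calc ∫ z, h z = ∫ z : ({(0)}ᶜ : Set (Space N)), h z ∂(Measure.comap Subtype.val volume) := by
        rw [integral_subtype_comap (measurableSet_singleton _).compl h, restrict_compl_singleton]
    _ = ∫ p : USphere N × Set.Ioi (0 : ℝ), h ((p.2 : ℝ) • (p.1 : Space N))
          ∂((surf N).prod (Measure.volumeIoiPow (N - 1))) := by
        rw [← h1.integral_comp (Homeomorph.measurableEmbedding _)]
        refine integral_congr_ae (.of_forall fun x => ?_)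
        have hx : ‖x.1‖ ≠ 0 := norm_ne_zero_iff.2 x.2
        simp [smul_smul, hx]
    _ = _ := by
        rw [integral_prod _ (integrable_comp_polar hh)]
        refine integral_congr_ae (.of_forall fun x => ?_)
        exact integral_polar_pow (N - 1) (fun r => h (r • (x : Space N)))

theorem integrable_polar_left {h : Space N → ℝ} (hh : Integrable h) :
    Integrable (fun x : USphere N ↦
      ∫ r in Set.Ioi (0 : ℝ), r ^ (N - 1) * h (r • (x : Space N))) (surf N) := by
  refine (integrable_comp_polar hh).integral_prod_left.congr (.of_forall fun x => ?_)
  exact integral_polar_pow (N - 1) (fun r => h (r • (x : Space N)))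

theorem ae_integrable_polar {h : Space N → ℝ} (hh : Integrable h) :
    ∀ᵐ x : USphere N ∂(surf N),
      IntegrableOn (fun r : ℝ ↦ r ^ (N - 1) * h (r • (x : Space N))) (Set.Ioi (0 : ℝ)) := by
  filter_upwards [(integrable_comp_polar hh).prod_right_ae] with x hx
  exact (integrable_polar_pow_iff (N - 1) (fun r => h (r • (x : Space N)))).1 hx

end Polar

section Graph

variable {N : ℕ}

/-- `E` is, up to the origin, the region enclosed by the radial graph of `1 + u`. -/
def IsRadialGraph (E : Set (Space N)) (u : USphere N → ℝ) : Prop :=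
  ∀ x : USphere N, ∀ r : ℝ, 0 < r → (r • (x : Space N) ∈ E ↔ r < 1 + u x)

/-- The difference of the indicators of `E` and of the unit ball. -/
noncomputable def indDiff (E : Set (Space N)) (z : Space N) : ℝ :=
  E.indicator 1 z - (ball (0 : Space N) 1).indicator 1 z

theorem exists_smul_sphere {z : Space N} (hz : z ≠ 0) :
    ∃ x : USphere N, z = ‖z‖ • (x : Space N) := by
  have h : ‖z‖ ≠ 0 := norm_ne_zero_iff.2 hz
  exact ⟨⟨‖z‖⁻¹ • z, by simp [norm_smul, h]⟩, by simp [smul_smul, h]⟩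

theorem measurable_indDiff {E : Set (Space N)} (hE : MeasurableSet E) :
    Measurable (indDiff E) :=
  (measurable_one.indicator hE).sub (measurable_one.indicator measurableSet_ball)

theorem abs_indDiff_le (E : Set (Space N)) (z : Space N) : |indDiff E z| ≤ 1 := by
  classical
  unfold indDiff
  simp only [Set.indicator_apply]
  split_ifs <;> simp

theorem IsRadialGraph.mem_ball {E : Set (Space N)} {u : USphere N → ℝ} (hE : IsRadialGraph E u)
    (hu : ∀ x, |u x| ≤ 1 / 2) {z : Space N} (hz : z ∈ E) : z ∈ ball (0 : Space N) 2 := by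
  rcases eq_or_ne z 0 with rfl | h
  · simp
  obtain ⟨x, hx⟩ := exists_smul_sphere h
  have h1 : 0 < ‖z‖ := norm_pos_iff.2 h
  have h2 := (hE x ‖z‖ h1).1 (hx ▸ hz)
  have h3 := abs_le.1 (hu x)
  rw [mem_ball_zero_iff]
  linarith

theorem IsRadialGraph.indDiff_eq_zero {E : Set (Space N)} {u : USphere N → ℝ}
    (hE : IsRadialGraph E u) (hu : ∀ x, |u x| ≤ 1 / 2) {z : Space N}
    (hz : z ∉ ball (0 : Space N) 2) : indDiff E z = 0 := by
  have h1 : z ∉ E := fun h => hz (hE.mem_ball hu h)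
  have h2 : z ∉ ball (0 : Space N) 1 := fun h => hz (ball_subset_ball (by norm_num) h)
  simp [indDiff, h1, h2]

theorem IsRadialGraph.indDiff_smul {E : Set (Space N)} {u : USphere N → ℝ}
    (hE : IsRadialGraph E u) (x : USphere N) {r : ℝ} (hr : 0 < r) :
    indDiff E (r • (x : Space N)) =
      (Set.Iio (1 + u x)).indicator 1 r - (Set.Iio 1).indicator 1 r := by
  classical
  have h2 : r • (x : Space N) ∈ ball (0 : Space N) 1 ↔ r < 1 := by
    rw [mem_ball_zero_iff, norm_smul, norm_coe, mul_one, Real.norm_of_nonneg hr.le]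
  simp only [indDiff, Set.indicator_apply, hE x r hr, h2, Set.mem_Iio, Pi.one_apply]

theorem integrable_indDiff_mul {E : Set (Space N)} {u : USphere N → ℝ} (hE : IsRadialGraph E u)
    (hEm : MeasurableSet E) (hu : ∀ x, |u x| ≤ 1 / 2) {h : Space N → ℝ}
    (hh : IntegrableOn h (ball 0 2)) : Integrable (fun z ↦ indDiff E z * h z) := by
  have h1 : Integrable ((ball (0 : Space N) 2).indicator h) :=
    hh.integrable_indicator measurableSet_ball
  have h2 : (fun z ↦ indDiff E z * h z) =
      fun z ↦ indDiff E z * (ball (0 : Space N) 2).indicator h z := by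
    funext z
    by_cases hz : z ∈ ball (0 : Space N) 2
    · rw [Set.indicator_of_mem hz]
    · rw [hE.indDiff_eq_zero hu hz]; simp
  rw [h2]
  exact h1.bdd_mul (measurable_indDiff hEm).aestronglyMeasurable
    (.of_forall fun z => abs_indDiff_le E z)

theorem setIntegral_radial {E : Set (Space N)} {u : USphere N → ℝ} (hE : IsRadialGraph E u)
    (hu : ∀ x, |u x| ≤ 1 / 2) (h : Space N → ℝ) (x : USphere N) :
    ∫ r in Set.Ioi (0 : ℝ), r ^ (N - 1) * (indDiff E (r • (x : Space N)) * h (r • (x : Space N))) =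
      ∫ r in (1 : ℝ)..(1 + u x), r ^ (N - 1) * h (r • (x : Space N)) := by
  have hux := abs_le.1 (hu x)
  set g : ℝ → ℝ := fun r ↦ r ^ (N - 1) * h (r • (x : Space N)) with hg
  rcases le_total 0 (u x) with h0 | h0
  · rw [intervalIntegral.integral_of_le (by linarith), ← integral_Ico_eq_integral_Ioc,
      ← integral_indicator measurableSet_Ico, ← integral_indicator measurableSet_Ioi]
    congr 1
    funext r
    by_cases hr : 0 < r
    · rw [Set.indicator_of_mem (Set.mem_Ioi.2 hr), hE.indDiff_smul x hr]
      simp only [Set.indicator_apply, Set.mem_Iio, Set.mem_Ico, Pi.one_apply]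
      split_ifs <;> first | ring1 | (exfalso; grind)
    · rw [Set.indicator_of_notMem (by simpa using hr), Set.indicator_of_notMem]
      simp only [Set.mem_Ico, not_and_or]; left; linarith
  · rw [intervalIntegral.integral_of_ge (by linarith), ← integral_Ico_eq_integral_Ioc,
      ← integral_indicator measurableSet_Ico, ← integral_indicator measurableSet_Ioi,
      ← integral_neg]
    congr 1
    funext r
    by_cases hr : 0 < r
    · rw [Set.indicator_of_mem (Set.mem_Ioi.2 hr), hE.indDiff_smul x hr]
      simp only [Set.indicator_apply, Set.mem_Iio, Set.mem_Ico, Pi.one_apply]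
      split_ifs <;> first | ring1 | (exfalso; grind)
    · rw [Set.indicator_of_notMem (by simpa using hr), Set.indicator_of_notMem]
      · simp
      simp only [Set.mem_Ico, not_and_or]; left; linarith

/-- Polar coordinates for integrals over the signed symmetric difference with the ball. -/
theorem integral_indDiff_mul [Fact (2 ≤ N)] {E : Set (Space N)} {u : USphere N → ℝ}
    (hE : IsRadialGraph E u) (hEm : MeasurableSet E) (hu : ∀ x, |u x| ≤ 1 / 2) {h : Space N → ℝ}
    (hh : IntegrableOn h (ball 0 2)) :
    ∫ z, indDiff E z * h z =
      ∫ x : USphere N, (∫ r in (1 : ℝ)..(1 + u x), r ^ (N - 1) * h (r • (x : Space N)))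
        ∂(surf N) := by
  rw [integral_polar (integrable_indDiff_mul hE hEm hu hh)]
  exact integral_congr_ae (.of_forall fun x => setIntegral_radial hE hu h x)

theorem integrable_radial {E : Set (Space N)} {u : USphere N → ℝ}
    (hE : IsRadialGraph E u) (hEm : MeasurableSet E) (hu : ∀ x, |u x| ≤ 1 / 2) {h : Space N → ℝ}
    (hh : IntegrableOn h (ball 0 2)) :
    Integrable (fun x : USphere N ↦
      ∫ r in (1 : ℝ)..(1 + u x), r ^ (N - 1) * h (r • (x : Space N))) (surf N) :=
  (integrable_polar_left (integrable_indDiff_mul hE hEm hu hh)).congr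
    (.of_forall fun x => setIntegral_radial hE hu h x)

theorem ae_intervalIntegrable_radial {h : Space N → ℝ} (hh : IntegrableOn h (ball 0 2)) :
    ∀ᵐ x : USphere N ∂(surf N), ∀ t : ℝ, |t| ≤ 1 / 2 →
      IntervalIntegrable (fun r : ℝ ↦ r ^ (N - 1) * h (r • (x : Space N))) volume 1 (1 + t) := by
  have h1 : Integrable ((ball (0 : Space N) 2).indicator h) :=
    hh.integrable_indicator measurableSet_ball
  filter_upwards [ae_integrable_polar h1] with x hx t ht
  have ht' := abs_le.1 ht
  rw [intervalIntegrable_iff]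
  have hsub : Set.uIoc 1 (1 + t) ⊆ Set.Ioo (0 : ℝ) 2 := by
    intro r hr
    rcases Set.mem_uIoc.1 hr with h | h <;> constructor <;> linarith [h.1, h.2]
  refine (hx.mono_set (hsub.trans Set.Ioo_subset_Ioi_self)).congr_fun ?_ measurableSet_uIoc
  intro r hr
  have hr' := hsub hr
  have : r • (x : Space N) ∈ ball (0 : Space N) 2 := by
    rw [mem_ball_zero_iff, norm_smul, norm_coe, mul_one, Real.norm_of_nonneg hr'.1.le]
    exact hr'.2
  simp only [Set.indicator_of_mem this]

end Graph

section Rotation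

variable {N : ℕ}

/-- The action of a linear isometry on the unit sphere. -/
noncomputable def rot (g : Space N ≃ₗᵢ[ℝ] Space N) : USphere N ≃ₜ USphere N where
  toFun x := ⟨g x, by simp⟩
  invFun x := ⟨g.symm x, by simp⟩
  left_inv x := by simp
  right_inv x := by simp
  continuous_toFun := by fun_prop
  continuous_invFun := by fun_prop

@[simp]
theorem coe_rot (g : Space N ≃ₗᵢ[ℝ] Space N) (x : USphere N) : (rot g x : Space N) = g x := rfl

theorem measurePreserving_rot (g : Space N ≃ₗᵢ[ℝ] Space N) :
    MeasurePreserving (rot g) (surf N) (surf N) := by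
  refine ⟨(rot g).measurable, ?_⟩
  ext s hs
  rw [Measure.map_apply (rot g).measurable hs, Measure.toSphere_apply' _ hs,
    Measure.toSphere_apply' _ ((rot g).measurable hs),
    ← g.measurePreserving.measure_preimage_equiv (f := g.toMeasurableEquiv)
      (Set.Ioo (0 : ℝ) 1 • (Subtype.val '' s))]
  congr 2
  ext z
  simp only [Set.mem_smul, Set.mem_image, Set.mem_preimage]
  constructor
  · rintro ⟨r, hr, _, ⟨y, hy, rfl⟩, rfl⟩
    exact ⟨r, hr, _, ⟨rot g y, hy, rfl⟩, (map_smul g r (y : Space N)).symm⟩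
  · rintro ⟨r, hr, _, ⟨y, hy, rfl⟩, hz⟩
    refine ⟨r, hr, _, ⟨(rot g).symm y, by simpa using hy, rfl⟩, ?_⟩
    apply g.injective
    have : g ((rot g).symm y : Space N) = y := by
      rw [← coe_rot, Homeomorph.apply_symm_apply]
    rw [map_smul, this]
    exact hz

theorem integral_comp_rot (g : Space N ≃ₗᵢ[ℝ] Space N) (f : USphere N → ℝ) :
    ∫ x, f (rot g x) ∂(surf N) = ∫ x, f x ∂(surf N) :=
  (measurePreserving_rot g).integral_comp (rot g).measurableEmbedding f

theorem integral_comp_rot_prod (g : Space N ≃ₗᵢ[ℝ] Space N) (f : USphere N × USphere N → ℝ) :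
    ∫ p : USphere N × USphere N, f (rot g p.1, rot g p.2) ∂((surf N).prod (surf N)) =
      ∫ p, f p ∂((surf N).prod (surf N)) :=
  ((measurePreserving_rot g).prod (measurePreserving_rot g)).integral_comp
    ((rot g).prodCongr (rot g)).measurableEmbedding f

theorem exists_rot_eq (x y : USphere N) : ∃ g : Space N ≃ₗᵢ[ℝ] Space N, rot g x = y :=
  ⟨(ℝ ∙ ((x : Space N) - y))ᗮ.reflection, Subtype.ext (by
    simpa using Submodule.reflection_sub (by simp))⟩

/-- Zonal integrals do not depend on the pole. -/
theorem integral_zonal (F : ℝ → ℝ) (x y : USphere N) :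
    ∫ z : USphere N, F ‖(x : Space N) - z‖ ∂(surf N) =
      ∫ z : USphere N, F ‖(y : Space N) - z‖ ∂(surf N) := by
  obtain ⟨g, rfl⟩ := exists_rot_eq x y
  rw [← integral_comp_rot g (fun z => F ‖((rot g x : USphere N) : Space N) - z‖)]
  simp only [coe_rot, ← map_sub, LinearIsometryEquiv.norm_map]

theorem surf_ne_zero [Fact (2 ≤ N)] : surf N ≠ 0 := Measure.toSphere_ne_zero _

theorem surf_real_univ_pos [Fact (2 ≤ N)] : 0 < (surf N).real Set.univ := by
  rw [measureReal_def, ENNReal.toReal_pos_iff]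
  refine ⟨?_, measure_lt_top _ _⟩
  rw [pos_iff_ne_zero, Ne, Measure.measure_univ_eq_zero]
  exact surf_ne_zero

instance [Fact (2 ≤ N)] : Nonempty (USphere N) :=
  (NormedSpace.sphere_nonempty (x := (0 : Space N)) (r := 1)).2 zero_le_one |>.to_subtype

theorem surf_singleton [Fact (2 ≤ N)] (x : USphere N) : surf N {x} = 0 := by
  have hN : 2 ≤ N := Fact.out
  rw [Measure.toSphere_apply' _ (measurableSet_singleton x)]
  have : volume (Set.Ioo (0 : ℝ) 1 • (Subtype.val '' {x} : Set (Space N))) = 0 := by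
    refine measure_mono_null (t := ((ℝ ∙ (x : Space N) : Submodule ℝ (Space N)) : Set (Space N)))
      ?_ (Measure.addHaar_submodule _ _ ?_)
    · rintro _ ⟨r, -, _, ⟨y, rfl, rfl⟩, rfl⟩
      exact Submodule.mem_span_singleton.2 ⟨r, rfl⟩
    · intro h
      have h1 := finrank_span_singleton (K := ℝ) (v := (x : Space N))
        (by intro h0; have := norm_coe x; rw [h0] at this; simp at this)
      rw [h, finrank_top, finrank_space] at h1
      omega
  rw [this, mul_zero]

theorem ae_ne [Fact (2 ≤ N)] (x : USphere N) : ∀ᵐ y ∂(surf N), y ≠ x := by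
  rw [ae_iff]
  simpa using surf_singleton x

end Rotation

section Kernel

variable {N : ℕ} {α : ℝ}

theorem integrableOn_norm_rpow {b : ℝ} [Fact (2 ≤ N)] (hb : -(N : ℝ) < b) (R : ℝ) :
    IntegrableOn (fun y : Space N ↦ ‖y‖ ^ b) (ball 0 R) := by
  have hN : 2 ≤ N := Fact.out
  rw [integrableOn_fun_norm_addHaar volume (f := fun r => r ^ b), finrank_space]
  rcases le_or_gt R 0 with hR | hR
  · simp [Set.Ioo_eq_empty_of_le hR]
  have h1 : IntegrableOn (fun y : ℝ => y ^ ((N : ℝ) - 1 + b)) (Set.Ioo 0 R) := by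
    rw [intervalIntegral.integrableOn_Ioo_rpow_iff hR]
    linarith
  refine h1.congr_fun ?_ measurableSet_Ioo
  intro y hy
  have : ((N - 1 : ℕ) : ℝ) = (N : ℝ) - 1 := by
    rw [Nat.cast_sub (by omega)]; simp
  simp only [smul_eq_mul]
  rw [Real.rpow_add hy.1, ← this, Real.rpow_natCast]

theorem integrableOn_norm_sub_rpow {b : ℝ} [Fact (2 ≤ N)] (hb : -(N : ℝ) < b) (R : ℝ)
    (x : Space N) : IntegrableOn (fun y : Space N ↦ ‖x - y‖ ^ b) (ball 0 R) := by
  have h1 := integrableOn_norm_rpow (N := N) hb (‖x‖ + R)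
  have h2 := (integrable_indicator_iff measurableSet_ball).2 h1
  have h3 := h2.comp_sub_left x
  refine (integrable_indicator_iff measurableSet_ball).1 ?_
  refine (h3.indicator (s := ball (0 : Space N) R) measurableSet_ball).congr
    (.of_forall fun y => ?_)
  by_cases hy : y ∈ ball (0 : Space N) R
  · rw [Set.indicator_of_mem hy, Set.indicator_of_mem hy, Set.indicator_of_mem]
    rw [mem_ball_zero_iff] at hy ⊢
    exact (norm_sub_le _ _).trans_lt (by linarith)
  · rw [Set.indicator_of_notMem hy, Set.indicator_of_notMem hy]

/-- The Riesz kernel restricted to the sphere. -/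
noncomputable def kern (N : ℕ) (α : ℝ) (x y : USphere N) : ℝ :=
  ‖(x : Space N) - y‖ ^ (α - (N : ℝ))

theorem kern_nonneg (x y : USphere N) : 0 ≤ kern N α x y := Real.rpow_nonneg (norm_nonneg _) _

theorem kern_comm (x y : USphere N) : kern N α x y = kern N α y x := by
  simp only [kern, norm_sub_rev]

theorem kern_rot (g : Space N ≃ₗᵢ[ℝ] Space N) (x y : USphere N) :
    kern N α (rot g x) (rot g y) = kern N α x y := by
  simp only [kern, coe_rot, ← map_sub, LinearIsometryEquiv.norm_map]

theorem measurable_kern : Measurable (fun p : USphere N × USphere N ↦ kern N α p.1 p.2) := by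
  unfold kern; fun_prop

theorem measurable_kern_right (x : USphere N) : Measurable (fun y ↦ kern N α x y) := by
  unfold kern; fun_prop

theorem integrable_kern [Fact (2 ≤ N)] (hα₁ : 1 < α) (hα₂ : α < N) (x : USphere N) :
    Integrable (fun y ↦ kern N α x y) (surf N) := by
  have hh := integrableOn_norm_sub_rpow (N := N) (b := α - N - 1) (by linarith) 2 (x : Space N)
  have h1 : Integrable ((ball (0 : Space N) 2).indicator
      (fun y : Space N ↦ ‖(x : Space N) - y‖ ^ (α - N - 1))) :=
    hh.integrable_indicator measurableSet_ball
  have h2 := integrable_polar_left h1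
  set c : ℝ := 2 ^ (α - N - 1) / 4 with hc
  have hc0 : 0 < c := by positivity
  have key : ∀ᵐ y ∂(surf N), ‖kern N α x y‖ ≤ c⁻¹ *
      ∫ r in Set.Ioi (0 : ℝ), r ^ (N - 1) * (ball (0 : Space N) 2).indicator
        (fun y : Space N ↦ ‖(x : Space N) - y‖ ^ (α - N - 1)) (r • (y : Space N)) := by
    filter_upwards [ae_integrable_polar h1, ae_ne x] with y hy hxy
    rw [Real.norm_of_nonneg (kern_nonneg _ _), ← div_eq_inv_mul, le_div_iff₀ hc0]
    set q := ‖(x : Space N) - y‖ with hq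
    have hq0 : 0 < q := norm_pos_iff.2 (sub_ne_zero.2 fun h => hxy (Subtype.ext h.symm))
    have hq2 : q ≤ 2 := by
      have := norm_sub_le (x : Space N) y
      rw [norm_coe, norm_coe] at this; linarith
    have h3 : ∫ r in Set.Ioc (1 : ℝ) (1 + q / 4), (2 * q) ^ (α - N - 1) ≤
        ∫ r in Set.Ioi (0 : ℝ), r ^ (N - 1) * (ball (0 : Space N) 2).indicator
        (fun y : Space N ↦ ‖(x : Space N) - y‖ ^ (α - N - 1)) (r • (y : Space N)) := by
      have hsub : Set.Ioc (1 : ℝ) (1 + q / 4) ⊆ Set.Ioi 0 := fun r hr => by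
        have := hr.1
        simp only [Set.mem_Ioi]; linarith
      refine le_trans ?_ (setIntegral_mono_set hy ?_ hsub.eventuallyLE)
      · refine setIntegral_mono_on (integrableOn_const (by simp)) (hy.mono_set hsub)
          measurableSet_Ioc fun r hr => ?_
        have hr1 := hr.1
        have hr2 := hr.2
        have hmem : r • (y : Space N) ∈ ball (0 : Space N) 2 := by
          rw [mem_ball_zero_iff, norm_smul, norm_coe, Real.norm_of_nonneg (by linarith)]
          linarith
        rw [Set.indicator_of_mem hmem]
        have h5 : ‖(x : Space N) - r • (y : Space N)‖ ≤ 2 * q := by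
          have : (x : Space N) - r • (y : Space N) = (x - y) - (r - 1) • (y : Space N) := by module
          rw [this]
          refine (norm_sub_le _ _).trans ?_
          rw [norm_smul, norm_coe, Real.norm_of_nonneg (by linarith)]
          linarith
        have h6 : 0 < ‖(x : Space N) - r • (y : Space N)‖ := by
          rw [norm_pos_iff, sub_ne_zero]
          intro h
          have h' := congrArg norm h
          rw [norm_smul, norm_coe, norm_coe, Real.norm_of_nonneg (by linarith)] at h'
          linarith
        calc (2 * q) ^ (α - N - 1) ≤ ‖(x : Space N) - r • (y : Space N)‖ ^ (α - N - 1) :=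
              Real.rpow_le_rpow_of_nonpos h6 h5 (by linarith)
          _ ≤ _ := le_mul_of_one_le_left (by positivity) (one_le_pow₀ hr1.le)
      · filter_upwards [ae_restrict_mem measurableSet_Ioi] with r hr
        simp only [Set.mem_Ioi] at hr
        exact mul_nonneg (by positivity) (Set.indicator_nonneg (fun _ _ => by positivity) _)
    refine le_trans (le_of_eq ?_) h3
    rw [setIntegral_const, measureReal_def, Real.volume_Ioc, ENNReal.toReal_ofReal (by linarith),
      Real.mul_rpow (by norm_num) hq0.le, kern, ← hq, hc, smul_eq_mul]
    have : q ^ (α - N) = q ^ (α - N - 1) * q := by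
      rw [← Real.rpow_add_one hq0.ne']; ring_nf
    rw [this]; ring
  exact (h2.const_mul c⁻¹).mono' (measurable_kern_right x).aestronglyMeasurable key

theorem integrable_kern_prod [Fact (2 ≤ N)] (hα₁ : 1 < α) (hα₂ : α < N) :
    Integrable (fun p : USphere N × USphere N ↦ kern N α p.1 p.2) ((surf N).prod (surf N)) := by
  rw [integrable_prod_iff measurable_kern.aestronglyMeasurable]
  refine ⟨.of_forall fun x => integrable_kern hα₁ hα₂ x, ?_⟩
  have x₀ : USphere N := Classical.arbitrary _
  have : (fun x : USphere N ↦ ∫ y, ‖kern N α x y‖ ∂(surf N)) =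
      fun _ => ∫ y, ‖kern N α x₀ y‖ ∂(surf N) := by
    funext x
    exact integral_zonal (fun r => ‖r ^ (α - (N : ℝ))‖) x x₀
  simp only [this]
  exact integrable_const _

end Kernel

section Forms

variable {N : ℕ} {α : ℝ}

/-- Bounded measurable functions on the sphere. -/
structure IsBM (u : USphere N → ℝ) : Prop where
  measurable : Measurable u
  bdd : ∃ C, ∀ x, |u x| ≤ C

namespace IsBM

variable {u v : USphere N → ℝ}

theorem const (c : ℝ) : IsBM (fun _ : USphere N ↦ c) := ⟨measurable_const, |c|, fun _ => le_rfl⟩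

theorem add (hu : IsBM u) (hv : IsBM v) : IsBM (fun x ↦ u x + v x) := by
  obtain ⟨C, hC⟩ := hu.bdd
  obtain ⟨D, hD⟩ := hv.bdd
  exact ⟨hu.measurable.add hv.measurable, C + D,
    fun x => (abs_add_le _ _).trans (add_le_add (hC x) (hD x))⟩

theorem mul (hu : IsBM u) (hv : IsBM v) : IsBM (fun x ↦ u x * v x) := by
  obtain ⟨C, hC⟩ := hu.bdd
  obtain ⟨D, hD⟩ := hv.bdd
  refine ⟨hu.measurable.mul hv.measurable, C * D, fun x => ?_⟩
  rw [abs_mul]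
  exact mul_le_mul (hC x) (hD x) (abs_nonneg _) ((abs_nonneg _).trans (hC x))

theorem const_mul (hu : IsBM u) (c : ℝ) : IsBM (fun x ↦ c * u x) := (const c).mul hu

theorem sub (hu : IsBM u) (hv : IsBM v) : IsBM (fun x ↦ u x - v x) := by
  simpa [sub_eq_add_neg] using hu.add (hv.const_mul (-1))

theorem sq (hu : IsBM u) : IsBM (fun x ↦ u x ^ 2) := by simpa [pow_two] using hu.mul hu

theorem comp_rot (hu : IsBM u) (g : Space N ≃ₗᵢ[ℝ] Space N) : IsBM (fun x ↦ u (rot g x)) :=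
  ⟨hu.measurable.comp (rot g).measurable, hu.bdd.imp fun _ h _ => h _⟩

theorem abs (hu : IsBM u) : IsBM (fun x ↦ |u x|) :=
  ⟨hu.measurable.abs, hu.bdd.imp fun _ h x => by simpa using h x⟩

theorem integrable (hu : IsBM u) : Integrable u (surf N) := by
  obtain ⟨C, hC⟩ := hu.bdd
  exact .of_bound hu.measurable.aestronglyMeasurable C (.of_forall hC)

theorem inner (e : Space N) : IsBM (fun x : USphere N ↦ inner ℝ (x : Space N) e) := by
  refine ⟨by fun_prop, ‖e‖, fun x => ?_⟩
  simpa [norm_coe] using abs_real_inner_le_norm (x : Space N) e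

theorem integrable_mul_left {f : USphere N → ℝ} (hu : IsBM u) (hf : Integrable f (surf N)) :
    Integrable (fun x ↦ f x * u x) (surf N) := by
  obtain ⟨C, hC⟩ := hu.bdd
  exact hf.mul_bdd hu.measurable.aestronglyMeasurable (.of_forall hC)

theorem integrable_prod_mul {f : USphere N × USphere N → ℝ} (hu : IsBM u) (hv : IsBM v)
    (hf : Integrable f ((surf N).prod (surf N))) :
    Integrable (fun p ↦ f p * (u p.1 * v p.2)) ((surf N).prod (surf N)) := by
  obtain ⟨C, hC⟩ := hu.bdd
  obtain ⟨D, hD⟩ := hv.bdd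
  refine hf.mul_bdd (c := C * D) ?_ (.of_forall fun p => ?_)
  · exact ((hu.measurable.comp measurable_fst).mul
      (hv.measurable.comp measurable_snd)).aestronglyMeasurable
  · rw [norm_mul]
    exact mul_le_mul (hC _) (hD _) (norm_nonneg _) ((abs_nonneg _).trans (hC p.1))

theorem integrable_prod (hu : IsBM u) (hv : IsBM v) :
    Integrable (fun p : USphere N × USphere N ↦ u p.1 * v p.2) ((surf N).prod (surf N)) := by
  simpa using hu.integrable_prod_mul hv (integrable_const (1 : ℝ))

end IsBM

/-- The squared `L²` norm on the sphere. -/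
noncomputable def normSq (u : USphere N → ℝ) : ℝ := ∫ x, u x ^ 2 ∂(surf N)

/-- The quadratic form of the Riesz kernel on the sphere. -/
noncomputable def kform (α : ℝ) (u : USphere N → ℝ) : ℝ :=
  ∫ p : USphere N × USphere N, kern N α p.1 p.2 * (u p.1 * u p.2) ∂((surf N).prod (surf N))

/-- The eigenvalue of the Riesz kernel on constants. -/
noncomputable def eigZero (N : ℕ) [Fact (2 ≤ N)] (α : ℝ) : ℝ :=
  ∫ y, kern N α (Classical.arbitrary _) y ∂(surf N)

/-- The eigenvalue of the Riesz kernel on linear functions. -/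
noncomputable def eigOne (N : ℕ) [Fact (2 ≤ N)] (α : ℝ) : ℝ :=
  ∫ y : USphere N, kern N α (Classical.arbitrary _) y *
    inner ℝ (y : Space N) (Classical.arbitrary (USphere N) : USphere N) ∂(surf N)

theorem integral_kern [Fact (2 ≤ N)] (x : USphere N) :
    ∫ y, kern N α x y ∂(surf N) = eigZero N α :=
  integral_zonal (fun r => r ^ (α - (N : ℝ))) x _

theorem norm_sub_sq_sphere (x y : USphere N) :
    ‖(x : Space N) - y‖ ^ 2 = 2 - 2 * inner ℝ (x : Space N) y := by
  rw [norm_sub_sq_real, norm_coe, norm_coe]; ring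

theorem inner_eq_zonal (x y : USphere N) :
    inner ℝ (y : Space N) x = 1 - ‖(x : Space N) - y‖ ^ 2 / 2 := by
  rw [norm_sub_sq_sphere, real_inner_comm]; ring

theorem integral_kern_inner_self [Fact (2 ≤ N)] (x : USphere N) :
    ∫ y : USphere N, kern N α x y * inner ℝ (y : Space N) x ∂(surf N) = eigOne N α := by
  simp only [eigOne, inner_eq_zonal, kern]
  exact integral_zonal (fun r => r ^ (α - (N : ℝ)) * (1 - r ^ 2 / 2)) x _

theorem inner_reflection (v y : Space N) :
    inner ℝ ((ℝ ∙ v)ᗮ.reflection y) v = - inner ℝ y v := by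
  have h := LinearIsometryEquiv.inner_map_map (ℝ ∙ v)ᗮ.reflection y v
  rw [Submodule.reflection_orthogonalComplement_singleton_eq_neg, inner_neg_right] at h
  linarith

/-- Linear functions are eigenfunctions of the Riesz kernel. -/
theorem integral_kern_inner [Fact (2 ≤ N)] (hα₁ : 1 < α) (hα₂ : α < N) (x : USphere N)
    (e : Space N) :
    ∫ y : USphere N, kern N α x y * inner ℝ (y : Space N) e ∂(surf N) =
      eigOne N α * inner ℝ (x : Space N) e := by
  set v : Space N := e - inner ℝ (x : Space N) e • (x : Space N) with hv
  have hxv : inner ℝ (x : Space N) v = 0 := by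
    rw [hv, inner_sub_right, inner_smul_right, real_inner_self_eq_norm_sq, norm_coe]; ring
  have hRx : rot (ℝ ∙ v)ᗮ.reflection x = x := by
    apply Subtype.ext
    rw [coe_rot]
    apply Submodule.reflection_mem_subspace_eq_self
    rw [Submodule.mem_orthogonal_singleton_iff_inner_left]
    exact hxv
  have h0 : ∫ y : USphere N, kern N α x y * inner ℝ (y : Space N) v ∂(surf N) = 0 := by
    have h1 := integral_comp_rot (ℝ ∙ v)ᗮ.reflection
      (fun y : USphere N ↦ kern N α x y * inner ℝ (y : Space N) v)
    have h2 : ∀ y : USphere N, kern N α x (rot (ℝ ∙ v)ᗮ.reflection y) = kern N α x y := by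
      intro y
      conv_lhs => rw [← hRx]
      rw [kern_rot]
    simp only [h2, coe_rot, inner_reflection, mul_neg, integral_neg] at h1
    linarith
  have h3 : ∀ y : USphere N, kern N α x y * inner ℝ (y : Space N) e =
      kern N α x y * inner ℝ (y : Space N) v +
        inner ℝ (x : Space N) e * (kern N α x y * inner ℝ (y : Space N) x) := by
    intro y
    rw [hv, inner_sub_right, inner_smul_right]; ring
  simp only [h3]
  rw [integral_add ((IsBM.inner v).integrable_mul_left (integrable_kern hα₁ hα₂ x))
    (((IsBM.inner (x : Space N)).integrable_mul_left (integrable_kern hα₁ hα₂ x)).const_mul _), h0,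
    integral_const_mul, integral_kern_inner_self]
  ring

end Forms

section OddGap

variable {N : ℕ} {α : ℝ}

theorem rpow_neg_sub_ge {a b γ : ℝ} (ha : 0 < a) (hab : a ≤ b) (hb : b ≤ 4) (hγ : 0 < γ) :
    γ * 4 ^ (-γ - 1) * (b - a) ≤ a ^ (-γ) - b ^ (-γ) := by
  have hb0 : 0 < b := ha.trans_le hab
  have h1 : a ^ (-γ) = b ^ (-γ) * Real.exp (-γ * Real.log (a / b)) := by
    rw [Real.rpow_def_of_pos ha, Real.rpow_def_of_pos hb0, ← Real.exp_add,
      Real.log_div ha.ne' hb0.ne']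
    ring_nf
  have h2 : 1 + γ * (1 - a / b) ≤ Real.exp (-γ * Real.log (a / b)) := by
    have h3 := Real.add_one_le_exp (-γ * Real.log (a / b))
    have h4 := Real.log_le_sub_one_of_pos (div_pos ha hb0)
    nlinarith
  have h5 : (4 : ℝ) ^ (-γ - 1) ≤ b ^ (-γ - 1) :=
    Real.rpow_le_rpow_of_nonpos hb0 hb (by linarith)
  have h6 : b ^ (-γ) = b ^ (-γ - 1) * b := by
    rw [← Real.rpow_add_one hb0.ne']; ring_nf
  have h7 : 0 < b ^ (-γ) := Real.rpow_pos_of_pos hb0 _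
  calc γ * 4 ^ (-γ - 1) * (b - a) ≤ γ * b ^ (-γ - 1) * (b - a) := by
        have : 0 ≤ b - a := by linarith
        gcongr
    _ = b ^ (-γ) * (γ * (1 - a / b)) := by rw [h6]; field_simp
    _ ≤ b ^ (-γ) * (Real.exp (-γ * Real.log (a / b)) - 1) := by
        apply mul_le_mul_of_nonneg_left _ h7.le; linarith
    _ = _ := by rw [h1]; ring

/-- The constant in the monotonicity of the odd part of the Riesz kernel. -/
noncomputable def gapConst (N : ℕ) (α : ℝ) : ℝ :=
  ((N : ℝ) - α) * 4 ^ (-(((N : ℝ) - α) / 2) - 1)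

theorem gapConst_pos (hα₂ : α < N) : 0 < gapConst N α := by
  have : 0 < (N : ℝ) - α := by linarith
  unfold gapConst; positivity

theorem kern_eq_rpow_sq (x y : USphere N) :
    kern N α x y = (‖(x : Space N) - y‖ ^ 2) ^ (-(((N : ℝ) - α) / 2)) := by
  rw [kern, ← Real.rpow_natCast, ← Real.rpow_mul (norm_nonneg _)]
  congr 1
  push_cast; ring

/-- The odd part of the Riesz kernel under the reflection in `eᗮ`. -/
noncomputable def oddKern (N : ℕ) (α : ℝ) (e : Space N) (x y : USphere N) : ℝ :=
  (kern N α x y - kern N α x (rot (ℝ ∙ e)ᗮ.reflection y)) / 2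

theorem rot_reflection_rot (e : Space N) (x : USphere N) :
    rot (ℝ ∙ e)ᗮ.reflection (rot (ℝ ∙ e)ᗮ.reflection x) = x := by
  apply Subtype.ext; simp

theorem kern_rot_left (e : Space N) (x y : USphere N) :
    kern N α (rot (ℝ ∙ e)ᗮ.reflection x) y = kern N α x (rot (ℝ ∙ e)ᗮ.reflection y) := by
  conv_lhs => rw [← rot_reflection_rot e y]
  rw [kern_rot]

theorem oddKern_comm (e : Space N) (x y : USphere N) :
    oddKern N α e x y = oddKern N α e y x := by
  unfold oddKern
  rw [kern_comm x y, kern_comm x (rot _ y), kern_rot_left]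

theorem oddKern_rot (e : Space N) (x y : USphere N) :
    oddKern N α e x (rot (ℝ ∙ e)ᗮ.reflection y) = - oddKern N α e x y := by
  unfold oddKern
  rw [rot_reflection_rot]; ring

theorem norm_sub_reflection_sq {e : Space N} (he : ‖e‖ = 1) (x y : USphere N) :
    ‖(x : Space N) - rot (ℝ ∙ e)ᗮ.reflection y‖ ^ 2 =
      ‖(x : Space N) - y‖ ^ 2 + 4 * (inner ℝ (x : Space N) e * inner ℝ (y : Space N) e) := by
  rw [norm_sub_sq_sphere, norm_sub_sq_sphere, coe_rot, Submodule.reflection_orthogonal_apply,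
    Submodule.reflection_singleton_apply, he]
  simp only [two_nsmul, inner_neg_right, inner_sub_right, inner_add_right, inner_smul_right,
    real_inner_comm e (y : Space N), RCLike.ofReal_one, one_pow, div_one]
  ring

theorem oddKern_ge (hα₂ : α < N) {e : Space N} (he : ‖e‖ = 1) {x y : USphere N} (hxy : x ≠ y)
    (h : 0 ≤ inner ℝ (x : Space N) e * inner ℝ (y : Space N) e) :
    gapConst N α * (inner ℝ (x : Space N) e * inner ℝ (y : Space N) e) ≤ oddKern N α e x y := by
  have h1 : 0 < ‖(x : Space N) - y‖ ^ 2 := by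
    have : (x : Space N) - y ≠ 0 := sub_ne_zero.2 fun h => hxy (Subtype.ext h)
    positivity
  have h2 := norm_sub_reflection_sq he x y
  have h3 : ‖(x : Space N) - rot (ℝ ∙ e)ᗮ.reflection y‖ ^ 2 ≤ 4 := by
    have := norm_sub_le (x : Space N) (rot (ℝ ∙ e)ᗮ.reflection y)
    rw [norm_coe, norm_coe] at this
    nlinarith [norm_nonneg ((x : Space N) - rot (ℝ ∙ e)ᗮ.reflection y)]
  have h4 := rpow_neg_sub_ge h1 (by linarith) h3 (γ := ((N : ℝ) - α) / 2) (by linarith)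
  rw [oddKern, kern_eq_rpow_sq, kern_eq_rpow_sq, gapConst]
  rw [h2] at h4 ⊢
  linarith

theorem div_oddKern_ge (hα₂ : α < N) {e : Space N} (he : ‖e‖ = 1) {x y : USphere N} (hxy : x ≠ y)
    (hxy' : x ≠ rot (ℝ ∙ e)ᗮ.reflection y)
    (h : inner ℝ (x : Space N) e * inner ℝ (y : Space N) e ≠ 0) :
    gapConst N α ≤ oddKern N α e x y / (inner ℝ (x : Space N) e * inner ℝ (y : Space N) e) := by
  rcases lt_or_gt_of_ne h with h0 | h0
  · have h1 := oddKern_ge hα₂ he hxy' (by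
      rw [coe_rot, inner_reflection]; linarith)
    rw [oddKern_rot, coe_rot, inner_reflection] at h1
    rw [le_div_iff_of_neg h0]; linarith
  · rw [le_div_iff₀ h0]
    exact oddKern_ge hα₂ he hxy h0.le

theorem integrable_oddKern [Fact (2 ≤ N)] (hα₁ : 1 < α) (hα₂ : α < N) (e : Space N)
    (x : USphere N) : Integrable (fun y ↦ oddKern N α e x y) (surf N) :=
  ((integrable_kern hα₁ hα₂ x).sub ((measurePreserving_rot _).integrable_comp_of_integrable
    (integrable_kern hα₁ hα₂ x))).div_const 2

theorem integral_oddKern_inner [Fact (2 ≤ N)] (hα₁ : 1 < α) (hα₂ : α < N) (e : Space N)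
    (x : USphere N) :
    ∫ y : USphere N, oddKern N α e x y * inner ℝ (y : Space N) e ∂(surf N) =
      eigOne N α * inner ℝ (x : Space N) e := by
  have h1 := integral_comp_rot (ℝ ∙ e)ᗮ.reflection
      (fun y : USphere N ↦ kern N α x y * inner ℝ (y : Space N) e)
  simp only [coe_rot, inner_reflection, mul_neg, integral_neg] at h1
  have h2 : ∀ y : USphere N, oddKern N α e x y * inner ℝ (y : Space N) e =
      (kern N α x y * inner ℝ (y : Space N) e -
        kern N α x (rot (ℝ ∙ e)ᗮ.reflection y) * inner ℝ (y : Space N) e) / 2 := by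
    intro y; unfold oddKern; ring
  simp only [h2]
  have h3 : Integrable (fun y : USphere N ↦
      kern N α x (rot (ℝ ∙ e)ᗮ.reflection y) * inner ℝ (y : Space N) e) (surf N) :=
    (IsBM.inner e).integrable_mul_left ((measurePreserving_rot _).integrable_comp_of_integrable
      (integrable_kern hα₁ hα₂ x))
  have h4 := integral_kern_inner hα₁ hα₂ x e
  rw [integral_div, integral_sub
    ((IsBM.inner e).integrable_mul_left (integrable_kern hα₁ hα₂ x)) h3]
  linarith

theorem integrable_kern_prod_rot [Fact (2 ≤ N)] (hα₁ : 1 < α) (hα₂ : α < N)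
    (g : Space N ≃ₗᵢ[ℝ] Space N) :
    Integrable (fun p : USphere N × USphere N ↦ kern N α p.1 (rot g p.2))
      ((surf N).prod (surf N)) :=
  ((MeasurePreserving.id _).prod (measurePreserving_rot g)).integrable_comp_of_integrable
    (integrable_kern_prod hα₁ hα₂)

theorem kform_eq_oddKern [Fact (2 ≤ N)] (hα₁ : 1 < α) (hα₂ : α < N) (e : Space N)
    {u : USphere N → ℝ} (hu : IsBM u) (hodd : ∀ x, u (rot (ℝ ∙ e)ᗮ.reflection x) = -u x) :
    ∫ p : USphere N × USphere N, oddKern N α e p.1 p.2 * (u p.1 * u p.2)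
      ∂((surf N).prod (surf N)) = kform α u := by
  have h2 : ∀ p : USphere N × USphere N, oddKern N α e p.1 p.2 * (u p.1 * u p.2) =
      (kern N α p.1 p.2 * (u p.1 * u p.2) -
        kern N α p.1 (rot (ℝ ∙ e)ᗮ.reflection p.2) * (u p.1 * u p.2)) / 2 := by
    intro p; unfold oddKern; ring
  have h3 := ((MeasurePreserving.id (surf N)).prod
    (measurePreserving_rot (ℝ ∙ e)ᗮ.reflection)).integral_comp
    ((Homeomorph.refl _).prodCongr (rot (ℝ ∙ e)ᗮ.reflection)).measurableEmbedding
    (fun p : USphere N × USphere N ↦ kern N α p.1 p.2 * (u p.1 * u p.2))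
  simp only [Prod.map_fst, Prod.map_snd, id, hodd, mul_neg, integral_neg] at h3
  simp only [h2]
  rw [integral_div, integral_sub (hu.integrable_prod_mul hu (integrable_kern_prod hα₁ hα₂))
    (hu.integrable_prod_mul hu (integrable_kern_prod_rot hα₁ hα₂ _))]
  rw [kform]
  linarith

theorem oddKern_ground_state (hα₂ : α < N) {e : Space N} (he : ‖e‖ = 1)
    {u : USphere N → ℝ} (hodd : ∀ x, u (rot (ℝ ∙ e)ᗮ.reflection x) = -u x) (x y : USphere N) :
    gapConst N α * (u x * inner ℝ (y : Space N) e - u y * inner ℝ (x : Space N) e) ^ 2 ≤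
      oddKern N α e x y * (inner ℝ (y : Space N) e / inner ℝ (x : Space N) e * u x ^ 2) +
        oddKern N α e y x * (inner ℝ (x : Space N) e / inner ℝ (y : Space N) e * u y ^ 2) -
        2 * (oddKern N α e x y * (u x * u y)) := by
  have hzero : ∀ z : USphere N, inner ℝ (z : Space N) e = 0 → u z = 0 := by
    intro z hz
    have : rot (ℝ ∙ e)ᗮ.reflection z = z := by
      apply Subtype.ext
      rw [coe_rot]
      apply Submodule.reflection_mem_subspace_eq_self
      rwa [Submodule.mem_orthogonal_singleton_iff_inner_left]
    have h := hodd z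
    rw [this] at h
    linarith
  rw [oddKern_comm e y x]
  by_cases hx : inner ℝ (x : Space N) e = 0
  · simp [hx, hzero x hx]
  by_cases hy : inner ℝ (y : Space N) e = 0
  · simp [hy, hzero y hy]
  have h1 : oddKern N α e x y * (inner ℝ (y : Space N) e / inner ℝ (x : Space N) e * u x ^ 2) +
        oddKern N α e x y * (inner ℝ (x : Space N) e / inner ℝ (y : Space N) e * u y ^ 2) -
        2 * (oddKern N α e x y * (u x * u y)) =
      oddKern N α e x y / (inner ℝ (x : Space N) e * inner ℝ (y : Space N) e) *
        (u x * inner ℝ (y : Space N) e - u y * inner ℝ (x : Space N) e) ^ 2 := by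
    field_simp
    ring
  rw [h1]
  by_cases hxy : x = y
  · subst hxy; simp
  by_cases hxy' : x = rot (ℝ ∙ e)ᗮ.reflection y
  · have : u x * inner ℝ (y : Space N) e - u y * inner ℝ (x : Space N) e = 0 := by
      rw [hxy', hodd, coe_rot, inner_reflection]; ring
    simp [this]
  · exact mul_le_mul_of_nonneg_right (div_oddKern_ge hα₂ he hxy hxy' (mul_ne_zero hx hy))
      (sq_nonneg _)

theorem measurable_oddKern (e : Space N) :
    Measurable (fun p : USphere N × USphere N ↦ oddKern N α e p.1 p.2) := by
  unfold oddKern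
  exact (measurable_kern.sub (measurable_kern.comp
    (measurable_fst.prodMk ((rot _).measurable.comp measurable_snd)))).div_const 2

theorem integral_oddKern_weight [Fact (2 ≤ N)] (hα₁ : 1 < α) (hα₂ : α < N) {e : Space N}
    {u : USphere N → ℝ} (hodd : ∀ x, u (rot (ℝ ∙ e)ᗮ.reflection x) = -u x) (x : USphere N) :
    ∫ y : USphere N, oddKern N α e x y *
      (inner ℝ (y : Space N) e / inner ℝ (x : Space N) e * u x ^ 2) ∂(surf N) =
      eigOne N α * u x ^ 2 := by
  have h1 : ∀ y : USphere N, oddKern N α e x y *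
      (inner ℝ (y : Space N) e / inner ℝ (x : Space N) e * u x ^ 2) =
      oddKern N α e x y * inner ℝ (y : Space N) e * (u x ^ 2 / inner ℝ (x : Space N) e) := by
    intro y; ring
  simp only [h1]
  rw [integral_mul_const, integral_oddKern_inner hα₁ hα₂]
  by_cases hx : inner ℝ (x : Space N) e = 0
  · have : rot (ℝ ∙ e)ᗮ.reflection x = x := by
      apply Subtype.ext
      rw [coe_rot]
      apply Submodule.reflection_mem_subspace_eq_self
      rwa [Submodule.mem_orthogonal_singleton_iff_inner_left]
    have h := hodd x
    rw [this] at h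
    have h0 : u x = 0 := by linarith
    simp [h0]
  · field_simp

theorem integrable_oddKern_weight [Fact (2 ≤ N)] (hα₁ : 1 < α) (hα₂ : α < N) {e : Space N}
    (he : ‖e‖ = 1) {u : USphere N → ℝ} (hu : IsBM u)
    (hodd : ∀ x, u (rot (ℝ ∙ e)ᗮ.reflection x) = -u x) :
    Integrable (fun p : USphere N × USphere N ↦ oddKern N α e p.1 p.2 *
      (inner ℝ (p.2 : Space N) e / inner ℝ (p.1 : Space N) e * u p.1 ^ 2))
      ((surf N).prod (surf N)) := by
  have hm : Measurable (fun p : USphere N × USphere N ↦ oddKern N α e p.1 p.2 *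
      (inner ℝ (p.2 : Space N) e / inner ℝ (p.1 : Space N) e * u p.1 ^ 2)) := by
    have h1 := (IsBM.inner (N := N) e).measurable
    exact (measurable_oddKern e).mul (((h1.comp measurable_snd).div (h1.comp measurable_fst)).mul
      ((hu.measurable.comp measurable_fst).pow_const 2))
  rw [integrable_prod_iff hm.aestronglyMeasurable]
  constructor
  · refine .of_forall fun x => ?_
    have := (((IsBM.inner e).const_mul (inner ℝ (x : Space N) e)⁻¹).mul
      (IsBM.const (u x ^ 2))).integrable_mul_left (integrable_oddKern hα₁ hα₂ e x)
    simpa [div_eq_inv_mul] using this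
  · refine (hu.sq.integrable.const_mul (eigOne N α)).congr (.of_forall fun x => ?_)
    simp only
    rw [← integral_oddKern_weight hα₁ hα₂ hodd x]
    refine integral_congr_ae ?_
    filter_upwards [ae_ne x, ae_ne (rot (ℝ ∙ e)ᗮ.reflection x)] with y hy hy'
    symm
    apply Real.norm_of_nonneg
    by_cases hx0 : inner ℝ (x : Space N) e = 0
    · simp [hx0]
    by_cases hy0 : inner ℝ (y : Space N) e = 0
    · simp [hy0]
    have h1 := div_oddKern_ge (α := α) hα₂ he hy.symm (fun h => hy' (by
      rw [h, rot_reflection_rot])) (mul_ne_zero hx0 hy0)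
    have h2 := (gapConst_pos hα₂).le.trans h1
    have h3 : oddKern N α e x y * (inner ℝ (y : Space N) e / inner ℝ (x : Space N) e * u x ^ 2) =
        oddKern N α e x y / (inner ℝ (x : Space N) e * inner ℝ (y : Space N) e) *
          (inner ℝ (y : Space N) e * u x) ^ 2 := by
      field_simp
    rw [h3]
    exact mul_nonneg h2 (sq_nonneg _)

/-- Spectral gap of the Riesz kernel on functions that are odd under a reflection. -/
theorem odd_gap [Fact (2 ≤ N)] (hα₁ : 1 < α) (hα₂ : α < N) {e : Space N}
    (he : ‖e‖ = 1) {u : USphere N → ℝ} (hu : IsBM u)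
    (hodd : ∀ x, u (rot (ℝ ∙ e)ᗮ.reflection x) = -u x) :
    gapConst N α * (normSq u * normSq (fun x : USphere N ↦ inner ℝ (x : Space N) e) -
      (∫ x : USphere N, u x * inner ℝ (x : Space N) e ∂(surf N)) ^ 2) ≤
      eigOne N α * normSq u - kform α u := by
  set t : USphere N → ℝ := fun x ↦ inner ℝ (x : Space N) e with ht
  have htb : IsBM t := IsBM.inner e
  set P : USphere N × USphere N → ℝ := fun p ↦ oddKern N α e p.1 p.2 *
      (t p.2 / t p.1 * u p.1 ^ 2) with hP
  set μ := (surf N).prod (surf N) with hμ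
  have hPi : Integrable P μ := integrable_oddKern_weight hα₁ hα₂ he hu hodd
  have hPv : ∫ p, P p ∂μ = eigOne N α * normSq u := by
    rw [integral_prod _ hPi]
    simp only [hP, ht, integral_oddKern_weight hα₁ hα₂ hodd]
    rw [integral_const_mul, normSq]
  have hPs : Integrable (fun p ↦ P p.swap) μ := hPi.swap
  have hPsv : ∫ p, P p.swap ∂μ = eigOne N α * normSq u := by
    rw [← hPv]; exact integral_prod_swap P
  have hKi : Integrable (fun p : USphere N × USphere N ↦
      oddKern N α e p.1 p.2 * (u p.1 * u p.2)) μ := by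
    refine hu.integrable_prod_mul hu ?_
    exact ((integrable_kern_prod hα₁ hα₂).sub (integrable_kern_prod_rot hα₁ hα₂ _)).div_const 2
  have hR1 : Integrable (fun p : USphere N × USphere N ↦ u p.1 ^ 2 * t p.2 ^ 2) μ :=
    hu.sq.integrable_prod htb.sq
  have hR2 : Integrable (fun p : USphere N × USphere N ↦ t p.1 ^ 2 * u p.2 ^ 2) μ :=
    htb.sq.integrable_prod hu.sq
  have hR3 : Integrable (fun p : USphere N × USphere N ↦ (u p.1 * t p.1) * (u p.2 * t p.2)) μ :=
    (hu.mul htb).integrable_prod (hu.mul htb)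
  have hmono : ∫ p, gapConst N α * ((u p.1 ^ 2 * t p.2 ^ 2 + t p.1 ^ 2 * u p.2 ^ 2) -
      2 * ((u p.1 * t p.1) * (u p.2 * t p.2))) ∂μ ≤
      ∫ p, (P p + P p.swap - 2 * (oddKern N α e p.1 p.2 * (u p.1 * u p.2))) ∂μ := by
    refine integral_mono (((hR1.add hR2).sub (hR3.const_mul 2)).const_mul _)
      ((hPi.add hPs).sub (hKi.const_mul 2)) fun p => ?_
    refine le_trans (le_of_eq ?_) (oddKern_ground_state hα₂ he hodd p.1 p.2)
    simp only [ht]; ring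
  have hR12 : Integrable (fun p : USphere N × USphere N ↦
      u p.1 ^ 2 * t p.2 ^ 2 + t p.1 ^ 2 * u p.2 ^ 2) μ := hR1.add hR2
  have hPP : Integrable (fun p ↦ P p + P p.swap) μ := hPi.add hPs
  rw [integral_const_mul, integral_sub hR12 (hR3.const_mul 2), integral_add hR1 hR2,
    integral_const_mul, integral_sub hPP (hKi.const_mul 2), integral_add hPi hPs, hPv,
    hPsv, integral_const_mul, kform_eq_oddKern hα₁ hα₂ e hu hodd,
    integral_prod_mul (fun x => u x ^ 2) (fun x => t x ^ 2),
    integral_prod_mul (fun x => t x ^ 2) (fun x => u x ^ 2),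
    integral_prod_mul (fun x => u x * t x) (fun x => u x * t x)] at hmono
  simp only [normSq] at hmono ⊢
  linarith

end OddGap

section Averaging

variable {N : ℕ} {α : ℝ}

/-- The orthogonal group as a compact topological group. -/
def OGroup (N : ℕ) : Type := ↥(unitary (Space N →L[ℝ] Space N))

namespace OGroup

noncomputable instance : Group (OGroup N) :=
  inferInstanceAs (Group ↥(unitary (Space N →L[ℝ] Space N)))

instance : TopologicalSpace (OGroup N) :=
  inferInstanceAs (TopologicalSpace ↥(unitary (Space N →L[ℝ] Space N)))

instance : ContinuousStar (Space N →L[ℝ] Space N) :=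
  ⟨(ContinuousLinearMap.adjoint (𝕜 := ℝ) (E := Space N) (F := Space N)).continuous⟩

instance : IsTopologicalGroup (OGroup N) :=
  inferInstanceAs (IsTopologicalGroup ↥(unitary (Space N →L[ℝ] Space N)))

instance : T2Space (OGroup N) :=
  inferInstanceAs (T2Space ↥(unitary (Space N →L[ℝ] Space N)))

noncomputable instance : MeasurableSpace (OGroup N) := borel _

instance : BorelSpace (OGroup N) := ⟨rfl⟩

instance : CompactSpace (OGroup N) := by
  suffices h : IsCompact (unitary (Space N →L[ℝ] Space N) : Set (Space N →L[ℝ] Space N)) from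
    isCompact_iff_compactSpace.1 h
  refine Metric.isCompact_of_isClosed_isBounded isClosed_unitary ?_
  refine (Metric.isBounded_iff_subset_closedBall 0).2 ⟨1, fun u hu => ?_⟩
  rw [mem_closedBall_zero_iff]
  refine ContinuousLinearMap.opNorm_le_bound _ zero_le_one fun x => ?_
  rw [Unitary.norm_map ⟨u, hu⟩ x, one_mul]

/-- The isometry given by an element of the orthogonal group. -/
noncomputable def toIsometry : OGroup N ≃* (Space N ≃ₗᵢ[ℝ] Space N) :=
  Unitary.linearIsometryEquiv (𝕜 := ℝ) (H := Space N)

theorem continuous_toIsometry :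
    Continuous (fun p : OGroup N × Space N ↦ toIsometry p.1 p.2) := by
  have h : Continuous (fun g : OGroup N ↦ (Subtype.val g : Space N →L[ℝ] Space N)) :=
    continuous_subtype_val
  exact (h.comp continuous_fst).clm_apply continuous_snd

end OGroup

/-- The inverse action of the orthogonal group on the sphere. -/
noncomputable def act (g : OGroup N) (x : USphere N) : USphere N :=
  rot (OGroup.toIsometry g⁻¹) x

theorem continuous_act : Continuous (fun p : OGroup N × USphere N ↦ act p.1 p.2) := by
  refine Continuous.subtype_mk ?_ _
  exact OGroup.continuous_toIsometry.comp
    ((continuous_inv.comp continuous_fst).prodMk (continuous_subtype_val.comp continuous_snd))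

theorem act_mul_left (h g : OGroup N) (x : USphere N) : act (h * g) x = act g (act h x) := by
  simp only [act, mul_inv_rev, map_mul]
  rfl

theorem exists_act_eq (x y : USphere N) : ∃ g : OGroup N, act g x = y := by
  obtain ⟨g, hg⟩ := exists_rot_eq x y
  refine ⟨(OGroup.toIsometry.symm g)⁻¹, ?_⟩
  simp only [act, inv_inv, MulEquiv.apply_symm_apply, hg]

theorem integral_act_const (f : USphere N → ℝ) (x y : USphere N) :
    ∫ g, f (act g x) ∂(Measure.haar : Measure (OGroup N)) =
      ∫ g, f (act g y) ∂(Measure.haar : Measure (OGroup N)) := by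
  obtain ⟨h, rfl⟩ := exists_act_eq x y
  rw [← integral_mul_left_eq_self _ h]
  simp only [act_mul_left]

theorem lintegral_act_const (f : USphere N → ENNReal) (x y : USphere N) :
    ∫⁻ g, f (act g x) ∂(Measure.haar : Measure (OGroup N)) =
      ∫⁻ g, f (act g y) ∂(Measure.haar : Measure (OGroup N)) := by
  obtain ⟨h, rfl⟩ := exists_act_eq x y
  rw [← lintegral_mul_left_eq_self _ h]
  simp only [act_mul_left]

/-- Rotation invariant finite measures on the sphere are averages over the orthogonal group. -/
theorem lintegral_invariant {μ : Measure (USphere N)} [IsFiniteMeasure μ]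
    (hμ : ∀ g : Space N ≃ₗᵢ[ℝ] Space N, MeasurePreserving (rot g) μ μ)
    {f : USphere N → ENNReal} (hf : Measurable f) (x₀ : USphere N) :
    (∫⁻ x, f x ∂μ) * (Measure.haar : Measure (OGroup N)) Set.univ =
      (∫⁻ g, f (act g x₀) ∂(Measure.haar : Measure (OGroup N))) * μ Set.univ := by
  have h1 : ∀ g : OGroup N, ∫⁻ x, f (act g x) ∂μ = ∫⁻ x, f x ∂μ := fun g =>
    (hμ (OGroup.toIsometry g⁻¹)).lintegral_comp hf
  have h2 : ∫⁻ g, ∫⁻ x, f (act g x) ∂μ ∂(Measure.haar : Measure (OGroup N)) =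
      ∫⁻ x, ∫⁻ g, f (act g x) ∂(Measure.haar : Measure (OGroup N)) ∂μ :=
    lintegral_lintegral_swap (hf.comp continuous_act.measurable).aemeasurable
  simp only [h1, lintegral_act_const f _ x₀, lintegral_const] at h2
  exact h2

/-- A mean zero function on the sphere has a rotation to which it is non-positively correlated. -/
theorem exists_corr_nonpos [Fact (2 ≤ N)] {φ : USphere N → ℝ} (hφ : IsBM φ)
    (h0 : ∫ x, φ x ∂(surf N) = 0) :
    ∃ g : Space N ≃ₗᵢ[ℝ] Space N, ∫ x, φ x * φ (rot g x) ∂(surf N) ≤ 0 := by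
  by_contra! hpos
  set m : Measure (OGroup N) := Measure.haar
  obtain ⟨C, hC⟩ := hφ.bdd
  have hprod : Integrable (fun p : OGroup N × USphere N ↦ φ p.2 * φ (act p.1 p.2))
      (m.prod (surf N)) := by
    refine .of_bound (C := C * C) ?_ (.of_forall fun p => ?_)
    · exact ((hφ.measurable.comp measurable_snd).mul
        (hφ.measurable.comp continuous_act.measurable)).aestronglyMeasurable
    · rw [norm_mul]
      exact mul_le_mul (hC _) (hC _) (norm_nonneg _) ((abs_nonneg _).trans (hC p.2))
  have hswap : ∫ g, ∫ x, φ x * φ (act g x) ∂(surf N) ∂m =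
      ∫ x, ∫ g, φ x * φ (act g x) ∂m ∂(surf N) := integral_integral_swap hprod
  have x₀ : USphere N := Classical.arbitrary _
  have hr : ∀ x, ∫ g, φ x * φ (act g x) ∂m = φ x * ∫ g, φ (act g x₀) ∂m := fun x => by
    rw [integral_const_mul, integral_act_const φ x x₀]
  simp only [hr, integral_mul_const, h0, zero_mul] at hswap
  have hp : ∀ g : OGroup N, 0 < ∫ x, φ x * φ (act g x) ∂(surf N) := fun g => hpos _
  have h3 : 0 < ∫ g, ∫ x, φ x * φ (act g x) ∂(surf N) ∂m := by
    rw [integral_pos_iff_support_of_nonneg (fun g => (hp g).le) hprod.integral_prod_left]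
    have : Function.support (fun g : OGroup N ↦ ∫ x, φ x * φ (act g x) ∂(surf N)) = Set.univ :=
      Set.eq_univ_of_forall fun g => (hp g).ne'
    rw [this]
    exact NeZero.pos _
  linarith

end Averaging

section NormSq

variable {N : ℕ} {u v : USphere N → ℝ}

theorem normSq_nonneg (u : USphere N → ℝ) : 0 ≤ normSq u := integral_nonneg fun _ => sq_nonneg _

theorem normSq_comp_rot (g : Space N ≃ₗᵢ[ℝ] Space N) (u : USphere N → ℝ) :
    normSq (fun x ↦ u (rot g x)) = normSq u :=
  integral_comp_rot g (fun x ↦ u x ^ 2)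

theorem normSq_add (hu : IsBM u) (hv : IsBM v) :
    normSq (fun x ↦ u x + v x) =
      normSq u + normSq v + 2 * ∫ x, u x * v x ∂(surf N) := by
  have h : ∀ x, (u x + v x) ^ 2 = u x ^ 2 + v x ^ 2 + 2 * (u x * v x) := fun x => by ring
  have h1 : Integrable (fun x ↦ u x ^ 2 + v x ^ 2) (surf N) := hu.sq.integrable.add hv.sq.integrable
  simp only [normSq, h]
  rw [integral_add h1 ((hu.mul hv).integrable.const_mul 2),
    integral_add hu.sq.integrable hv.sq.integrable, integral_const_mul]

theorem normSq_const_mul (c : ℝ) (u : USphere N → ℝ) :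
    normSq (fun x ↦ c * u x) = c ^ 2 * normSq u := by
  simp only [normSq, mul_pow, integral_const_mul]

theorem normSq_sub (hu : IsBM u) (hv : IsBM v) :
    normSq (fun x ↦ u x - v x) =
      normSq u + normSq v - 2 * ∫ x, u x * v x ∂(surf N) := by
  have h := normSq_add hu (hv.const_mul (-1))
  rw [normSq_const_mul] at h
  have h2 : ∫ x, u x * (-1 * v x) ∂(surf N) = - ∫ x, u x * v x ∂(surf N) := by
    rw [← integral_neg]; congr 1; ext x; ring
  rw [h2] at h
  have h3 : (fun x ↦ u x - v x) = fun x ↦ u x + -1 * v x := by ext x; ring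
  rw [h3, h]; ring

theorem normSq_add_le (hu : IsBM u) (hv : IsBM v) :
    normSq (fun x ↦ u x + v x) ≤ 2 * normSq u + 2 * normSq v := by
  have h1 := normSq_add hu hv
  have h2 := normSq_sub hu hv
  have h3 := normSq_nonneg (fun x ↦ u x - v x)
  linarith

theorem normSq_sub_list_prod {φ : USphere N → ℝ} (hφ : IsBM φ) {d : ℝ} (hd : 0 ≤ d)
    (h : ∀ e : Space N, ‖e‖ = 1 → normSq (fun x ↦ φ x - φ (rot (ℝ ∙ e)ᗮ.reflection x)) ≤ d)
    (l : List (Space N)) :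
    normSq (fun x ↦ φ x - φ (rot (l.map fun v => (ℝ ∙ v)ᗮ.reflection).prod x)) ≤
      (2 ^ (l.length + 1) - 2) * d := by
  induction l with
  | nil =>
    have : ∀ x : USphere N, rot (1 : Space N ≃ₗᵢ[ℝ] Space N) x = x := fun x => rfl
    simp [this, normSq]
  | cons v l ih =>
    set P := (l.map fun v => (ℝ ∙ v)ᗮ.reflection).prod with hP
    have h1 : ∀ x, rot ((List.map (fun v : Space N => (ℝ ∙ v)ᗮ.reflection) (v :: l)).prod) x =
        rot (ℝ ∙ v)ᗮ.reflection (rot P x) := fun x => rfl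
    have hv : normSq (fun x ↦ φ x - φ (rot (ℝ ∙ v)ᗮ.reflection x)) ≤ d := by
      rcases eq_or_ne v 0 with rfl | hv
      · have : ∀ x, rot (ℝ ∙ (0 : Space N))ᗮ.reflection x = x := fun x => by
          apply Subtype.ext
          rw [coe_rot]
          exact Submodule.reflection_mem_subspace_eq_self (by simp)
        simp only [normSq, this, sub_self]
        simpa using hd
      · have h2 := h (‖v‖⁻¹ • v) (by simp [norm_smul, hv])
        simpa only [Submodule.span_singleton_smul_eq (r := ‖v‖⁻¹) (by simpa using hv)] using h2
    simp only [h1]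
    have h3 : (fun x ↦ φ x - φ (rot (ℝ ∙ v)ᗮ.reflection (rot P x))) =
        fun x ↦ (φ x - φ (rot P x)) +
          (φ (rot P x) - φ (rot (ℝ ∙ v)ᗮ.reflection (rot P x))) := by ext x; ring
    rw [h3]
    refine (normSq_add_le (hφ.sub (hφ.comp_rot P))
      ((hφ.sub (hφ.comp_rot _)).comp_rot P)).trans ?_
    rw [normSq_comp_rot P (fun x ↦ φ x - φ (rot (ℝ ∙ v)ᗮ.reflection x)), List.length_cons, pow_succ]
    linarith

/-- A mean zero function on the sphere is far from being even for some reflection. -/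
theorem exists_reflection_normSq_ge [Fact (2 ≤ N)] {φ : USphere N → ℝ} (hφ : IsBM φ)
    (h0 : ∫ x, φ x ∂(surf N) = 0) :
    ∃ e : Space N, ‖e‖ = 1 ∧
      normSq φ / 2 ^ N ≤ normSq (fun x ↦ φ x - φ (rot (ℝ ∙ e)ᗮ.reflection x)) := by
  by_contra! hcon
  obtain ⟨g, hg⟩ := exists_corr_nonpos hφ h0
  obtain ⟨l, hl, rfl⟩ := g.reflections_generate_dim
  rw [finrank_space] at hl
  have hpos : 0 < normSq φ := by
    have x₀ : USphere N := Classical.arbitrary _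
    have h1 := (normSq_nonneg _).trans_lt (hcon x₀ (norm_coe x₀))
    by_contra! h2
    exact absurd h1 (not_lt.2 (div_nonpos_of_nonpos_of_nonneg h2 (by positivity)))
  have h1 := normSq_sub_list_prod hφ (div_nonneg hpos.le (by positivity : (0 : ℝ) ≤ 2 ^ N))
    (fun e he => (hcon e he).le) l
  have h2 := normSq_sub hφ (hφ.comp_rot (l.map fun v => (ℝ ∙ v)ᗮ.reflection).prod)
  rw [normSq_comp_rot] at h2
  have h3 : (2 : ℝ) ^ (l.length + 1) ≤ 2 ^ (N + 1) := pow_le_pow_right₀ (by norm_num) (by omega)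
  have h4 : ((2 : ℝ) ^ (l.length + 1) - 2) * (normSq φ / 2 ^ N) ≤
      (2 ^ (N + 1) - 2) * (normSq φ / 2 ^ N) := by gcongr
  have h5 : ((2 : ℝ) ^ (N + 1) - 2) * (normSq φ / 2 ^ N) =
      2 * normSq φ - 2 * (normSq φ / 2 ^ N) := by
    rw [pow_succ]; field_simp
  have h6 : 0 < normSq φ / 2 ^ N := by positivity
  linarith

/-- The second moment of a coordinate on the sphere. -/
theorem exists_normSq_inner [Fact (2 ≤ N)] : ∃ s : ℝ, 0 < s ∧ ∀ e : Space N, ‖e‖ = 1 →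
    normSq (fun x : USphere N ↦ inner ℝ (x : Space N) e) = s := by
  have x₀ : USphere N := Classical.arbitrary _
  have hs : ∀ e : Space N, ‖e‖ = 1 →
      normSq (fun x : USphere N ↦ inner ℝ (x : Space N) e) =
        normSq (fun x : USphere N ↦ inner ℝ (x : Space N) x₀) := by
    intro e he
    lift e to USphere N using by simpa using he
    have h := integral_zonal (fun r => (1 - r ^ 2 / 2) ^ 2) e x₀
    simp only [← inner_eq_zonal] at h
    exact h
  refine ⟨_, ?_, hs⟩
  set b := EuclideanSpace.basisFun (Fin N) ℝ
  have h1 : ∀ x : USphere N, ∑ i, (inner ℝ (x : Space N) (b i)) ^ 2 = 1 := fun x => by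
    have := b.sum_sq_norm_inner_left (x : Space N)
    simpa [norm_coe] using this
  have h2 : ∑ i, normSq (fun x : USphere N ↦ inner ℝ (x : Space N) (b i)) =
      (surf N).real Set.univ := by
    simp only [normSq]
    rw [← integral_finsetSum _ fun i _ => (IsBM.inner (b i)).sq.integrable]
    simp [h1]
  simp only [hs (b _) (b.norm_eq_one _), Finset.sum_const, nsmul_eq_mul] at h2
  have h3 := surf_real_univ_pos (N := N)
  rw [← h2] at h3
  exact pos_of_mul_pos_right h3 (by positivity)

end NormSq

section Gap

variable {N : ℕ} {α : ℝ}

/-- The bilinear form on the sphere with kernel `K`. -/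
noncomputable def bform (K : USphere N → USphere N → ℝ) (u v : USphere N → ℝ) : ℝ :=
  ∫ p : USphere N × USphere N, K p.1 p.2 * (u p.1 * v p.2) ∂((surf N).prod (surf N))

section General

variable {K : USphere N → USphere N → ℝ} {u v w : USphere N → ℝ}

theorem bform_comm (hK : ∀ x y, K x y = K y x) : bform K u v = bform K v u := by
  rw [bform, ← integral_prod_swap]
  simp only [bform, Prod.fst_swap, Prod.snd_swap]
  congr 1; ext p
  rw [hK]; ring

theorem bform_comp_rot (g : Space N ≃ₗᵢ[ℝ] Space N)
    (hK : ∀ x y, K (rot g x) (rot g y) = K x y) :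
    bform K (fun x ↦ u (rot g x)) (fun x ↦ v (rot g x)) = bform K u v := by
  rw [bform, bform, ← integral_comp_rot_prod g (fun p ↦ K p.1 p.2 * (u p.1 * v p.2))]
  simp only [hK]

theorem bform_add_left (hK : Integrable (fun p : USphere N × USphere N ↦ K p.1 p.2)
    ((surf N).prod (surf N))) (hu : IsBM u) (hv : IsBM v) (hw : IsBM w) :
    bform K (fun x ↦ u x + v x) w = bform K u w + bform K v w := by
  simp only [bform]
  rw [← integral_add (hu.integrable_prod_mul hw hK) (hv.integrable_prod_mul hw hK)]
  congr 1; ext p; ring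

theorem bform_const_mul_left (c : ℝ) (u v : USphere N → ℝ) :
    bform K (fun x ↦ c * u x) v = c * bform K u v := by
  simp only [bform]
  rw [← integral_const_mul]
  congr 1; ext p; ring

theorem bform_add_self (hK : Integrable (fun p : USphere N × USphere N ↦ K p.1 p.2)
    ((surf N).prod (surf N))) (hs : ∀ x y, K x y = K y x) (hu : IsBM u) (hv : IsBM v) :
    bform K (fun x ↦ u x + v x) (fun x ↦ u x + v x) =
      bform K u u + bform K v v + 2 * bform K u v := by
  rw [bform_add_left hK hu hv (hu.add hv), bform_comm hs (u := u), bform_comm hs (u := v),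
    bform_add_left hK hu hv hu, bform_add_left hK hu hv hv, bform_comm hs (u := v) (v := u)]
  ring

theorem bform_const_mul_right (hs : ∀ x y, K x y = K y x) (c : ℝ) (u v : USphere N → ℝ) :
    bform K u (fun x ↦ c * v x) = c * bform K u v := by
  rw [bform_comm hs, bform_const_mul_left, bform_comm hs]

/-- The even and odd parts under a reflection are orthogonal for an invariant kernel. -/
theorem bform_even_odd (hK : Integrable (fun p : USphere N × USphere N ↦ K p.1 p.2)
    ((surf N).prod (surf N))) (hs : ∀ x y, K x y = K y x)
    (hg : ∀ (g : Space N ≃ₗᵢ[ℝ] Space N) (x y), K (rot g x) (rot g y) = K x y) (hu : IsBM u)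
    (e : Space N) :
    bform K u u =
      bform K (fun x ↦ 2⁻¹ * (u x - u (rot (ℝ ∙ e)ᗮ.reflection x)))
        (fun x ↦ 2⁻¹ * (u x - u (rot (ℝ ∙ e)ᗮ.reflection x))) +
      bform K (fun x ↦ 2⁻¹ * (u x + u (rot (ℝ ∙ e)ᗮ.reflection x)))
        (fun x ↦ 2⁻¹ * (u x + u (rot (ℝ ∙ e)ᗮ.reflection x))) := by
  set R := (ℝ ∙ e)ᗮ.reflection
  have h : ∀ x, u x - u (rot R x) = u x + -1 * u (rot R x) := fun x => by ring
  have hR := hu.comp_rot R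
  have h1 := bform_comp_rot (u := u) (v := u) R (hg R)
  simp only [bform_const_mul_left, bform_const_mul_right hs, h]
  rw [bform_add_self hK hs hu hR, bform_add_self hK hs hu (hR.const_mul (-1)),
    bform_const_mul_left, bform_const_mul_right hs, bform_const_mul_right hs, h1]
  ring

theorem normSq_even_odd (hu : IsBM u) (e : Space N) :
    normSq u = normSq (fun x ↦ 2⁻¹ * (u x - u (rot (ℝ ∙ e)ᗮ.reflection x))) +
      normSq (fun x ↦ 2⁻¹ * (u x + u (rot (ℝ ∙ e)ᗮ.reflection x))) := by
  have hR := hu.comp_rot (ℝ ∙ e)ᗮ.reflection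
  have h1 := normSq_comp_rot (ℝ ∙ e)ᗮ.reflection u
  rw [normSq_const_mul, normSq_const_mul, normSq_sub hu hR, normSq_add hu hR, h1]
  ring

theorem bform_const_right [Fact (2 ≤ N)]
    (hK : Integrable (fun p : USphere N × USphere N ↦ K p.1 p.2)
    ((surf N).prod (surf N))) {k : ℝ} (hk : ∀ x, ∫ y, K x y ∂(surf N) = k) (hu : IsBM u) (c : ℝ) :
    bform K u (fun _ ↦ c) = c * k * ∫ x, u x ∂(surf N) := by
  rw [bform, integral_prod _ (hu.integrable_prod_mul (IsBM.const c) hK)]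
  simp only [integral_mul_const, hk]
  rw [← integral_const_mul]
  congr 1; ext x; ring

/-- Schur's bound. -/
theorem abs_bform_le (hK : Integrable (fun p : USphere N × USphere N ↦ K p.1 p.2)
    ((surf N).prod (surf N))) (hs : ∀ x y, K x y = K y x)
    (hp : ∀ᵐ p : USphere N × USphere N ∂((surf N).prod (surf N)), 0 ≤ K p.1 p.2)
    {k : ℝ} (hk : ∀ x, ∫ y, K x y ∂(surf N) = k) (hu : IsBM u) :
    |bform K u u| ≤ k * normSq u := by
  have h1 : Integrable (fun p : USphere N × USphere N ↦ K p.1 p.2 * u p.1 ^ 2)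
      ((surf N).prod (surf N)) := by
    simpa using hu.sq.integrable_prod_mul (IsBM.const 1) hK
  have h2 : Integrable (fun p : USphere N × USphere N ↦ K p.1 p.2 * u p.2 ^ 2)
      ((surf N).prod (surf N)) := by
    simpa using (IsBM.const 1).integrable_prod_mul hu.sq hK
  have h3 : ∫ p : USphere N × USphere N, K p.1 p.2 * u p.1 ^ 2 ∂((surf N).prod (surf N)) =
      k * normSq u := by
    rw [integral_prod _ h1]
    simp only [integral_mul_const, hk, integral_const_mul, normSq]
  have h4 : ∫ p : USphere N × USphere N, K p.1 p.2 * u p.2 ^ 2 ∂((surf N).prod (surf N)) =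
      k * normSq u := by
    rw [← h3, ← integral_prod_swap]
    simp only [Prod.fst_swap, Prod.snd_swap]
    congr 1; ext p; rw [hs]
  calc |bform K u u| ≤ ∫ p : USphere N × USphere N, |K p.1 p.2 * (u p.1 * u p.2)|
        ∂((surf N).prod (surf N)) := abs_integral_le_integral_abs
    _ ≤ ∫ p : USphere N × USphere N, 2⁻¹ * (K p.1 p.2 * u p.1 ^ 2 + K p.1 p.2 * u p.2 ^ 2)
        ∂((surf N).prod (surf N)) := by
      refine integral_mono_ae (hu.integrable_prod_mul hu hK).abs ((h1.add h2).const_mul _)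
        (hp.mono fun p hp => ?_)
      simp only
      rw [abs_mul, abs_of_nonneg hp, abs_mul]
      have h5 : |u p.1| * |u p.2| ≤ 2⁻¹ * (u p.1 ^ 2 + u p.2 ^ 2) := by
        nlinarith [sq_nonneg (|u p.1| - |u p.2|), sq_abs (u p.1), sq_abs (u p.2)]
      nlinarith [mul_le_mul_of_nonneg_left h5 hp]
    _ = k * normSq u := by
      rw [integral_const_mul, integral_add h1 h2, h3, h4]; ring

end General

theorem kform_eq_bform (u : USphere N → ℝ) : kform α u = bform (kern N α) u u := rfl

theorem IsBM.integrable_smul_coe {u : USphere N → ℝ} (hu : IsBM u) :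
    Integrable (fun x : USphere N ↦ u x • (x : Space N)) (surf N) := by
  obtain ⟨C, hC⟩ := hu.bdd
  refine .of_bound (C := C) (by have := hu.measurable; fun_prop) (.of_forall fun x => ?_)
  rw [norm_smul, norm_coe, mul_one]
  exact hC x

theorem integrable_inner_prod :
    Integrable (fun p : USphere N × USphere N ↦ inner ℝ (p.1 : Space N) p.2)
      ((surf N).prod (surf N)) := by
  refine .of_bound (C := 1) (by fun_prop) (.of_forall fun p => ?_)
  simpa [norm_coe] using norm_inner_le_norm (𝕜 := ℝ) (p.1 : Space N) p.2

/-- The form with kernel `⟪x, y⟫` is the square of the barycenter. -/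
theorem bform_inner {u : USphere N → ℝ} (hu : IsBM u) :
    bform (fun x y ↦ inner ℝ (x : Space N) y) u u =
      ‖∫ x : USphere N, u x • (x : Space N) ∂(surf N)‖ ^ 2 := by
  rw [bform, integral_prod _ (hu.integrable_prod_mul hu integrable_inner_prod),
    ← real_inner_self_eq_norm_sq, ← integral_inner hu.integrable_smul_coe]
  congr 1; ext x
  rw [real_inner_comm, ← integral_inner hu.integrable_smul_coe]
  congr 1; ext y
  rw [inner_smul_left, inner_smul_right]
  simp; ring

theorem integral_mul_inner {u : USphere N → ℝ} (hu : IsBM u) (e : Space N) :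
    ∫ x : USphere N, u x * inner ℝ (x : Space N) e ∂(surf N) =
      inner ℝ (∫ x : USphere N, u x • (x : Space N) ∂(surf N)) e := by
  rw [real_inner_comm, ← integral_inner hu.integrable_smul_coe]
  congr 1; ext x
  rw [inner_smul_right, real_inner_comm]

/-- The Riesz kernel corrected on linear functions. -/
noncomputable def gkern (N : ℕ) (α : ℝ) (x y : USphere N) : ℝ :=
  kern N α x y - gapConst N α * inner ℝ (x : Space N) y

theorem gkern_comm (x y : USphere N) : gkern N α x y = gkern N α y x := by
  rw [gkern, gkern, kern_comm, real_inner_comm]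

theorem gkern_rot (g : Space N ≃ₗᵢ[ℝ] Space N) (x y : USphere N) :
    gkern N α (rot g x) (rot g y) = gkern N α x y := by
  rw [gkern, gkern, kern_rot, coe_rot, coe_rot, LinearIsometryEquiv.inner_map_map]

theorem integrable_gkern_prod [Fact (2 ≤ N)] (hα₁ : 1 < α) (hα₂ : α < N) :
    Integrable (fun p : USphere N × USphere N ↦ gkern N α p.1 p.2) ((surf N).prod (surf N)) :=
  (integrable_kern_prod hα₁ hα₂).sub (integrable_inner_prod.const_mul _)

theorem integral_inner_left (e : Space N) :
    ∫ x : USphere N, inner ℝ (x : Space N) e ∂(surf N) = 0 := by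
  have h := integral_comp_rot (ℝ ∙ e)ᗮ.reflection (fun x : USphere N ↦ inner ℝ (x : Space N) e)
  simp only [coe_rot, inner_reflection, integral_neg] at h
  linarith

theorem integral_gkern [Fact (2 ≤ N)] (hα₁ : 1 < α) (hα₂ : α < N) (x : USphere N) :
    ∫ y, gkern N α x y ∂(surf N) = eigZero N α := by
  have h := (IsBM.inner (x : Space N)).integrable
  simp only [gkern]
  simp only [real_inner_comm (x : Space N)] at h ⊢
  rw [integral_sub (integrable_kern hα₁ hα₂ x) (h.const_mul _), integral_kern, integral_const_mul]
  have h0 := integral_inner_left (x : Space N)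
  simp only [real_inner_comm (x : Space N)] at h0
  rw [h0]; ring

theorem bform_gkern [Fact (2 ≤ N)] (hα₁ : 1 < α) (hα₂ : α < N) {u : USphere N → ℝ}
    (hu : IsBM u) :
    bform (gkern N α) u u =
      kform α u - gapConst N α * ‖∫ x : USphere N, u x • (x : Space N) ∂(surf N)‖ ^ 2 := by
  rw [← bform_inner hu, kform, bform, bform, ← integral_const_mul, ← integral_sub
    (hu.integrable_prod_mul hu (integrable_kern_prod hα₁ hα₂))
    ((hu.integrable_prod_mul hu integrable_inner_prod).const_mul _)]
  congr 1; ext p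
  rw [gkern]; ring

/-- The defect form of the corrected kernel. -/
noncomputable def gapForm [Fact (2 ≤ N)] (α : ℝ) (u : USphere N → ℝ) : ℝ :=
  eigOne N α * normSq u - bform (gkern N α) u u

theorem gapForm_even_odd [Fact (2 ≤ N)] (hα₁ : 1 < α) (hα₂ : α < N) {u : USphere N → ℝ}
    (hu : IsBM u) (e : Space N) :
    gapForm α u = gapForm α (fun x ↦ 2⁻¹ * (u x - u (rot (ℝ ∙ e)ᗮ.reflection x))) +
      gapForm α (fun x ↦ 2⁻¹ * (u x + u (rot (ℝ ∙ e)ᗮ.reflection x))) := by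
  rw [gapForm, normSq_even_odd hu e, bform_even_odd (integrable_gkern_prod hα₁ hα₂) gkern_comm
    gkern_rot hu e, gapForm, gapForm]
  ring

theorem gapForm_odd_ge [Fact (2 ≤ N)] (hα₁ : 1 < α) (hα₂ : α < N) {s : ℝ}
    (hs : ∀ e : Space N, ‖e‖ = 1 → normSq (fun x : USphere N ↦ inner ℝ (x : Space N) e) = s)
    {e : Space N} (he : ‖e‖ = 1) {u : USphere N → ℝ} (hu : IsBM u)
    (hodd : ∀ x, u (rot (ℝ ∙ e)ᗮ.reflection x) = -u x) :
    gapConst N α * s * normSq u ≤ gapForm α u := by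
  have h1 := odd_gap hα₁ hα₂ he hu hodd
  rw [hs e he, integral_mul_inner hu] at h1
  rw [gapForm, bform_gkern hα₁ hα₂ hu]
  have h2 := abs_real_inner_le_norm (∫ x : USphere N, u x • (x : Space N) ∂(surf N)) e
  rw [he, mul_one] at h2
  have h3 := pow_le_pow_left₀ (abs_nonneg _) h2 2
  rw [sq_abs] at h3
  nlinarith [gapConst_pos hα₂]

theorem gapForm_ge_neg [Fact (2 ≤ N)] (hα₁ : 1 < α) (hα₂ : α < N) {u : USphere N → ℝ}
    (hu : IsBM u) : (eigOne N α - eigZero N α) * normSq u ≤ gapForm α u := by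
  rw [gapForm, bform_gkern hα₁ hα₂ hu]
  have h1 := abs_bform_le (integrable_kern_prod hα₁ hα₂) kern_comm
    (.of_forall fun _ => kern_nonneg _ _) (integral_kern (N := N) (α := α)) hu
  rw [← kform_eq_bform] at h1
  have h2 := le_of_abs_le h1
  nlinarith [gapConst_pos hα₂, sq_nonneg ‖∫ x : USphere N, u x • (x : Space N) ∂(surf N)‖]

theorem gapForm_improve [Fact (2 ≤ N)] (hα₁ : 1 < α) (hα₂ : α < N) {s : ℝ}
    (hs : ∀ e : Space N, ‖e‖ = 1 → normSq (fun x : USphere N ↦ inner ℝ (x : Space N) e) = s)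
    {m : ℝ} (hm : m ≤ gapConst N α * s)
    (h : ∀ u : USphere N → ℝ, IsBM u → ∫ x, u x ∂(surf N) = 0 → m * normSq u ≤ gapForm α u)
    {u : USphere N → ℝ} (hu : IsBM u) (h0 : ∫ x, u x ∂(surf N) = 0) :
    (m + (gapConst N α * s - m) * (4 * 2 ^ N)⁻¹) * normSq u ≤ gapForm α u := by
  obtain ⟨e, he, hfar⟩ := exists_reflection_normSq_ge hu h0
  set R := (ℝ ∙ e)ᗮ.reflection with hR
  have huR := hu.comp_rot R
  have ho : IsBM (fun x ↦ 2⁻¹ * (u x - u (rot R x))) := (hu.sub huR).const_mul _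
  have hev : IsBM (fun x ↦ 2⁻¹ * (u x + u (rot R x))) := (hu.add huR).const_mul _
  have h1 := gapForm_odd_ge hα₁ hα₂ hs he ho fun x => by
    rw [rot_reflection_rot]; ring
  have h2 := h _ hev (by
    rw [integral_const_mul, integral_add hu.integrable huR.integrable, integral_comp_rot, h0]
    ring)
  rw [gapForm_even_odd hα₁ hα₂ hu e]
  have h3 := normSq_even_odd hu e
  have h4 := normSq_const_mul 2⁻¹ (fun x ↦ u x - u (rot R x))
  have h5 : normSq u * (4 * 2 ^ N)⁻¹ ≤ normSq (fun x ↦ 2⁻¹ * (u x - u (rot R x))) := by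
    rw [h4, mul_inv, ← mul_assoc, mul_comm _ (4⁻¹ : ℝ), mul_assoc, ← div_eq_mul_inv]
    linarith
  have h6 := mul_le_mul_of_nonneg_left h5 (sub_nonneg.2 hm)
  rw [← hR] at h3
  have h7 : m * normSq u = m * normSq (fun x ↦ 2⁻¹ * (u x - u (rot R x))) +
      m * normSq (fun x ↦ 2⁻¹ * (u x + u (rot R x))) := by rw [← mul_add, ← h3]
  linarith

/-- The spectral gap on mean zero functions. -/
theorem gapForm_ge [Fact (2 ≤ N)] (hα₁ : 1 < α) (hα₂ : α < N) {s : ℝ}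
    (hs : ∀ e : Space N, ‖e‖ = 1 → normSq (fun x : USphere N ↦ inner ℝ (x : Space N) e) = s)
    {u : USphere N → ℝ} (hu : IsBM u) (h0 : ∫ x, u x ∂(surf N) = 0) :
    gapConst N α * s * normSq u ≤ gapForm α u := by
  set c := gapConst N α * s
  set q : ℝ := (4 * 2 ^ N)⁻¹ with hq
  set d := max 0 (c - (eigOne N α - eigZero N α)) with hd
  have hd0 : 0 ≤ d := le_max_left _ _
  have hq0 : 0 < q := by positivity
  have hq1 : q ≤ 1 := inv_le_one_of_one_le₀ (by
    have : (1 : ℝ) ≤ 2 ^ N := one_le_pow₀ (by norm_num)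
    linarith)
  have key : ∀ k : ℕ, ∀ u : USphere N → ℝ, IsBM u → ∫ x, u x ∂(surf N) = 0 →
      (c - (1 - q) ^ k * d) * normSq u ≤ gapForm α u := by
    intro k
    induction k with
    | zero =>
      intro u hu _
      refine le_trans ?_ (gapForm_ge_neg hα₁ hα₂ hu)
      have : c - (eigOne N α - eigZero N α) ≤ d := le_max_right _ _
      exact mul_le_mul_of_nonneg_right (by linarith) (normSq_nonneg u)
    | succ k ih =>
      intro u hu h0
      have h1 : 0 ≤ (1 - q) ^ k * d := mul_nonneg (pow_nonneg (by linarith) _) hd0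
      refine le_trans (le_of_eq ?_) (gapForm_improve hα₁ hα₂ hs (by linarith) ih hu h0)
      rw [pow_succ]; ring
  have hlim : Filter.Tendsto (fun k : ℕ ↦ (c - (1 - q) ^ k * d) * normSq u) Filter.atTop
      (nhds ((c - 0 * d) * normSq u)) :=
    ((tendsto_const_nhds.sub ((tendsto_pow_atTop_nhds_zero_of_lt_one (by linarith)
      (by linarith)).mul_const d)).mul_const _)
  rw [zero_mul, sub_zero] at hlim
  exact le_of_tendsto' hlim fun k => key k u hu h0

/-- The spectral gap for functions with small mean and barycenter. -/
theorem spectral_gap [Fact (2 ≤ N)] (hα₁ : 1 < α) (hα₂ : α < N) :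
    ∃ c C : ℝ, 0 < c ∧ 0 ≤ C ∧ ∀ u : USphere N → ℝ, IsBM u → ∀ D : ℝ, 0 ≤ D →
      (∀ e : Space N, ‖e‖ = 1 →
        |∫ x : USphere N, u x * inner ℝ (x : Space N) e ∂(surf N)| ≤ D) →
      c * normSq u - C * ((∫ x, u x ∂(surf N)) ^ 2 + D ^ 2) ≤
        eigOne N α * normSq u - kform α u := by
  obtain ⟨s, hs0, hs⟩ := exists_normSq_inner (N := N)
  have hg := gapConst_pos hα₂
  have hσ := surf_real_univ_pos (N := N)
  set σ := (surf N).real Set.univ with hσd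
  have hk0 : 0 ≤ eigZero N α := integral_nonneg fun y => kern_nonneg _ _
  refine ⟨gapConst N α * s, (gapConst N α * s + eigZero N α + |eigOne N α|) / σ + gapConst N α,
    by positivity, by positivity, fun u hu D hD hbar => ?_⟩
  set I := ∫ x, u x ∂(surf N) with hI
  set M := ∫ x : USphere N, u x • (x : Space N) ∂(surf N) with hM
  have hMD : ‖M‖ ≤ D := by
    rcases eq_or_ne M 0 with h | h
    · simpa [h] using hD
    · have h1 := hbar (‖M‖⁻¹ • M) (by simp [norm_smul, h])
      rw [integral_mul_inner hu, ← hM, inner_smul_right, real_inner_self_eq_norm_sq, pow_two,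
        inv_mul_cancel_left₀ (norm_ne_zero_iff.2 h), abs_norm] at h1
      exact h1
  set a : ℝ := - (I / σ) with ha
  have hw := hu.add (IsBM.const (N := N) a)
  have hw0 : ∫ x, (u x + a) ∂(surf N) = 0 := by
    rw [integral_add hu.integrable (integrable_const _), integral_const, smul_eq_mul, ← hI, ha]
    field_simp
    ring
  have h1 := gapForm_ge hα₁ hα₂ hs hw hw0
  have hn : normSq (fun x ↦ u x + a) = normSq u - I ^ 2 / σ := by
    rw [normSq_add hu (IsBM.const a), integral_mul_const, ← hI]
    simp only [normSq, integral_const, smul_eq_mul]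
    rw [← hσd, ha]
    field_simp
    ring
  have hb : bform (gkern N α) (fun x ↦ u x + a) (fun x ↦ u x + a) =
      bform (gkern N α) u u - eigZero N α * (I ^ 2 / σ) := by
    have hK := integrable_gkern_prod (N := N) hα₁ hα₂
    have hk := integral_gkern (N := N) hα₁ hα₂
    rw [bform_add_self hK gkern_comm hu (IsBM.const a), bform_const_right hK hk hu,
      bform_const_right hK hk (IsBM.const a), integral_const, ← hI, ← hσd, smul_eq_mul, ha]
    field_simp
    ring
  rw [gapForm, hn, hb, bform_gkern hα₁ hα₂ hu, ← hM] at h1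
  have h2 : ‖M‖ ^ 2 ≤ D ^ 2 := pow_le_pow_left₀ (norm_nonneg _) hMD 2
  have h3 := mul_le_mul_of_nonneg_left h2 hg.le
  have hJ : 0 ≤ I ^ 2 / σ := by positivity
  have h4 : -|eigOne N α| * (I ^ 2 / σ) ≤ eigOne N α * (I ^ 2 / σ) :=
    mul_le_mul_of_nonneg_right (neg_abs_le _) hJ
  have h5 : ((gapConst N α * s + eigZero N α + |eigOne N α|) / σ + gapConst N α) * (I ^ 2 + D ^ 2) =
      (gapConst N α * s + eigZero N α + |eigOne N α|) * (I ^ 2 / σ) + gapConst N α * D ^ 2 +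
      ((gapConst N α * s + eigZero N α + |eigOne N α|) / σ * D ^ 2 + gapConst N α * I ^ 2) := by
    field_simp
    ring
  have h6 : 0 ≤ (gapConst N α * s + eigZero N α + |eigOne N α|) / σ * D ^ 2 +
      gapConst N α * I ^ 2 := by positivity
  linarith

end Gap

section KernelComparison

variable {N : ℕ} {α : ℝ}

/-- Radial profile of the error in comparing the Riesz kernel near the sphere with the one on the
sphere. -/
noncomputable def errProfile (N : ℕ) (α δ q : ℝ) : ℝ :=
  ((1 + δ) ^ (2 * ((N : ℝ) - 1 + (α - N) / 2)) - (1 - δ) ^ (2 * ((N : ℝ) - 1 + (α - N) / 2))) *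
    q ^ (α - N) + (q ^ (α - N) - (q ^ 2 + 16 * δ ^ 2) ^ ((α - N) / 2))

/-- The error kernel on the sphere. -/
noncomputable def errKern (N : ℕ) (α δ : ℝ) (x y : USphere N) : ℝ :=
  errProfile N α δ ‖(x : Space N) - y‖

/-- The (constant) row integral of the error kernel. -/
noncomputable def errMod (N : ℕ) [Fact (2 ≤ N)] (α δ : ℝ) : ℝ :=
  ∫ y, errKern N α δ (Classical.arbitrary _) y ∂(surf N)

theorem errKern_comm (δ : ℝ) (x y : USphere N) : errKern N α δ x y = errKern N α δ y x := by
  simp only [errKern, norm_sub_rev]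

theorem integral_errKern [Fact (2 ≤ N)] (δ : ℝ) (x : USphere N) :
    ∫ y, errKern N α δ x y ∂(surf N) = errMod N α δ :=
  integral_zonal (errProfile N α δ) x _

theorem sq_rpow_half {q : ℝ} (hq : 0 ≤ q) (b : ℝ) : (q ^ 2) ^ (b / 2) = q ^ b := by
  rw [← Real.rpow_natCast, ← Real.rpow_mul hq]
  congr 1
  push_cast
  ring

theorem exponent_pos [Fact (2 ≤ N)] (hα₁ : 1 < α) : 0 < (N : ℝ) - 1 + (α - N) / 2 := by
  have : (2 : ℝ) ≤ N := by exact_mod_cast (Fact.out : 2 ≤ N)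
  linarith

theorem rpow_err_nonneg [Fact (2 ≤ N)] (hα₁ : 1 < α) {δ : ℝ} (hδ0 : 0 ≤ δ) (hδ : δ ≤ 1 / 2) :
    (1 - δ) ^ (2 * ((N : ℝ) - 1 + (α - N) / 2)) ≤ (1 + δ) ^ (2 * ((N : ℝ) - 1 + (α - N) / 2)) :=
  Real.rpow_le_rpow (by linarith) (by linarith) (by linarith [exponent_pos (N := N) hα₁])

theorem errProfile_nonneg [Fact (2 ≤ N)] (hα₁ : 1 < α) (hα₂ : α < N) {δ q : ℝ} (hδ0 : 0 ≤ δ)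
    (hδ : δ ≤ 1 / 2) (hq : 0 < q) : 0 ≤ errProfile N α δ q := by
  have h1 := rpow_err_nonneg (N := N) hα₁ hδ0 hδ
  have h2 : (q ^ 2 + 16 * δ ^ 2) ^ ((α - N) / 2) ≤ (q ^ 2) ^ ((α - N) / 2) :=
    Real.rpow_le_rpow_of_nonpos (by positivity) (by nlinarith [sq_nonneg δ]) (by linarith)
  rw [sq_rpow_half hq.le] at h2
  exact add_nonneg (mul_nonneg (by linarith) (Real.rpow_nonneg hq.le _)) (by linarith)

theorem errKern_nonneg [Fact (2 ≤ N)] (hα₁ : 1 < α) (hα₂ : α < N) {δ : ℝ} (hδ0 : 0 ≤ δ)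
    (hδ : δ ≤ 1 / 2) {x y : USphere N} (hxy : x ≠ y) : 0 ≤ errKern N α δ x y :=
  errProfile_nonneg hα₁ hα₂ hδ0 hδ (norm_pos_iff.2 (sub_ne_zero.2 fun h => hxy (Subtype.ext h)))

theorem abs_errKern_le [Fact (2 ≤ N)] (hα₁ : 1 < α) {δ : ℝ} (hδ0 : 0 ≤ δ)
    (hδ : δ ≤ 1 / 2) {x y : USphere N} (hxy : x ≠ y) (hα₂ : α < N) :
    |errKern N α δ x y| ≤
      ((3 / 2) ^ (2 * ((N : ℝ) - 1 + (α - N) / 2)) + 1) * kern N α x y := by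
  rw [abs_of_nonneg (errKern_nonneg hα₁ hα₂ hδ0 hδ hxy), errKern, errProfile, kern, add_mul,
    one_mul]
  have hp := exponent_pos (N := N) hα₁
  have h1 : (1 + δ) ^ (2 * ((N : ℝ) - 1 + (α - N) / 2)) ≤
      (3 / 2) ^ (2 * ((N : ℝ) - 1 + (α - N) / 2)) :=
    Real.rpow_le_rpow (by linarith) (by linarith) (by linarith)
  have h2 : 0 ≤ (1 - δ) ^ (2 * ((N : ℝ) - 1 + (α - N) / 2)) := Real.rpow_nonneg (by linarith) _
  have h3 : 0 ≤ ‖(x : Space N) - y‖ ^ (α - N) := Real.rpow_nonneg (norm_nonneg _) _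
  have h4 : 0 ≤ (‖(x : Space N) - y‖ ^ 2 + 16 * δ ^ 2) ^ ((α - N) / 2) :=
    Real.rpow_nonneg (by positivity) _
  have h5 := mul_le_mul_of_nonneg_right
    (show (1 + δ) ^ (2 * ((N : ℝ) - 1 + (α - N) / 2)) - (1 - δ) ^ (2 * ((N : ℝ) - 1 + (α - N) / 2))
      ≤ (3 / 2) ^ (2 * ((N : ℝ) - 1 + (α - N) / 2)) by linarith) h3
  linarith

theorem measurable_errKern (δ : ℝ) :
    Measurable (fun p : USphere N × USphere N ↦ errKern N α δ p.1 p.2) := by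
  unfold errKern errProfile; fun_prop

theorem ae_prod_ne [Fact (2 ≤ N)] :
    ∀ᵐ p : USphere N × USphere N ∂((surf N).prod (surf N)), p.1 ≠ p.2 := by
  rw [Measure.ae_prod_iff_ae_ae]
  · exact .of_forall fun x => (ae_ne x).mono fun y h => h.symm
  · exact (measurableSet_eq_fun measurable_fst measurable_snd).compl

theorem integrable_errKern_prod [Fact (2 ≤ N)] (hα₁ : 1 < α) (hα₂ : α < N) {δ : ℝ} (hδ0 : 0 ≤ δ)
    (hδ : δ ≤ 1 / 2) :
    Integrable (fun p : USphere N × USphere N ↦ errKern N α δ p.1 p.2)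
      ((surf N).prod (surf N)) :=
  ((integrable_kern_prod hα₁ hα₂).const_mul _).mono' (measurable_errKern δ).aestronglyMeasurable
    (ae_prod_ne.mono fun _ hp => abs_errKern_le hα₁ hδ0 hδ hp hα₂)

theorem integrable_errKern [Fact (2 ≤ N)] (hα₁ : 1 < α) (hα₂ : α < N) {δ : ℝ} (hδ0 : 0 ≤ δ)
    (hδ : δ ≤ 1 / 2) (x : USphere N) : Integrable (fun y ↦ errKern N α δ x y) (surf N) :=
  ((integrable_kern hα₁ hα₂ x).const_mul _).mono'
    ((measurable_errKern δ).comp measurable_prodMk_left).aestronglyMeasurable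
    ((ae_ne x).mono fun _ hp => abs_errKern_le hα₁ hδ0 hδ hp.symm hα₂)

theorem tendsto_errMod [Fact (2 ≤ N)] (hα₁ : 1 < α) (hα₂ : α < N) :
    Filter.Tendsto (errMod N α) (nhdsWithin 0 (Set.Ioi 0)) (nhds 0) := by
  set x₀ : USphere N := Classical.arbitrary _ with hx₀
  have hev : ∀ᶠ δ : ℝ in nhdsWithin 0 (Set.Ioi 0), 0 ≤ δ ∧ δ ≤ 1 / 2 := by
    filter_upwards [Ioo_mem_nhdsGT (show (0 : ℝ) < 1 / 2 by norm_num)] with δ hδ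
    exact ⟨hδ.1.le, hδ.2.le⟩
  have h := tendsto_integral_filter_of_dominated_convergence (μ := surf N)
    (l := nhdsWithin (0 : ℝ) (Set.Ioi 0)) (F := fun δ y ↦ errKern N α δ x₀ y) (f := fun _ ↦ 0)
    (fun y ↦ ((3 / 2) ^ (2 * ((N : ℝ) - 1 + (α - N) / 2)) + 1) * kern N α x₀ y)
    (.of_forall fun δ => ((measurable_errKern δ).comp measurable_prodMk_left).aestronglyMeasurable)
    (hev.mono fun δ hδ => (ae_ne x₀).mono fun y hy => abs_errKern_le hα₁ hδ.1 hδ.2 hy.symm hα₂)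
    ((integrable_kern hα₁ hα₂ x₀).const_mul _) ?_
  · rw [integral_zero] at h
    exact h
  · filter_upwards [ae_ne x₀] with y hy
    have hq : 0 < ‖(x₀ : Space N) - y‖ :=
      norm_pos_iff.2 (sub_ne_zero.2 fun h => hy (Subtype.ext h.symm))
    have hc : ContinuousAt (fun δ : ℝ ↦ errKern N α δ x₀ y) 0 := by
      unfold errKern errProfile
      have hp := exponent_pos (N := N) hα₁
      have h1 : ContinuousAt (fun δ : ℝ ↦ (1 + δ) ^ (2 * ((N : ℝ) - 1 + (α - N) / 2))) 0 :=
        ContinuousAt.rpow_const (by fun_prop) (Or.inl (by norm_num))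
      have h2 : ContinuousAt (fun δ : ℝ ↦ (1 - δ) ^ (2 * ((N : ℝ) - 1 + (α - N) / 2))) 0 :=
        ContinuousAt.rpow_const (by fun_prop) (Or.inl (by norm_num))
      have h3 : ContinuousAt (fun δ : ℝ ↦
          (‖(x₀ : Space N) - y‖ ^ 2 + 16 * δ ^ 2) ^ ((α - N) / 2)) 0 :=
        ContinuousAt.rpow_const (by fun_prop) (Or.inl (by positivity))
      exact ((h1.sub h2).mul continuousAt_const).add (continuousAt_const.sub h3)
    have h0 : errKern N α 0 x₀ y = 0 := by
      rw [errKern, errProfile]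
      simp [sq_rpow_half hq.le]
    have := hc.tendsto
    rw [h0] at this
    exact this.mono_left nhdsWithin_le_nhds

/-- The Riesz kernel near the sphere is close to the kernel on the sphere. -/
theorem abs_polar_kern_sub_le [Fact (2 ≤ N)] (hα₁ : 1 < α) (hα₂ : α < N) {δ : ℝ}
    (hδ : δ ≤ 1 / 2) {x y : USphere N} (hxy : x ≠ y) {r s : ℝ} (hr : |r - 1| ≤ δ)
    (hs : |s - 1| ≤ δ) :
    |r ^ (N - 1) * (s ^ (N - 1) * ‖r • (x : Space N) - s • (y : Space N)‖ ^ (α - N)) -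
      kern N α x y| ≤ errKern N α δ x y := by
  have hN : 2 ≤ N := Fact.out
  have hp := exponent_pos (N := N) hα₁
  set p := (N : ℝ) - 1 + (α - N) / 2 with hpd
  set q := ‖(x : Space N) - y‖ with hqd
  have hq : 0 < q := norm_pos_iff.2 (sub_ne_zero.2 fun h => hxy (Subtype.ext h))
  rw [abs_le] at hr hs
  have hδ0 : 0 ≤ δ := by linarith
  have hr0 : 1 / 2 ≤ r := by linarith
  have hs0 : 1 / 2 ≤ s := by linarith
  have hrs : 0 < r * s := mul_pos (by linarith) (by linarith)
  set t := (r - s) ^ 2 / (r * s) with ht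
  have ht0 : 0 ≤ t := div_nonneg (sq_nonneg _) hrs.le
  have ht1 : t ≤ 16 * δ ^ 2 := by
    rw [ht, div_le_iff₀ hrs]
    have h1 : (r - s) ^ 2 ≤ (2 * δ) ^ 2 := sq_le_sq' (by linarith) (by linarith)
    have h2 : 1 / 4 ≤ r * s := by nlinarith
    nlinarith [sq_nonneg δ]
  have hnorm : ‖r • (x : Space N) - s • (y : Space N)‖ ^ 2 = r * s * (q ^ 2 + t) := by
    rw [hqd, norm_sub_sq_sphere, norm_sub_sq_real, norm_smul, norm_smul, norm_coe, norm_coe,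
      inner_smul_left, inner_smul_right, ht, Real.norm_of_nonneg (by linarith),
      Real.norm_of_nonneg (by linarith)]
    field_simp
    simp
    ring
  have hval : r ^ (N - 1) * (s ^ (N - 1) * ‖r • (x : Space N) - s • (y : Space N)‖ ^ (α - N)) =
      (r * s) ^ p * (q ^ 2 + t) ^ ((α - N) / 2) := by
    rw [← sq_rpow_half (norm_nonneg (r • (x : Space N) - s • (y : Space N))), hnorm,
      Real.mul_rpow hrs.le (by positivity), hpd, Real.rpow_add hrs, ← mul_assoc, ← mul_pow,
      ← mul_assoc]
    congr 2
    rw [← Real.rpow_natCast]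
    congr 1
    push_cast [Nat.cast_sub (by omega : 1 ≤ N)]
    ring
  have hlo : (1 - δ) ^ (2 * p) ≤ (r * s) ^ p := by
    rw [Real.rpow_mul (by linarith), Real.rpow_two]
    exact Real.rpow_le_rpow (by positivity) (by nlinarith) hp.le
  have hhi : (r * s) ^ p ≤ (1 + δ) ^ (2 * p) := by
    rw [Real.rpow_mul (by linarith), Real.rpow_two]
    exact Real.rpow_le_rpow hrs.le (by nlinarith) hp.le
  have hlo1 : (1 - δ) ^ (2 * p) ≤ 1 := Real.rpow_le_one (by linarith) (by linarith) (by linarith)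
  have hhi1 : 1 ≤ (1 + δ) ^ (2 * p) := Real.one_le_rpow (by linarith) (by linarith)
  have hA1 : (q ^ 2 + t) ^ ((α - N) / 2) ≤ q ^ (α - N) := by
    rw [← sq_rpow_half hq.le]
    exact Real.rpow_le_rpow_of_nonpos (by positivity) (by linarith) (by linarith)
  have hA2 : (q ^ 2 + 16 * δ ^ 2) ^ ((α - N) / 2) ≤ (q ^ 2 + t) ^ ((α - N) / 2) :=
    Real.rpow_le_rpow_of_nonpos (by positivity) (by linarith) (by linarith)
  have hA0 : 0 ≤ (q ^ 2 + t) ^ ((α - N) / 2) := Real.rpow_nonneg (by positivity) _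
  rw [hval, errKern, errProfile, kern, ← hqd, ← hpd]
  set A := (q ^ 2 + t) ^ ((α - N) / 2)
  set A0 := q ^ (α - N)
  set L := (1 - δ) ^ (2 * p)
  set U := (1 + δ) ^ (2 * p)
  have h1 : |(r * s) ^ p - 1| ≤ U - L := abs_le.2 ⟨by linarith, by linarith⟩
  calc |(r * s) ^ p * A - A0| = |((r * s) ^ p - 1) * A + (A - A0)| := by congr 1; ring
    _ ≤ |(r * s) ^ p - 1| * A + (A0 - A) := by
      refine (abs_add_le _ _).trans ?_
      rw [abs_mul, abs_of_nonneg hA0, abs_of_nonpos (sub_nonpos.2 hA1), neg_sub]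
    _ ≤ (U - L) * A0 + (A0 - (q ^ 2 + 16 * δ ^ 2) ^ ((α - N) / 2)) := by
      have := mul_le_mul h1 hA1 hA0 ((abs_nonneg _).trans h1)
      linarith

end KernelComparison

section Energy

variable {N : ℕ} {α : ℝ}

/-- Bounded measurable densities supported in the ball of radius two. -/
structure IsDensity (a : Space N → ℝ) : Prop where
  measurable : Measurable a
  bdd : ∃ C, ∀ z, |a z| ≤ C
  supp : ∀ z ∉ ball (0 : Space N) 2, a z = 0

/-- The Riesz potential of a density. -/
noncomputable def pot (α : ℝ) (a : Space N → ℝ) (z : Space N) : ℝ :=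
  ∫ w, a w * ‖z - w‖ ^ (α - (N : ℝ))

/-- The mutual Riesz energy of two densities. -/
noncomputable def mutualEnergy (α : ℝ) (a b : Space N → ℝ) : ℝ := ∫ z, a z * pot α b z

theorem IsDensity.indicator {E : Set (Space N)} (hE : MeasurableSet E)
    (h2 : E ⊆ ball (0 : Space N) 2) : IsDensity (E.indicator 1) where
  measurable := measurable_one.indicator hE
  bdd := ⟨1, fun z => by
    classical
    rw [Set.indicator_apply]
    split_ifs <;> simp⟩
  supp z hz := Set.indicator_of_notMem (fun h => hz (h2 h)) _

theorem IsDensity.sub {a b : Space N → ℝ} (ha : IsDensity a) (hb : IsDensity b) :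
    IsDensity (fun z ↦ a z - b z) where
  measurable := ha.measurable.sub hb.measurable
  bdd := by
    obtain ⟨C, hC⟩ := ha.bdd
    obtain ⟨D, hD⟩ := hb.bdd
    exact ⟨C + D, fun z => (abs_sub _ _).trans (add_le_add (hC z) (hD z))⟩
  supp z hz := by rw [ha.supp z hz, hb.supp z hz, sub_zero]

theorem integrable_mul_rkern [Fact (2 ≤ N)] (hα₁ : 1 < α) {a : Space N → ℝ} (ha : IsDensity a)
    (z : Space N) : Integrable (fun w ↦ a w * ‖z - w‖ ^ (α - (N : ℝ))) := by
  obtain ⟨C, hC⟩ := ha.bdd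
  have h1 := (integrable_indicator_iff measurableSet_ball).2
    (integrableOn_norm_sub_rpow (N := N) (b := α - N) (by linarith) 2 z)
  refine (h1.bdd_mul (c := C) ha.measurable.aestronglyMeasurable (.of_forall hC)).congr
    (.of_forall fun w => ?_)
  by_cases hw : w ∈ ball (0 : Space N) 2
  · simp only [Set.indicator_of_mem hw]
  · simp [ha.supp w hw]

theorem integrable_mul_rkern_prod [Fact (2 ≤ N)] (hα₁ : 1 < α) {a b : Space N → ℝ}
    (ha : IsDensity a) (hb : IsDensity b) :
    Integrable (fun p : Space N × Space N ↦
      a p.1 * (b p.2 * ‖p.1 - p.2‖ ^ (α - (N : ℝ)))) (volume.prod volume) := by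
  obtain ⟨C, hC⟩ := ha.bdd
  obtain ⟨D, hD⟩ := hb.bdd
  have h1 : Integrable ((ball (0 : Space N) 2).indicator (fun _ ↦ (1 : ℝ))) :=
    (integrable_indicator_iff measurableSet_ball).2
      (integrableOn_const measure_ball_lt_top.ne)
  have h2 := (integrable_indicator_iff measurableSet_ball).2
    (integrableOn_norm_rpow (N := N) (b := α - N) (by linarith) 4)
  have h3 := h1.convolution_integrand (ContinuousLinearMap.mul ℝ ℝ) h2
  have hm : AEStronglyMeasurable (fun p : Space N × Space N ↦ a p.1 * b p.2)
      (volume.prod volume) :=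
    ((ha.measurable.comp measurable_fst).mul
      (hb.measurable.comp measurable_snd)).aestronglyMeasurable
  have hb' : ∀ p : Space N × Space N, ‖a p.1 * b p.2‖ ≤ C * D := fun p => by
    rw [norm_mul]
    exact mul_le_mul (hC _) (hD _) (norm_nonneg _) ((abs_nonneg _).trans (hC p.1))
  refine (h3.bdd_mul hm (.of_forall hb')).congr (.of_forall fun p => ?_)
  · by_cases hz : p.1 ∈ ball (0 : Space N) 2
    · by_cases hw : p.2 ∈ ball (0 : Space N) 2
      · have h4 : p.1 - p.2 ∈ ball (0 : Space N) 4 := by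
          rw [mem_ball_zero_iff] at hz hw ⊢
          linarith [norm_sub_le p.1 p.2]
        simp only [Set.indicator_of_mem hw, Set.indicator_of_mem h4, ContinuousLinearMap.mul_apply',
          one_mul, mul_assoc]
      · simp [hb.supp _ hw]
    · simp [ha.supp _ hz]

theorem integrable_mul_pot [Fact (2 ≤ N)] (hα₁ : 1 < α) {a b : Space N → ℝ}
    (ha : IsDensity a) (hb : IsDensity b) : Integrable (fun z ↦ a z * pot α b z) := by
  refine (integrable_mul_rkern_prod hα₁ ha hb).integral_prod_left.congr (.of_forall fun z => ?_)
  exact integral_const_mul (a z) (fun w ↦ b w * ‖z - w‖ ^ (α - (N : ℝ)))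

theorem integrableOn_pot [Fact (2 ≤ N)] (hα₁ : 1 < α) {a : Space N → ℝ} (ha : IsDensity a) :
    IntegrableOn (pot α a) (ball (0 : Space N) 2) := by
  have := integrable_mul_pot hα₁ (IsDensity.indicator (N := N) measurableSet_ball subset_rfl) ha
  refine (integrable_indicator_iff measurableSet_ball).1 (this.congr (.of_forall fun z => ?_))
  by_cases hz : z ∈ ball (0 : Space N) 2
  · simp only [Set.indicator_of_mem hz, Pi.one_apply, one_mul]
  · simp only [Set.indicator_of_notMem hz, zero_mul]

theorem isDensity_ball : IsDensity ((ball (0 : Space N) 1).indicator 1) :=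
  .indicator measurableSet_ball (ball_subset_ball (by norm_num))

theorem mutual_comm [Fact (2 ≤ N)] (hα₁ : 1 < α) {a b : Space N → ℝ}
    (ha : IsDensity a) (hb : IsDensity b) : mutualEnergy α a b = mutualEnergy α b a := by
  have h := integral_integral_swap
    (f := fun z w ↦ a z * (b w * ‖z - w‖ ^ (α - (N : ℝ)))) (integrable_mul_rkern_prod hα₁ ha hb)
  simp only [integral_const_mul] at h
  rw [mutualEnergy, mutualEnergy]
  simp only [pot]
  rw [h]
  congr 1; ext w
  rw [← integral_const_mul]
  congr 1; ext z
  rw [norm_sub_rev]; ring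

theorem pot_sub [Fact (2 ≤ N)] (hα₁ : 1 < α) {a b : Space N → ℝ}
    (ha : IsDensity a) (hb : IsDensity b) (z : Space N) :
    pot α (fun w ↦ a w - b w) z = pot α a z - pot α b z := by
  simp only [pot, sub_mul]
  exact integral_sub (integrable_mul_rkern hα₁ ha z) (integrable_mul_rkern hα₁ hb z)

theorem mutual_sub_left [Fact (2 ≤ N)] (hα₁ : 1 < α) {a b c : Space N → ℝ}
    (ha : IsDensity a) (hb : IsDensity b) (hc : IsDensity c) :
    mutualEnergy α (fun w ↦ a w - b w) c = mutualEnergy α a c - mutualEnergy α b c := by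
  simp only [mutualEnergy, sub_mul]
  exact integral_sub (integrable_mul_pot hα₁ ha hc) (integrable_mul_pot hα₁ hb hc)

theorem rieszEnergy_eq_mutual {E : Set (Space N)} (hE : MeasurableSet E) :
    rieszEnergy N α E = mutualEnergy α (E.indicator 1) (E.indicator 1) := by
  have h : ∀ (F : Space N → ℝ), ∫ z in E, F z = ∫ z, E.indicator 1 z * F z := fun F => by
    rw [← integral_indicator hE]
    congr 1; ext z
    by_cases hz : z ∈ E <;> simp [hz]
  simp only [rieszEnergy, mutualEnergy, pot]
  rw [h]
  congr 1; ext z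
  rw [h]
  simp only [norm_sub_rev z]

/-- Expansion of the energy around the ball. -/
theorem rieszEnergy_ball_sub [Fact (2 ≤ N)] (hα₁ : 1 < α) {E : Set (Space N)}
    (hE : MeasurableSet E) (h2 : E ⊆ ball (0 : Space N) 2) :
    rieszEnergy N α (ball (0 : Space N) 1) - rieszEnergy N α E =
      -2 * mutualEnergy α (indDiff E) ((ball (0 : Space N) 1).indicator 1) -
        mutualEnergy α (indDiff E) (indDiff E) := by
  have hB : IsDensity ((ball (0 : Space N) 1).indicator 1) :=
    .indicator measurableSet_ball (ball_subset_ball (by norm_num))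
  have hEd := IsDensity.indicator hE h2
  have hf : IsDensity (indDiff E) := hEd.sub hB
  have h1 := mutual_sub_left hα₁ hEd hB hB
  have h3 := mutual_sub_left hα₁ hEd hB hf
  have h4 := mutual_sub_left hα₁ hEd hB hEd
  have h5 := mutual_comm hα₁ hEd hB
  have h6 := mutual_comm hα₁ hEd hf
  have h7 := mutual_comm hα₁ hB hf
  change mutualEnergy α (indDiff E) _ = _ at h1
  change mutualEnergy α (indDiff E) _ = _ at h3
  change mutualEnergy α (indDiff E) _ = _ at h4
  rw [rieszEnergy_eq_mutual hE, rieszEnergy_eq_mutual measurableSet_ball]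
  linarith

end Energy

section SecondVariation

variable {N : ℕ} {α : ℝ}

theorem abs_integral_polar_kern_sub_le [Fact (2 ≤ N)] (hα₁ : 1 < α) (hα₂ : α < N) {δ : ℝ}
    (hδ : δ ≤ 1 / 2) {x y : USphere N} (hxy : x ≠ y) {r t : ℝ} (hr : |r - 1| ≤ δ)
    (ht : |t| ≤ δ)
    (hi : IntervalIntegrable (fun s : ℝ ↦ s ^ (N - 1) *
      ‖r • (x : Space N) - s • (y : Space N)‖ ^ (α - N)) volume 1 (1 + t)) :
    |r ^ (N - 1) * (∫ s in (1 : ℝ)..(1 + t), s ^ (N - 1) *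
      ‖r • (x : Space N) - s • (y : Space N)‖ ^ (α - N)) - kern N α x y * t| ≤
      errKern N α δ x y * |t| := by
  have h1 : r ^ (N - 1) * (∫ s in (1 : ℝ)..(1 + t), s ^ (N - 1) *
      ‖r • (x : Space N) - s • (y : Space N)‖ ^ (α - N)) - kern N α x y * t =
      ∫ s in (1 : ℝ)..(1 + t), (r ^ (N - 1) * (s ^ (N - 1) *
      ‖r • (x : Space N) - s • (y : Space N)‖ ^ (α - N)) - kern N α x y) := by
    rw [intervalIntegral.integral_sub (hi.const_mul _) intervalIntegrable_const,
      intervalIntegral.integral_const_mul, intervalIntegral.integral_const, smul_eq_mul]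
    ring
  rw [h1]
  have h2 := intervalIntegral.norm_integral_le_of_norm_le_const (a := (1 : ℝ)) (b := 1 + t)
    (C := errKern N α δ x y) (f := fun s ↦ r ^ (N - 1) * (s ^ (N - 1) *
      ‖r • (x : Space N) - s • (y : Space N)‖ ^ (α - N)) - kern N α x y) (fun s hs => ?_)
  · simpa using h2
  · refine abs_polar_kern_sub_le hα₁ hα₂ hδ hxy hr ?_
    rw [abs_le] at ht
    rw [abs_le]
    rcases Set.mem_uIoc.1 hs with h | h <;> constructor <;> linarith

/-- The potential of a thin radial shell near the sphere. -/
theorem abs_pot_indDiff_sub_le [Fact (2 ≤ N)] (hα₁ : 1 < α) (hα₂ : α < N) {E : Set (Space N)}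
    {u : USphere N → ℝ} (hE : IsRadialGraph E u) (hEm : MeasurableSet E) (hum : IsBM u) {δ : ℝ}
    (hδ : δ ≤ 1 / 2) (hu : ∀ x, |u x| ≤ δ) (x : USphere N) {r : ℝ} (hr : |r - 1| ≤ δ) :
    |r ^ (N - 1) * pot α (indDiff E) (r • (x : Space N)) - ∫ y, kern N α x y * u y ∂(surf N)| ≤
      ∫ y, errKern N α δ x y * |u y| ∂(surf N) := by
  have hu2 : ∀ x, |u x| ≤ 1 / 2 := fun x => (hu x).trans hδ
  have hδ0 : 0 ≤ δ := (abs_nonneg _).trans hr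
  have hh := integrableOn_norm_sub_rpow (N := N) (b := α - N) (by linarith) 2 (r • (x : Space N))
  have hrad := integrable_radial hE hEm hu2 hh
  have hku := hum.integrable_mul_left (integrable_kern hα₁ hα₂ x)
  rw [pot, integral_indDiff_mul hE hEm hu2 hh, ← integral_const_mul,
    ← integral_sub (hrad.const_mul _) hku]
  refine (abs_integral_le_integral_abs).trans (integral_mono_ae
    ((hrad.const_mul _).sub hku).abs
    (hum.abs.integrable_mul_left (integrable_errKern hα₁ hα₂ hδ0 hδ x)) ?_)
  filter_upwards [ae_ne x, ae_intervalIntegrable_radial hh] with y hy hi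
  exact abs_integral_polar_kern_sub_le hα₁ hα₂ hδ hy.symm hr (hu y) (hi _ (hu2 y))

/-- The self energy of a thin radial shell. -/
theorem abs_mutual_sub_kform_le [Fact (2 ≤ N)] (hα₁ : 1 < α) (hα₂ : α < N) {E : Set (Space N)}
    {u : USphere N → ℝ} (hE : IsRadialGraph E u) (hEm : MeasurableSet E) (hum : IsBM u) {δ : ℝ}
    (hδ0 : 0 ≤ δ) (hδ : δ ≤ 1 / 2) (hu : ∀ x, |u x| ≤ δ) :
    |mutualEnergy α (indDiff E) (indDiff E) - kform α u| ≤ errMod N α δ * normSq u := by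
  have hu2 : ∀ x, |u x| ≤ 1 / 2 := fun x => (hu x).trans hδ
  have hB : IsDensity ((ball (0 : Space N) 1).indicator 1) :=
    .indicator measurableSet_ball (ball_subset_ball (by norm_num))
  have hf : IsDensity (indDiff E) := (IsDensity.indicator hEm fun z hz => hE.mem_ball hu2 hz).sub hB
  have hh := integrableOn_pot hα₁ hf
  have hrad := integrable_radial hE hEm hu2 hh
  have hK := hum.integrable_prod_mul hum (integrable_kern_prod hα₁ hα₂)
  have hD := hum.abs.integrable_prod_mul hum.abs (integrable_errKern_prod hα₁ hα₂ hδ0 hδ)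
  have hkf : kform α u = ∫ x, (∫ y, kern N α x y * u y ∂(surf N)) * u x ∂(surf N) := by
    rw [kform, integral_prod _ hK]
    congr 1; ext x
    rw [← integral_mul_const]
    congr 1; ext y; ring
  have hKi : Integrable (fun x ↦ (∫ y, kern N α x y * u y ∂(surf N)) * u x) (surf N) := by
    refine hK.integral_prod_left.congr (.of_forall fun x => ?_)
    simp only
    rw [← integral_mul_const]
    congr 1; ext y; ring
  have hDi : Integrable (fun x ↦ (∫ y, errKern N α δ x y * |u y| ∂(surf N)) * |u x|)
      (surf N) := by
    refine hD.integral_prod_left.congr (.of_forall fun x => ?_)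
    simp only
    rw [← integral_mul_const]
    congr 1; ext y; ring
  have hDv : bform (errKern N α δ) (fun x ↦ |u x|) (fun x ↦ |u x|) =
      ∫ x, (∫ y, errKern N α δ x y * |u y| ∂(surf N)) * |u x| ∂(surf N) := by
    rw [bform, integral_prod _ hD]
    congr 1; ext x
    rw [← integral_mul_const]
    congr 1; ext y; ring
  have hS := abs_bform_le (integrable_errKern_prod hα₁ hα₂ hδ0 hδ) (errKern_comm δ)
    (ae_prod_ne.mono fun p hp => errKern_nonneg hα₁ hα₂ hδ0 hδ hp) (integral_errKern (N := N) δ)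
    hum.abs
  have hna : normSq (fun x ↦ |u x|) = normSq u := by simp only [normSq, sq_abs]
  rw [hna] at hS
  refine le_trans ?_ ((le_abs_self _).trans hS)
  rw [mutualEnergy, integral_indDiff_mul hE hEm hu2 hh, hkf, ← integral_sub hrad hKi, hDv]
  refine (abs_integral_le_integral_abs).trans (integral_mono_ae (hrad.sub hKi).abs hDi ?_)
  filter_upwards [ae_intervalIntegrable_radial hh] with x hi
  have hi := hi _ (hu2 x)
  set k := ∫ y, kern N α x y * u y ∂(surf N)
  have h1 : (∫ r in (1 : ℝ)..(1 + u x), r ^ (N - 1) * pot α (indDiff E) (r • (x : Space N))) -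
      k * u x = ∫ r in (1 : ℝ)..(1 + u x),
        (r ^ (N - 1) * pot α (indDiff E) (r • (x : Space N)) - k) := by
    rw [intervalIntegral.integral_sub hi intervalIntegrable_const,
      intervalIntegral.integral_const, smul_eq_mul]
    ring
  rw [h1]
  have h2 := intervalIntegral.norm_integral_le_of_norm_le_const (a := (1 : ℝ)) (b := 1 + u x)
    (C := ∫ y, errKern N α δ x y * |u y| ∂(surf N))
    (f := fun r ↦ r ^ (N - 1) * pot α (indDiff E) (r • (x : Space N)) - k) (fun s hs => ?_)
  · simpa using h2
  · refine abs_pot_indDiff_sub_le hα₁ hα₂ hE hEm hum hδ hu x ?_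
    have ht := hu x
    rw [abs_le] at ht
    rw [abs_le]
    rcases Set.mem_uIoc.1 hs with h | h <;> constructor <;> linarith

end SecondVariation

section BallPotential

variable {N : ℕ} {α : ℝ}

theorem abs_pow_sub_one_le {r : ℝ} (hr : |r - 1| ≤ 1 / 2) (n : ℕ) :
    |r ^ n - 1| ≤ n * 2 ^ n * |r - 1| := by
  have h := abs_pow_sub_pow_le r 1 n
  have hr2 : |r| ≤ 2 := by
    rw [abs_le] at hr ⊢
    constructor <;> linarith
  have h1 : max |r| |(1 : ℝ)| ^ (n - 1) ≤ 2 ^ n :=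
    (pow_le_pow_left₀ (by positivity) (max_le hr2 (by norm_num)) _).trans
      (pow_le_pow_right₀ (by norm_num) (Nat.sub_le n 1))
  rw [one_pow] at h
  calc |r ^ n - 1| ≤ |r - 1| * n * max |r| |(1 : ℝ)| ^ (n - 1) := h
    _ ≤ |r - 1| * n * 2 ^ n := by gcongr
    _ = _ := by ring

theorem abs_integral_one_add_le {F : ℝ → ℝ} {t k : ℝ} (hF : ∀ r, |r - 1| ≤ |t| → |F r| ≤ k) :
    |∫ r in (1 : ℝ)..(1 + t), F r| ≤ k * |t| := by
  have h2 := intervalIntegral.norm_integral_le_of_norm_le_const (a := (1 : ℝ)) (b := 1 + t)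
    (C := k) (f := F) (fun s hs => hF s ?_)
  · simpa using h2
  · rcases Set.mem_uIoc.1 hs with h | h
    · rw [abs_of_nonneg (by linarith : (0 : ℝ) ≤ t), abs_le]
      constructor <;> linarith
    · rw [abs_of_neg (by linarith : t < 0), abs_le]
      constructor <;> linarith

/-- The radial function of the ball of radius one centred at `-(h • x)`. -/
noncomputable def shiftFun (h : ℝ) (x y : USphere N) : ℝ :=
  -h * inner ℝ (y : Space N) x + (√(1 - h ^ 2 * (1 - inner ℝ (y : Space N) x ^ 2)) - 1)

theorem abs_inner_sphere_le (x y : USphere N) : |inner ℝ (y : Space N) (x : Space N)| ≤ 1 := by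
  simpa [norm_coe] using abs_real_inner_le_norm (y : Space N) x

theorem shift_radicand_bounds {h : ℝ} (x y : USphere N) :
    0 ≤ h ^ 2 * (1 - inner ℝ (y : Space N) x ^ 2) ∧
      h ^ 2 * (1 - inner ℝ (y : Space N) x ^ 2) ≤ h ^ 2 := by
  have h1 : inner ℝ (y : Space N) (x : Space N) ^ 2 ≤ 1 :=
    (sq_le_one_iff_abs_le_one _).2 (abs_inner_sphere_le x y)
  have h2 := sq_nonneg h
  have h3 := sq_nonneg (inner ℝ (y : Space N) (x : Space N))
  constructor <;> nlinarith

theorem abs_shiftFun_add_le {h : ℝ} (hh : |h| ≤ 1 / 2) (x y : USphere N) :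
    |shiftFun h x y + h * inner ℝ (y : Space N) x| ≤ h ^ 2 := by
  obtain ⟨h1, h2⟩ := shift_radicand_bounds (h := h) x y
  have h3 : h ^ 2 ≤ 1 := (sq_le_one_iff_abs_le_one _).2 (by linarith)
  rw [shiftFun]
  set s := h ^ 2 * (1 - inner ℝ (y : Space N) (x : Space N) ^ 2)
  have h4 : √(1 - s) ≤ 1 := Real.sqrt_le_one.2 (by linarith)
  have h5 : 1 - s ≤ √(1 - s) := Real.le_sqrt_of_sq_le (by nlinarith)
  rw [abs_le]
  constructor <;> linarith

theorem abs_shiftFun_le {h : ℝ} (hh : |h| ≤ 1 / 2) (x y : USphere N) :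
    |shiftFun h x y| ≤ 2 * |h| := by
  have h1 := abs_shiftFun_add_le hh x y
  have h2 : |h * inner ℝ (y : Space N) (x : Space N)| ≤ |h| := by
    rw [abs_mul]
    exact mul_le_of_le_one_right (abs_nonneg _) (abs_inner_sphere_le x y)
  have h3 : h ^ 2 ≤ |h| := by
    rw [← sq_abs]
    nlinarith [abs_nonneg h]
  have h4 := abs_sub (shiftFun h x y + h * inner ℝ (y : Space N) x)
    (h * inner ℝ (y : Space N) x)
  rw [add_sub_cancel_right] at h4
  linarith

theorem isBM_shiftFun {h : ℝ} (hh : |h| ≤ 1 / 2) (x : USphere N) : IsBM (shiftFun h x) :=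
  ⟨by unfold shiftFun; fun_prop, 2 * |h|, abs_shiftFun_le hh x⟩

theorem isRadialGraph_shift {h : ℝ} (hh : |h| ≤ 1 / 2) (x : USphere N) :
    IsRadialGraph (ball (-(h • (x : Space N))) 1) (shiftFun h x) := by
  intro y r hr
  obtain ⟨h1, h2⟩ := shift_radicand_bounds (h := h) x y
  have h3 : ‖r • (y : Space N) + h • (x : Space N)‖ ^ 2 =
      (r + h * inner ℝ (y : Space N) x) ^ 2 + h ^ 2 * (1 - inner ℝ (y : Space N) x ^ 2) := by
    rw [norm_add_sq_real, norm_smul, norm_smul, norm_coe, norm_coe, inner_smul_left,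
      inner_smul_right, mul_one, mul_one, Real.norm_eq_abs, Real.norm_eq_abs, sq_abs, sq_abs]
    simp only [conj_trivial]
    ring
  have h4 : |h| ^ 2 ≤ 1 / 4 := by nlinarith [abs_nonneg h]
  rw [sq_abs] at h4
  have hc := abs_inner_sphere_le x y
  have h5 : |h * inner ℝ (y : Space N) (x : Space N)| ≤ |h| := by
    rw [abs_mul]
    exact mul_le_of_le_one_right (abs_nonneg _) hc
  rw [mem_ball, dist_eq_norm, sub_neg_eq_add, ← sq_lt_one_iff₀ (norm_nonneg _), h3, shiftFun]
  set s := h ^ 2 * (1 - inner ℝ (y : Space N) (x : Space N) ^ 2)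
  set c := inner ℝ (y : Space N) (x : Space N)
  have h6 : |h| ≤ √(1 - s) := Real.le_sqrt_of_sq_le (by rw [sq_abs]; linarith)
  have h7 : (r + h * c) ^ 2 + s < 1 ↔ |r + h * c| < √(1 - s) := by
    rw [Real.lt_sqrt (abs_nonneg _), sq_abs]
    constructor <;> intro <;> linarith
  rw [h7, abs_lt]
  rw [abs_le] at h5
  constructor
  · intro h8; linarith [h8.2]
  · intro h8; constructor <;> linarith

/-- The value of the potential of the unit ball on the unit sphere. -/
noncomputable def ballPotOne (N : ℕ) [Fact (2 ≤ N)] (α : ℝ) : ℝ :=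
  pot α ((ball (0 : Space N) 1).indicator 1) (Classical.arbitrary (USphere N) : USphere N)

theorem pot_ball_sphere [Fact (2 ≤ N)] (x : USphere N) :
    pot α ((ball (0 : Space N) 1).indicator 1) x = ballPotOne N α := by
  obtain ⟨g, hg⟩ := exists_rot_eq x (Classical.arbitrary (USphere N))
  symm
  rw [ballPotOne, ← hg, coe_rot, pot, pot,
    ← g.measurePreserving.integral_comp g.toHomeomorph.measurableEmbedding]
  congr 1; ext w
  have h1 : (ball (0 : Space N) 1).indicator (1 : Space N → ℝ) (g w) =
      (ball (0 : Space N) 1).indicator 1 w := by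
    classical
    simp [Set.indicator_apply]
  rw [h1, ← map_sub, g.norm_map]

theorem pot_ball_shift [Fact (2 ≤ N)] (hα₁ : 1 < α) {v : Space N} (hv : ‖v‖ ≤ 1) (z : Space N) :
    pot α ((ball (0 : Space N) 1).indicator 1) (z + v) -
      pot α ((ball (0 : Space N) 1).indicator 1) z = pot α (indDiff (ball (-v) 1)) z := by
  have h1 : pot α ((ball (0 : Space N) 1).indicator 1) (z + v) =
      pot α ((ball (-v) 1).indicator 1) z := by
    rw [pot, pot, ← integral_add_right_eq_self _ v]
    congr 1; ext w
    have h2 : (ball (0 : Space N) 1).indicator (1 : Space N → ℝ) (w + v) =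
        (ball (-v) 1).indicator 1 w := by
      classical
      simp [Set.indicator_apply, dist_eq_norm]
    rw [h2, add_sub_add_right_eq_sub]
  rw [h1, ← pot_sub hα₁ (.indicator measurableSet_ball ?_) isDensity_ball]
  · rfl
  · refine ball_subset_ball' ?_
    rw [dist_zero_right, norm_neg]
    linarith

/-- First order expansion of the potential of the unit ball at the unit sphere. -/
theorem abs_ballPot_sub_le [Fact (2 ≤ N)] (hα₁ : 1 < α) (hα₂ : α < N) {δ h : ℝ}
    (hδ : δ ≤ 1 / 4) (hh : |h| ≤ δ) (x : USphere N) :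
    |pot α ((ball (0 : Space N) 1).indicator 1) ((1 + h) • (x : Space N)) - ballPotOne N α +
        h * eigOne N α| ≤ |h| * (2 * errMod N α (2 * δ) + δ * eigZero N α) := by
  have hδ0 : 0 ≤ δ := (abs_nonneg _).trans hh
  have hh2 : |h| ≤ 1 / 2 := by linarith
  have hu := isBM_shiftFun hh2 x
  have hk := integrable_kern hα₁ hα₂ x
  have h1 := pot_ball_shift (α := α) hα₁ (v := h • (x : Space N))
    (by rw [norm_smul, norm_coe, Real.norm_eq_abs]; linarith) x
  rw [pot_ball_sphere, show (x : Space N) + h • (x : Space N) = (1 + h) • (x : Space N) by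
    rw [add_smul, one_smul]] at h1
  have h2 := abs_pot_indDiff_sub_le hα₁ hα₂ (isRadialGraph_shift hh2 x) measurableSet_ball hu
    (δ := 2 * δ) (by linarith) (fun y => (abs_shiftFun_le hh2 x y).trans (by linarith)) x
    (r := 1) (by simpa using hδ0)
  rw [one_pow, one_mul, one_smul, ← h1] at h2
  have h3 : ∫ y, errKern N α (2 * δ) x y * |shiftFun h x y| ∂(surf N) ≤
      errMod N α (2 * δ) * (2 * |h|) := by
    rw [← integral_errKern (2 * δ) x, ← integral_mul_const]
    have hi := integrable_errKern hα₁ hα₂ (δ := 2 * δ) (by linarith) (by linarith) x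
    refine integral_mono_ae (hu.abs.integrable_mul_left hi) (hi.mul_const _) ?_
    filter_upwards [ae_ne x] with y hy
    exact mul_le_mul_of_nonneg_left (abs_shiftFun_le hh2 x y)
      (errKern_nonneg hα₁ hα₂ (by linarith) (by linarith) hy.symm)
  have h4 : |(∫ y, kern N α x y * shiftFun h x y ∂(surf N)) + h * eigOne N α| ≤
      h ^ 2 * eigZero N α := by
    have hin := (IsBM.inner (x : Space N)).integrable_mul_left hk
    rw [← integral_kern_inner_self x, ← integral_kern x, ← integral_const_mul,
      ← integral_const_mul, ← integral_add (hu.integrable_mul_left hk) (hin.const_mul _)]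
    refine (abs_integral_le_integral_abs).trans (integral_mono
      ((hu.integrable_mul_left hk).add (hin.const_mul _)).abs (hk.const_mul _) fun y => ?_)
    have h5 : kern N α x y * shiftFun h x y + h * (kern N α x y * inner ℝ (y : Space N) x) =
        kern N α x y * (shiftFun h x y + h * inner ℝ (y : Space N) x) := by ring
    beta_reduce
    rw [h5, abs_mul, abs_of_nonneg (kern_nonneg x y), mul_comm]
    exact mul_le_mul_of_nonneg_right (abs_shiftFun_add_le hh2 x y) (kern_nonneg x y)
  have h6 : h ^ 2 * eigZero N α ≤ |h| * (δ * eigZero N α) := by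
    have h0 : 0 ≤ eigZero N α := integral_nonneg fun y => kern_nonneg _ y
    rw [← sq_abs, ← mul_assoc, pow_two]
    gcongr
  have h7 := abs_add_le (pot α ((ball (0 : Space N) 1).indicator 1) ((1 + h) • (x : Space N)) -
    ballPotOne N α - ∫ y, kern N α x y * shiftFun h x y ∂(surf N))
    ((∫ y, kern N α x y * shiftFun h x y ∂(surf N)) + h * eigOne N α)
  rw [show ∀ a b c d : ℝ, a - b - c + (c + d) = a - b + d from fun a b c d => by ring] at h7
  linarith

/-- The modulus controlling the interaction of a thin shell with the ball. -/
noncomputable def ballMod (N : ℕ) [Fact (2 ≤ N)] (α δ : ℝ) : ℝ :=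
  2 ^ N * (2 * errMod N α (2 * δ) + δ * eigZero N α) + |eigOne N α| * (N * 2 ^ N) * δ

theorem abs_polar_ballPot_le [Fact (2 ≤ N)] (hα₁ : 1 < α) (hα₂ : α < N) {δ r : ℝ}
    (hδ : δ ≤ 1 / 4) (hr : |r - 1| ≤ δ) (x : USphere N) :
    |r ^ (N - 1) * (pot α ((ball (0 : Space N) 1).indicator 1) (r • (x : Space N)) -
        ballPotOne N α) + eigOne N α * (r - 1)| ≤ ballMod N α δ * |r - 1| := by
  have h1 := abs_ballPot_sub_le hα₁ hα₂ hδ hr x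
  rw [add_sub_cancel] at h1
  have h2 := abs_pow_sub_one_le (hr.trans (hδ.trans (by norm_num))) (N - 1)
  set V := pot α ((ball (0 : Space N) 1).indicator 1) (r • (x : Space N)) - ballPotOne N α
  have hr2 : |r| ≤ 2 := by
    rw [abs_le] at hr ⊢
    constructor <;> linarith
  have h3 : |r ^ (N - 1)| ≤ 2 ^ N := by
    rw [abs_pow]
    exact (pow_le_pow_left₀ (abs_nonneg _) hr2 _).trans
      (pow_le_pow_right₀ (by norm_num) (Nat.sub_le N 1))
  have h4 : ((N - 1 : ℕ) : ℝ) * 2 ^ (N - 1) ≤ N * 2 ^ N := by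
    gcongr
    · exact Nat.sub_le N 1
    · norm_num
    · exact Nat.sub_le N 1
  have h5 : r ^ (N - 1) * V + eigOne N α * (r - 1) =
      r ^ (N - 1) * (V + (r - 1) * eigOne N α) -
        eigOne N α * (r - 1) * (r ^ (N - 1) - 1) := by ring
  rw [h5]
  refine (abs_sub _ _).trans ?_
  rw [abs_mul, abs_mul, abs_mul, ballMod]
  have h6 : |r ^ (N - 1)| * |V + (r - 1) * eigOne N α| ≤
      2 ^ N * (|r - 1| * (2 * errMod N α (2 * δ) + δ * eigZero N α)) :=
    mul_le_mul h3 h1 (abs_nonneg _) (by positivity)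
  have h7 : |r ^ (N - 1) - 1| ≤ N * 2 ^ N * δ :=
    h2.trans (mul_le_mul h4 hr (abs_nonneg _) (by positivity))
  have h8 := mul_le_mul_of_nonneg_left h7
    (mul_nonneg (abs_nonneg (eigOne N α)) (abs_nonneg (r - 1)))
  linarith

theorem integral_one_add_sub_one (t : ℝ) : ∫ r in (1 : ℝ)..(1 + t), (r - 1) = t ^ 2 / 2 := by
  rw [intervalIntegral.integral_comp_sub_right (fun r => r) 1, integral_id]
  ring

theorem integral_indDiff {E : Set (Space N)} (hEm : MeasurableSet E)
    (hvol : volume E = volume (ball (0 : Space N) 1)) : ∫ z, indDiff E z = 0 := by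
  have h : volume E ≠ ⊤ := by rw [hvol]; exact measure_ball_lt_top.ne
  simp only [indDiff]
  rw [integral_sub ((integrable_indicator_iff hEm).2 (integrableOn_const h))
    ((integrable_indicator_iff measurableSet_ball).2
      (integrableOn_const measure_ball_lt_top.ne)), integral_indicator_one hEm,
    integral_indicator_one measurableSet_ball, measureReal_def, measureReal_def, hvol, sub_self]

theorem integral_radial_vol [Fact (2 ≤ N)] {E : Set (Space N)} {u : USphere N → ℝ}
    (hE : IsRadialGraph E u) (hEm : MeasurableSet E) (hu : ∀ x, |u x| ≤ 1 / 2)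
    (hvol : volume E = volume (ball (0 : Space N) 1)) :
    ∫ x, (∫ r in (1 : ℝ)..(1 + u x), r ^ (N - 1)) ∂(surf N) = 0 := by
  have h := integral_indDiff_mul hE hEm hu (h := fun _ ↦ 1)
    (integrableOn_const measure_ball_lt_top.ne)
  simp only [mul_one] at h
  rw [← h, integral_indDiff hEm hvol]

/-- The interaction of a thin volume preserving shell with the ball. -/
theorem abs_mutual_ball_le [Fact (2 ≤ N)] (hα₁ : 1 < α) (hα₂ : α < N) {E : Set (Space N)}
    {u : USphere N → ℝ} (hE : IsRadialGraph E u) (hEm : MeasurableSet E) (hum : IsBM u) {δ : ℝ}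
    (hδ : δ ≤ 1 / 4) (hu : ∀ x, |u x| ≤ δ)
    (hvol : volume E = volume (ball (0 : Space N) 1)) :
    |mutualEnergy α (indDiff E) ((ball (0 : Space N) 1).indicator 1) +
      eigOne N α / 2 * normSq u| ≤ ballMod N α δ * normSq u := by
  have hu2 : ∀ x, |u x| ≤ 1 / 2 := fun x => (hu x).trans (hδ.trans (by norm_num))
  have hh := integrableOn_pot hα₁ (isDensity_ball (N := N))
  have hrad := integrable_radial hE hEm hu2 hh
  have h1rad := integrable_radial hE hEm hu2 (h := fun _ ↦ 1)
    (integrableOn_const measure_ball_lt_top.ne)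
  simp only [mul_one] at h1rad
  have h1 : mutualEnergy α (indDiff E) ((ball (0 : Space N) 1).indicator 1) +
      eigOne N α / 2 * normSq u = ∫ x, ((∫ r in (1 : ℝ)..(1 + u x), r ^ (N - 1) *
        pot α ((ball (0 : Space N) 1).indicator 1) (r • (x : Space N))) -
        (∫ r in (1 : ℝ)..(1 + u x), r ^ (N - 1)) * ballPotOne N α +
        eigOne N α / 2 * u x ^ 2) ∂(surf N) := by
    have hsub : Integrable (fun x : USphere N ↦ (∫ r in (1 : ℝ)..(1 + u x), r ^ (N - 1) *
        pot α ((ball (0 : Space N) 1).indicator 1) (r • (x : Space N))) -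
        (∫ r in (1 : ℝ)..(1 + u x), r ^ (N - 1)) * ballPotOne N α) (surf N) :=
      hrad.sub (h1rad.mul_const _)
    rw [integral_add hsub (hum.sq.integrable.const_mul _), integral_sub hrad (h1rad.mul_const _),
      integral_mul_const, integral_radial_vol hE hEm hu2 hvol, zero_mul, sub_zero, integral_const_mul,
      mutualEnergy,
      integral_indDiff_mul hE hEm hu2 hh, normSq]
  rw [h1, normSq, ← integral_const_mul]
  refine (abs_integral_le_integral_abs).trans (integral_mono_ae
    ((hrad.sub (h1rad.mul_const _)).add (hum.sq.integrable.const_mul _)).abs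
    (hum.sq.integrable.const_mul _) ?_)
  filter_upwards [ae_intervalIntegrable_radial hh] with x hi
  have hi := hi _ (hu2 x)
  have hp : IntervalIntegrable (fun r : ℝ ↦ r ^ (N - 1)) volume 1 (1 + u x) :=
    (continuous_pow _).intervalIntegrable _ _
  have hl : IntervalIntegrable (fun r : ℝ ↦ r - 1) volume 1 (1 + u x) :=
    (continuous_id.sub continuous_const).intervalIntegrable _ _
  have h2 : (∫ r in (1 : ℝ)..(1 + u x), r ^ (N - 1) *
        pot α ((ball (0 : Space N) 1).indicator 1) (r • (x : Space N))) -
        (∫ r in (1 : ℝ)..(1 + u x), r ^ (N - 1)) * ballPotOne N α + eigOne N α / 2 * u x ^ 2 =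
      ∫ r in (1 : ℝ)..(1 + u x), (r ^ (N - 1) *
        (pot α ((ball (0 : Space N) 1).indicator 1) (r • (x : Space N)) - ballPotOne N α) +
        eigOne N α * (r - 1)) := by
    simp only [mul_sub (_ ^ (N - 1))]
    rw [intervalIntegral.integral_add (hi.sub (hp.mul_const _)) (hl.const_mul _),
      intervalIntegral.integral_sub hi (hp.mul_const _), intervalIntegral.integral_mul_const,
      intervalIntegral.integral_const_mul, integral_one_add_sub_one]
    ring
  have hM : 0 ≤ ballMod N α δ * |u x| := by
    by_cases h0 : u x = 0
    · simp [h0]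
    · refine (abs_nonneg _).trans
        ((abs_polar_ballPot_le hα₁ hα₂ hδ (r := 1 + u x) (by simpa using hu x) x).trans_eq ?_)
      simp
  have hM' : ∀ r, |r - 1| ≤ |u x| → ballMod N α δ * |r - 1| ≤ ballMod N α δ * |u x| := by
    intro r hr
    by_cases h0 : |u x| = 0
    · have : |r - 1| = 0 := le_antisymm (hr.trans_eq h0) (abs_nonneg _)
      rw [this, h0]
    · have : 0 ≤ ballMod N α δ :=
        nonneg_of_mul_nonneg_left hM (lt_of_le_of_ne (abs_nonneg _) (Ne.symm h0))
      gcongr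
  rw [h2, ← sq_abs, pow_two, ← mul_assoc]
  exact abs_integral_one_add_le fun r hr =>
    (abs_polar_ballPot_le hα₁ hα₂ hδ (hr.trans (hu x)) x).trans (hM' r hr)

end BallPotential

section Combine

variable {N : ℕ} {α : ℝ}

theorem integral_one_add_pow (n : ℕ) (t : ℝ) :
    ∫ r in (1 : ℝ)..(1 + t), r ^ n = ((1 + t) ^ (n + 1) - 1) / (n + 1) := by
  rw [integral_pow, one_pow]

theorem IsBM.integral_one_add_pow {u : USphere N → ℝ} (hum : IsBM u) (n : ℕ) :
    IsBM (fun x ↦ ∫ r in (1 : ℝ)..(1 + u x), r ^ n) := by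
  obtain ⟨C, hC⟩ := hum.bdd
  simp only [FugledeRiesz.integral_one_add_pow]
  refine ⟨by have := hum.measurable; fun_prop, ((1 + C) ^ (n + 1) + 1) / (n + 1), fun x => ?_⟩
  have h0 : (0 : ℝ) < n + 1 := by positivity
  rw [abs_div, abs_of_pos h0]
  gcongr
  refine (abs_sub _ _).trans ?_
  rw [abs_one, abs_pow]
  gcongr
  exact (abs_add_le _ _).trans (by rw [abs_one]; linarith [hC x])

/-- A vanishing radial moment forces the corresponding moment of the profile to be of second
order. -/
theorem abs_moment_le {u w : USphere N → ℝ} (hum : IsBM u) (hw : IsBM w)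
    (hw1 : ∀ x, |w x| ≤ 1) (hu : ∀ x, |u x| ≤ 1 / 2) {n : ℕ}
    (h : ∫ x, (∫ r in (1 : ℝ)..(1 + u x), r ^ n) * w x ∂(surf N) = 0) :
    |∫ x, u x * w x ∂(surf N)| ≤ n * 2 ^ n * normSq u := by
  have hP := hum.integral_one_add_pow n
  have h1 : ∫ x, u x * w x ∂(surf N) =
      - ∫ x, ((∫ r in (1 : ℝ)..(1 + u x), r ^ n) - u x) * w x ∂(surf N) := by
    simp only [sub_mul]
    rw [integral_sub (hP.mul hw).integrable (hum.mul hw).integrable, h, zero_sub, neg_neg]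
  rw [h1, abs_neg, normSq, ← integral_const_mul]
  refine (abs_integral_le_integral_abs).trans (integral_mono
    ((hP.sub hum).mul hw).abs.integrable (hum.sq.const_mul _).integrable fun x => ?_)
  have h2 : (∫ r in (1 : ℝ)..(1 + u x), r ^ n) - u x = ∫ r in (1 : ℝ)..(1 + u x), (r ^ n - 1) := by
    rw [intervalIntegral.integral_sub ((continuous_pow _).intervalIntegrable _ _)
      intervalIntegrable_const, intervalIntegral.integral_const]
    simp
  have h3 : |∫ r in (1 : ℝ)..(1 + u x), (r ^ n - 1)| ≤ n * 2 ^ n * |u x| * |u x| :=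
    abs_integral_one_add_le fun r hr => (abs_pow_sub_one_le (hr.trans (hu x)) n).trans (by gcongr)
  rw [abs_mul, h2]
  refine (mul_le_of_le_one_right (abs_nonneg _) (hw1 x)).trans (h3.trans_eq ?_)
  rw [mul_assoc, ← pow_two, sq_abs]

theorem integrableOn_inner_ball (e : Space N) :
    IntegrableOn (fun z : Space N ↦ inner ℝ z e) (ball (0 : Space N) 2) :=
  ((by fun_prop : Continuous fun z : Space N ↦ inner ℝ z e).continuousOn.integrableOn_compact
    (isCompact_closedBall (0 : Space N) 2)).mono_set ball_subset_closedBall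

theorem setIntegral_inner_eq_zero [Fact (2 ≤ N)] {E : Set (Space N)}
    (h2 : E ⊆ ball (0 : Space N) 2)
    (hvol : volume E = volume (ball (0 : Space N) 1)) (hbar : barycenter N E = 0) (e : Space N) :
    ∫ z in E, inner ℝ z e = 0 := by
  have hpos : (volume E).toReal ≠ 0 := by
    rw [hvol]
    exact (ENNReal.toReal_pos (measure_ball_pos _ _ one_pos).ne' measure_ball_lt_top.ne).ne'
  have h0 : ∫ z in E, z = 0 := by
    rw [barycenter, smul_eq_zero] at hbar
    exact hbar.resolve_left (inv_ne_zero hpos)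
  have hi : IntegrableOn (fun z : Space N ↦ z) E :=
    ((continuous_id.continuousOn.integrableOn_compact
      (isCompact_closedBall (0 : Space N) 2)).mono_set ball_subset_closedBall).mono_set h2
  have h1 := integral_inner (𝕜 := ℝ) hi e
  simp only [real_inner_comm] at h1 ⊢
  rw [h0, inner_zero_right] at h1
  exact h1

theorem setIntegral_inner_ball (e : Space N) :
    ∫ z in ball (0 : Space N) 1, inner ℝ z e = 0 := by
  have h : ∫ z in ball (0 : Space N) 1, inner ℝ z e =
      - ∫ z in ball (0 : Space N) 1, inner ℝ z e := by
    rw [← integral_indicator measurableSet_ball]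
    conv_lhs => rw [← integral_neg_eq_self]
    rw [← integral_neg]
    congr 1; ext z
    classical
    simp only [Set.indicator_apply, mem_ball_zero_iff, norm_neg, inner_neg_left]
    split_ifs <;> simp
  linarith

theorem integral_indDiff_inner [Fact (2 ≤ N)] {E : Set (Space N)} (hEm : MeasurableSet E)
    (h2 : E ⊆ ball (0 : Space N) 2)
    (hvol : volume E = volume (ball (0 : Space N) 1)) (hbar : barycenter N E = 0) (e : Space N) :
    ∫ z, indDiff E z * inner ℝ z e = 0 := by
  have hi := integrableOn_inner_ball e
  have hind : ∀ F : Set (Space N), (fun z ↦ F.indicator 1 z * inner ℝ z e) =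
      F.indicator (fun z ↦ inner ℝ z e) := fun F => by
    ext z
    by_cases hz : z ∈ F <;> simp [hz]
  have hiE : Integrable (fun z ↦ E.indicator 1 z * inner ℝ z e) := by
    rw [hind]
    exact (integrable_indicator_iff hEm).2 (hi.mono_set h2)
  have hiB : Integrable (fun z ↦ (ball (0 : Space N) 1).indicator 1 z * inner ℝ z e) := by
    rw [hind]
    exact (integrable_indicator_iff measurableSet_ball).2
      (hi.mono_set (ball_subset_ball (by norm_num)))
  simp only [indDiff, sub_mul]
  rw [integral_sub hiE hiB, hind, hind, integral_indicator hEm,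
    integral_indicator measurableSet_ball, setIntegral_inner_eq_zero h2 hvol hbar,
    setIntegral_inner_ball, sub_zero]

theorem abs_integral_le_normSq [Fact (2 ≤ N)] {E : Set (Space N)} {u : USphere N → ℝ}
    (hE : IsRadialGraph E u) (hEm : MeasurableSet E) (hum : IsBM u) (hu : ∀ x, |u x| ≤ 1 / 2)
    (hvol : volume E = volume (ball (0 : Space N) 1)) :
    |∫ x, u x ∂(surf N)| ≤ N * 2 ^ N * normSq u := by
  have h := abs_moment_le hum (.const 1) (fun _ => by simp) hu (n := N - 1)
    (by simpa using integral_radial_vol hE hEm hu hvol)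
  simp only [mul_one] at h
  refine h.trans ?_
  have := normSq_nonneg u
  gcongr
  · exact Nat.sub_le N 1
  · norm_num
  · exact Nat.sub_le N 1

theorem abs_integral_inner_le_normSq [Fact (2 ≤ N)] {E : Set (Space N)} {u : USphere N → ℝ}
    (hE : IsRadialGraph E u) (hEm : MeasurableSet E) (hum : IsBM u) (hu : ∀ x, |u x| ≤ 1 / 2)
    (hvol : volume E = volume (ball (0 : Space N) 1)) (hbar : barycenter N E = 0) {e : Space N}
    (he : ‖e‖ = 1) :
    |∫ x : USphere N, u x * inner ℝ (x : Space N) e ∂(surf N)| ≤ N * 2 ^ N * normSq u := by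
  refine abs_moment_le hum (.inner e) (fun x => ?_) hu ?_
  · simpa [norm_coe, he] using abs_real_inner_le_norm (x : Space N) e
  · rw [← integral_indDiff_inner hEm (fun z hz => hE.mem_ball hu hz) hvol hbar e,
      integral_indDiff_mul hE hEm hu (integrableOn_inner_ball e)]
    congr 1; ext x
    rw [← intervalIntegral.integral_mul_const]
    congr 1; ext r
    have hN : N = N - 1 + 1 := by have := Fact.out (p := 2 ≤ N); omega
    rw [inner_smul_left, conj_trivial, ← mul_assoc, ← pow_succ, ← hN]

theorem tendsto_ballMod [Fact (2 ≤ N)] (hα₁ : 1 < α) (hα₂ : α < N) :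
    Filter.Tendsto (ballMod N α) (nhdsWithin 0 (Set.Ioi 0)) (nhds 0) := by
  have h1 : Filter.Tendsto (fun δ : ℝ ↦ δ) (nhdsWithin 0 (Set.Ioi 0)) (nhds 0) :=
    Filter.tendsto_id.mono_left nhdsWithin_le_nhds
  have h2 : Filter.Tendsto (fun δ : ℝ ↦ 2 * δ) (nhdsWithin 0 (Set.Ioi 0))
      (nhdsWithin 0 (Set.Ioi 0)) := by
    refine tendsto_nhdsWithin_iff.2 ⟨by simpa using h1.const_mul 2, ?_⟩
    filter_upwards [self_mem_nhdsWithin] with δ hδ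
    exact mul_pos two_pos (Set.mem_Ioi.1 hδ)
  have h3 := (tendsto_errMod (N := N) hα₁ hα₂).comp h2
  have h4 := (((h3.const_mul 2).add (h1.mul_const (eigZero N α))).const_mul ((2 : ℝ) ^ N)).add
    (h1.const_mul (|eigOne N α| * (N * 2 ^ N)))
  simp only [Function.comp_def, zero_mul, mul_zero, add_zero] at h4
  exact h4

theorem normSq_le_of_abs_le {u : USphere N → ℝ} (hum : IsBM u) {δ : ℝ} (hu : ∀ x, |u x| ≤ δ) :
    normSq u ≤ (surf N).real Set.univ * δ ^ 2 := by
  have h := integral_mono hum.sq.integrable (integrable_const (δ ^ 2)) (fun x =>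
    sq_le_sq' (abs_le.1 (hu x)).1 (abs_le.1 (hu x)).2)
  simpa [normSq] using h

/-- Stability of the ball among radial graphs, in terms of the surface measure. -/
theorem exists_energy_gap [Fact (2 ≤ N)] (hα₁ : 1 < α) (hα₂ : α < N) :
    ∃ δ c : ℝ, 0 < δ ∧ δ ≤ 1 / 4 ∧ 0 < c ∧ ∀ (E : Set (Space N)) (u : USphere N → ℝ),
      IsRadialGraph E u → MeasurableSet E → IsBM u → (∀ x, |u x| ≤ δ) →
      volume E = volume (ball (0 : Space N) 1) → barycenter N E = 0 →
      c * normSq u ≤ rieszEnergy N α (ball (0 : Space N) 1) - rieszEnergy N α E := by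
  obtain ⟨c, C, hc, hC, hgap⟩ := spectral_gap (N := N) hα₁ hα₂
  set K : ℝ := N * 2 ^ N with hK
  set σ := (surf N).real Set.univ
  have h1 : Filter.Tendsto (fun δ : ℝ ↦ δ) (nhdsWithin 0 (Set.Ioi 0)) (nhds 0) :=
    Filter.tendsto_id.mono_left nhdsWithin_le_nhds
  have hlim : Filter.Tendsto (fun δ ↦ 2 * ballMod N α δ + errMod N α δ +
      C * (2 * K ^ 2) * σ * δ ^ 2) (nhdsWithin 0 (Set.Ioi 0)) (nhds 0) := by
    simpa using (((tendsto_ballMod (N := N) hα₁ hα₂).const_mul 2).add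
      (tendsto_errMod (N := N) hα₁ hα₂)).add ((h1.pow 2).const_mul (C * (2 * K ^ 2) * σ))
  obtain ⟨δ, ⟨hδ1, hδ2⟩, hδ0⟩ := ((((hlim.eventually (gt_mem_nhds (half_pos hc))).and
    (h1.eventually (gt_mem_nhds (by norm_num : (0 : ℝ) < 1 / 4)))).and
    self_mem_nhdsWithin).exists)
  have hδ0 : 0 < δ := hδ0
  refine ⟨δ, c / 2, hδ0, hδ2.le, half_pos hc, fun E u hE hEm hum hu hvol hbar => ?_⟩
  have hu2 : ∀ x, |u x| ≤ 1 / 2 := fun x => (hu x).trans (by linarith)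
  have hn := normSq_nonneg u
  have hg := hgap u hum (K * normSq u) (by positivity)
    (fun e he => abs_integral_inner_le_normSq hE hEm hum hu2 hvol hbar he)
  have hI : (∫ x, u x ∂(surf N)) ^ 2 ≤ (K * normSq u) ^ 2 :=
    sq_le_sq' (abs_le.1 (abs_integral_le_normSq hE hEm hum hu2 hvol)).1
      (abs_le.1 (abs_integral_le_normSq hE hEm hum hu2 hvol)).2
  have h2 := abs_le.1 (abs_mutual_ball_le hα₁ hα₂ hE hEm hum hδ2.le hu hvol)
  have h3 := abs_le.1 (abs_mutual_sub_kform_le hα₁ hα₂ hE hEm hum hδ0.le (by linarith) hu)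
  have h4 : C * ((∫ x, u x ∂(surf N)) ^ 2 + (K * normSq u) ^ 2) ≤
      C * (2 * K ^ 2) * σ * δ ^ 2 * normSq u := by
    calc C * ((∫ x, u x ∂(surf N)) ^ 2 + (K * normSq u) ^ 2)
        ≤ C * ((K * normSq u) ^ 2 + (K * normSq u) ^ 2) := by gcongr
      _ = C * (2 * K ^ 2) * (normSq u * normSq u) := by ring
      _ ≤ C * (2 * K ^ 2) * ((σ * δ ^ 2) * normSq u) := by
        gcongr
        exact normSq_le_of_abs_le hum hu
      _ = _ := by ring
  have h5 := mul_le_mul_of_nonneg_right hδ1.le hn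
  rw [rieszEnergy_ball_sub hα₁ hEm (fun z hz => hE.mem_ball hu2 hz)]
  nlinarith [h2.2, h3.2]

theorem integral_abs_sq_le [Fact (2 ≤ N)] {u : USphere N → ℝ} (hum : IsBM u) :
    (∫ x, |u x| ∂(surf N)) ^ 2 ≤ (surf N).real Set.univ * normSq u := by
  have hσ := surf_real_univ_pos (N := N)
  set σ := (surf N).real Set.univ
  set I := ∫ x, |u x| ∂(surf N)
  have h0 : 0 ≤ ∫ x, (σ * |u x| - I) ^ 2 ∂(surf N) := integral_nonneg fun x => sq_nonneg _
  have h1 : ∫ x, (σ * |u x| - I) ^ 2 ∂(surf N) = σ ^ 2 * normSq u - 2 * σ * I * I + σ * I ^ 2 := by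
    have h2 : ∀ x, (σ * |u x| - I) ^ 2 = σ ^ 2 * u x ^ 2 - 2 * σ * I * |u x| + I ^ 2 := fun x => by
      rw [← sq_abs (u x)]; ring
    simp only [h2]
    rw [integral_add ((hum.sq.const_mul _).sub (hum.abs.const_mul _)).integrable
      (integrable_const _), integral_sub (hum.sq.const_mul _).integrable
      (hum.abs.const_mul _).integrable, integral_const_mul, integral_const_mul, integral_const]
    rfl
  rw [h1] at h0
  nlinarith

/-- The asymmetry of a radial graph is controlled by the profile. -/
theorem sq_volume_symmDiff_le [Fact (2 ≤ N)] {E : Set (Space N)} {u : USphere N → ℝ}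
    (hE : IsRadialGraph E u) (hEm : MeasurableSet E) (hum : IsBM u) (hu : ∀ x, |u x| ≤ 1 / 2) :
    (volume (E ∆ ball (0 : Space N) 1)).toReal ^ 2 ≤
      (2 ^ N) ^ 2 * (surf N).real Set.univ * normSq u := by
  have hh : IntegrableOn (indDiff E) (ball (0 : Space N) 2) :=
    Measure.integrableOn_of_bounded measure_ball_lt_top.ne
      (measurable_indDiff hEm).aestronglyMeasurable (M := 1) (.of_forall (abs_indDiff_le E))
  have h1 : (volume (E ∆ ball (0 : Space N) 1)).toReal = ∫ z, indDiff E z * indDiff E z := by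
    rw [← measureReal_def, ← integral_indicator_one (hEm.symmDiff measurableSet_ball)]
    congr 1; ext z
    classical
    simp only [indDiff, Set.indicator_apply, Set.mem_symmDiff, Pi.one_apply]
    by_cases h1 : z ∈ E <;> by_cases h2 : z ∈ ball (0 : Space N) 1 <;> simp [h1, h2]
  have h2 : (volume (E ∆ ball (0 : Space N) 1)).toReal ≤ 2 ^ N * ∫ x, |u x| ∂(surf N) := by
    rw [h1, integral_indDiff_mul hE hEm hu hh, ← integral_const_mul]
    refine integral_mono (integrable_radial hE hEm hu hh) (hum.abs.const_mul _).integrable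
      fun x => (le_abs_self _).trans (abs_integral_one_add_le fun r hr => ?_)
    have hr2 : |r| ≤ 2 := by
      have := hr.trans (hu x)
      rw [abs_le] at this ⊢
      constructor <;> linarith
    rw [abs_mul, abs_pow]
    calc |r| ^ (N - 1) * |indDiff E (r • (x : Space N))| ≤ 2 ^ (N - 1) * 1 := by
          gcongr
          exact abs_indDiff_le E _
      _ ≤ 2 ^ N := by
        rw [mul_one]
        exact pow_le_pow_right₀ (by norm_num) (Nat.sub_le N 1)
  calc (volume (E ∆ ball (0 : Space N) 1)).toReal ^ 2 ≤ (2 ^ N * ∫ x, |u x| ∂(surf N)) ^ 2 := by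
        gcongr
    _ = (2 ^ N) ^ 2 * (∫ x, |u x| ∂(surf N)) ^ 2 := by ring
    _ ≤ (2 ^ N) ^ 2 * ((surf N).real Set.univ * normSq u) := by
      gcongr
      exact integral_abs_sq_le hum
    _ = _ := by ring

end Combine

section Hausdorff

variable {N : ℕ}

/-- The Hausdorff measure of codimension one on the unit sphere. -/
noncomputable abbrev hausSurf (N : ℕ) : Measure (USphere N) := μH[(N : ℝ) - 1]

theorem measurePreserving_rot_hausSurf (g : Space N ≃ₗᵢ[ℝ] Space N) :
    MeasurePreserving (rot g) (hausSurf N) (hausSurf N) :=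
  IsometryEquiv.measurePreserving_hausdorffMeasure
    (X := USphere N) ⟨(rot g).toEquiv, fun x y => g.isometry x y⟩ _

theorem finrank_tangent [Fact (2 ≤ N)] {v : Space N} (hv : ‖v‖ = 1) :
    ((Module.finrank ℝ (ℝ ∙ v)ᗮ : ℕ) : ℝ) = (N : ℝ) - 1 := by
  have hN : 2 ≤ N := Fact.out
  have : Fact (Module.finrank ℝ (Space N) = (N - 1) + 1) := ⟨by rw [finrank_space]; omega⟩
  rw [Submodule.finrank_orthogonal_span_singleton (n := N - 1)
    (by rintro rfl; simp at hv), Nat.cast_sub (by omega), Nat.cast_one]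

theorem finiteAt_hausSurf [Fact (2 ≤ N)] (x : USphere N) :
    (hausSurf N).FiniteAtFilter (nhds x) := by
  have hN : 2 ≤ N := Fact.out
  set v : Space N := -(x : Space N)
  have hv : ‖v‖ = 1 := by rw [norm_neg, norm_coe]
  have h0 : (stereographic hv).symm 0 = x := by
    ext1
    change ((stereoInvFun hv 0 : USphere N) : Space N) = x
    simp [v, smul_smul]
  have hc : ContDiffAt ℝ 1 (fun w : (ℝ ∙ v)ᗮ ↦ stereoInvFunAux v (w : Space N)) 0 :=
    (contDiff_stereoInvFunAux.comp (ℝ ∙ v)ᗮ.subtypeL.contDiff).contDiffAt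
  obtain ⟨K, t, ht, hK⟩ := hc.exists_lipschitzOnWith
  have hK' : LipschitzOnWith K (stereoInvFun hv) (t ∩ ball 0 1) :=
    fun a ha b hb => hK ha.1 hb.1
  refine ⟨stereoInvFun hv '' (t ∩ ball 0 1), ?_, ?_⟩
  · have h1 := (stereographic hv).symm.image_mem_nhds (x := 0) (by simp)
      (Filter.inter_mem ht (ball_mem_nhds 0 one_pos))
    rw [h0] at h1
    exact h1
  · refine (hK'.hausdorffMeasure_image_le (d := (N : ℝ) - 1) ?_).trans_lt ?_
    · have : (2 : ℝ) ≤ N := by exact_mod_cast hN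
      linarith
    · refine ENNReal.mul_lt_top (ENNReal.rpow_lt_top_of_nonneg ?_ ENNReal.coe_ne_top) ?_
      · have : (2 : ℝ) ≤ N := by exact_mod_cast hN
        linarith
      · refine (measure_mono Set.inter_subset_right).trans_lt ?_
        rw [← finrank_tangent hv]
        exact measure_ball_lt_top

instance [Fact (2 ≤ N)] : IsFiniteMeasure (hausSurf N) :=
  ⟨isCompact_univ.measure_lt_top_of_nhdsWithin fun x _ => by
    rw [nhdsWithin_univ]
    exact finiteAt_hausSurf x⟩

theorem hausSurf_univ_ne_zero [Fact (2 ≤ N)] : hausSurf N Set.univ ≠ 0 := by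
  have hN : 2 ≤ N := Fact.out
  obtain ⟨v, hv⟩ : ∃ v : Space N, ‖v‖ = 1 := ⟨_, norm_coe (Classical.arbitrary (USphere N))⟩
  have hL : LipschitzWith 1
      (fun y : USphere N ↦ (ℝ ∙ v)ᗮ.orthogonalProjectionOnto (y : Space N)) := by
    have h := (ℝ ∙ v)ᗮ.lipschitzWith_orthogonalProjectionOnto.comp
      (LipschitzWith.subtype_val (sphere (0 : Space N) 1))
    rw [mul_one] at h
    exact h
  have h1 := hL.hausdorffMeasure_image_le (d := (N : ℝ) - 1)
    (by have : (2 : ℝ) ≤ N := by exact_mod_cast hN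
        linarith) Set.univ
  have h2 : ball 0 1 ⊆
      (fun y : USphere N ↦ (ℝ ∙ v)ᗮ.orthogonalProjectionOnto (y : Space N)) '' Set.univ := by
    intro w hw
    rw [mem_ball_zero_iff] at hw
    have hvw : inner ℝ (w : Space N) v = 0 :=
      Submodule.mem_orthogonal_singleton_iff_inner_left.mp w.2
    have hs : 0 ≤ 1 - ‖w‖ ^ 2 := by nlinarith [norm_nonneg w]
    have hn : ‖(w : Space N) + √(1 - ‖w‖ ^ 2) • v‖ = 1 := by
      rw [← sq_eq_sq₀ (norm_nonneg _) zero_le_one, norm_add_sq_real, norm_smul, hv,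
        inner_smul_right, hvw, mul_one, Real.norm_eq_abs, sq_abs, Real.sq_sqrt hs,
        Submodule.coe_norm]
      ring
    refine ⟨⟨_, mem_sphere_zero_iff_norm.2 hn⟩, trivial, ?_⟩
    simp [Submodule.orthogonalProjectionOnto_orthogonalComplement_singleton_eq_zero]
  have h3 : 0 < (μH[(N : ℝ) - 1] : Measure (ℝ ∙ v)ᗮ) (ball 0 1) := by
    rw [← finrank_tangent hv]
    exact measure_ball_pos _ _ one_pos
  intro h4
  have h5 := (measure_mono h2).trans h1
  rw [h4, mul_zero] at h5
  exact absurd h5 (not_le.2 h3)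

/-- The Hausdorff measure on the sphere is a multiple of the surface measure. -/
theorem hausSurf_eq [Fact (2 ≤ N)] :
    hausSurf N = (hausSurf N Set.univ / surf N Set.univ) • surf N := by
  ext s hs
  set x₀ : USphere N := Classical.arbitrary _
  have hf : Measurable (s.indicator (1 : USphere N → ENNReal)) := measurable_one.indicator hs
  have h1 := lintegral_invariant measurePreserving_rot_hausSurf hf x₀
  have h2 := lintegral_invariant measurePreserving_rot hf x₀
  rw [lintegral_indicator_one hs] at h1 h2
  set H := (Measure.haar : Measure (OGroup N)) Set.univ
  set A := ∫⁻ g, s.indicator (1 : USphere N → ENNReal) (act g x₀)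
    ∂(Measure.haar : Measure (OGroup N))
  have hH0 : H ≠ 0 := by simp [H, NeZero.ne]
  have hH : H ≠ ⊤ := measure_ne_top _ _
  have hS0 : surf N Set.univ ≠ 0 := by
    rw [Ne, Measure.measure_univ_eq_zero]
    exact surf_ne_zero
  have hS : surf N Set.univ ≠ ⊤ := measure_ne_top _ _
  rw [Measure.smul_apply, smul_eq_mul]
  refine (ENNReal.mul_left_inj hH0 hH).1 ?_
  rw [h1, mul_assoc, h2, ENNReal.div_eq_inv_mul, mul_comm (surf N Set.univ)⁻¹, mul_assoc,
    mul_left_comm _ A, ENNReal.inv_mul_cancel hS0 hS, mul_one, mul_comm]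

/-- Integration over the sphere against the Hausdorff measure. -/
theorem exists_setIntegral_sphere_eq [Fact (2 ≤ N)] : ∃ k : ℝ, 0 < k ∧
    ∀ f : Space N → ℝ, ∫ x in sphere (0 : Space N) 1, f x ∂(μH[(N : ℝ) - 1]) =
      k * ∫ x : USphere N, f x ∂(surf N) := by
  refine ⟨(hausSurf N Set.univ / surf N Set.univ).toReal, ?_, fun f => ?_⟩
  · have hS0 : surf N Set.univ ≠ 0 := by
      rw [Ne, Measure.measure_univ_eq_zero]
      exact surf_ne_zero
    exact ENNReal.toReal_pos (ENNReal.div_ne_zero.2 ⟨hausSurf_univ_ne_zero, measure_ne_top _ _⟩)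
      (ENNReal.div_ne_top (measure_ne_top _ _) hS0)
  · have h1 := isometry_subtype_coe (s := sphere (0 : Space N) 1) |>.map_hausdorffMeasure
      (d := (N : ℝ) - 1) (.inl (by
        have : (2 : ℝ) ≤ N := by exact_mod_cast (Fact.out : 2 ≤ N)
        linarith))
    rw [Subtype.range_coe] at h1
    rw [← h1, (MeasurableEmbedding.subtype_coe isClosed_sphere.measurableSet).integral_map,
      ← smul_eq_mul, ← integral_smul_measure, ← hausSurf_eq]

end Hausdorff

section Final

variable {N : ℕ}

theorem isRadialGraph_of_eq {E : Set (Space N)} {u : Space N → ℝ} {ε : ℝ} (hε : ε ≤ 1 / 2)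
    (hu : ∀ x ∈ sphere (0 : Space N) 1, |u x| ≤ ε)
    (hE : E = {p : Space N | ∃ x ∈ sphere (0 : Space N) 1, ∃ ρ : ℝ,
      0 < ρ ∧ ρ < 1 ∧ p = (1 + u x) • ρ • x}) :
    IsRadialGraph E (fun x : USphere N ↦ u x) := by
  intro x r hr
  have hpos : ∀ y ∈ sphere (0 : Space N) 1, 0 < 1 + u y := fun y hy => by
    linarith [(abs_le.1 (hu y hy)).1]
  rw [hE, Set.mem_ofPred_eq]
  constructor
  · rintro ⟨y, hy, ρ, hρ, hρ1, h⟩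
    have hy1 := hpos y hy
    have hn := congrArg norm h
    rw [norm_smul, norm_smul, norm_smul, norm_coe, mem_sphere_zero_iff_norm.1 hy, mul_one, mul_one,
      Real.norm_of_nonneg hr.le, Real.norm_of_nonneg hy1.le, Real.norm_of_nonneg hρ.le] at hn
    rw [smul_smul, ← hn] at h
    have hxy : (x : Space N) = y := smul_right_injective _ hr.ne' h
    change r < 1 + u x
    rw [hxy, hn]
    exact mul_lt_of_lt_one_right hy1 hρ1
  · intro h
    have hx1 := hpos x x.2
    refine ⟨x, x.2, r / (1 + u x), div_pos hr hx1, (div_lt_one hx1).2 h, ?_⟩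
    rw [smul_smul, mul_div_cancel₀ _ hx1.ne']

end Final

end FugledeRiesz

theorem fuglede_estimate_riesz (N : ℕ) (hN : 2 ≤ N) (α : ℝ) (hα₁ : 1 < α) (hα₂ : α < N) :
    ∃ ε₀ C₀ C₁ : ℝ, 0 < ε₀ ∧ 0 < C₀ ∧ 0 < C₁ ∧
      ∀ E : Set (EuclideanSpace ℝ (Fin N)), MeasurableSet E →
        volume E = volume (ball (0 : EuclideanSpace ℝ (Fin N)) 1) →
        barycenter N E = 0 →
        ∀ u : EuclideanSpace ℝ (Fin N) → ℝ, Measurable u →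
          (∀ x ∈ sphere (0 : EuclideanSpace ℝ (Fin N)) 1, |u x| ≤ ε₀) →
          E = {p : EuclideanSpace ℝ (Fin N) |
              ∃ x ∈ sphere (0 : EuclideanSpace ℝ (Fin N)) 1, ∃ ρ : ℝ,
                0 < ρ ∧ ρ < 1 ∧ p = (1 + u x) • ρ • x} →
          rieszEnergy N α (ball (0 : EuclideanSpace ℝ (Fin N)) 1) - rieszEnergy N α E ≥
              C₀ * ∫ x in sphere (0 : EuclideanSpace ℝ (Fin N)) 1, u x ^ 2
                ∂(μH[(N : ℝ) - 1]) ∧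
            C₀ * (∫ x in sphere (0 : EuclideanSpace ℝ (Fin N)) 1, u x ^ 2
                ∂(μH[(N : ℝ) - 1])) ≥
              C₁ * ((volume (E ∆ ball (0 : EuclideanSpace ℝ (Fin N)) 1)).toReal) ^ 2 := by
  have : Fact (2 ≤ N) := ⟨hN⟩
  obtain ⟨δ, c, hδ0, hδ, hc, hgap⟩ := FugledeRiesz.exists_energy_gap (N := N) hα₁ hα₂
  obtain ⟨k, hk, hkint⟩ := FugledeRiesz.exists_setIntegral_sphere_eq (N := N)
  have hσ := FugledeRiesz.surf_real_univ_pos (N := N)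
  set σ := (FugledeRiesz.surf N).real Set.univ
  refine ⟨δ, c / k, c / ((2 ^ N) ^ 2 * σ), hδ0, by positivity, by positivity,
    fun E hEm hvol hbar u hum hu hE => ?_⟩
  have hE' := FugledeRiesz.isRadialGraph_of_eq (by linarith) hu hE
  have hu' : ∀ x : FugledeRiesz.USphere N, |u x| ≤ δ := fun x => hu x x.2
  have hBM : FugledeRiesz.IsBM (fun x : FugledeRiesz.USphere N ↦ u x) :=
    ⟨hum.comp measurable_subtype_coe, δ, hu'⟩
  have h1 := hgap E _ hE' hEm hBM hu' hvol hbar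
  have h2 := FugledeRiesz.sq_volume_symmDiff_le hE' hEm hBM fun x => (hu' x).trans (by linarith)
  have h3 : c / k * ∫ x in sphere (0 : FugledeRiesz.Space N) 1, u x ^ 2 ∂(μH[(N : ℝ) - 1]) =
      c * FugledeRiesz.normSq (fun x : FugledeRiesz.USphere N ↦ u x) := by
    rw [hkint (fun x ↦ u x ^ 2), ← mul_assoc, div_mul_cancel₀ _ hk.ne']
    rfl
  rw [h3]
  refine ⟨h1, ?_⟩
  rw [ge_iff_le, div_mul_eq_mul_div, div_le_iff₀ (by positivity), mul_assoc]
  refine mul_le_mul_of_nonneg_left (h2.trans_eq ?_) hc.le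
  rw [mul_comm]
end

section
/- Let N ≥ 2, 1 < α < N, and let ε₁ be as in the reduction to nearly spherical sets. Let 0 < ε < ε₁ and let E' ⊆ ℝ^N be a measurable set with |E'| = ω_N and B(1−ε²) ⊆ E' ⊆ B(1+ε²). Then, for every z with |z| = ε/2, any set E_z which is ε-nearly spherical around B_z, produced by the construction of the reduction (in particular satisfying E_z ∩ H⁺ ⊆ B(1+ε²) ∩ H⁺ and E_z ∩ H⁻ ⊇ B(1−ε²) ∩ H⁻, where H⁺ = {x : x·z > |z|²} and H⁻ = {x : x·z < |z|²}), has barycenter Bar(z) satisfying (Bar(z) − z)·z < 0. -/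
open MeasureTheory Metric
open scoped RealInnerProductSpace

/-- `S` is an `ε`-nearly spherical set around the unit ball centered at `z`:
its boundary is the graph over `∂B` of a measurable function `u` with values in `(-ε, ε)`. -/
def IsNearlySpherical (N : ℕ) (ε : ℝ) (z : EuclideanSpace ℝ (Fin N))
    (S : Set (EuclideanSpace ℝ (Fin N))) : Prop :=
  volume S = volume (ball (0 : EuclideanSpace ℝ (Fin N)) 1) ∧
  ∃ u : EuclideanSpace ℝ (Fin N) → ℝ, Measurable u ∧
    (∀ x ∈ sphere (0 : EuclideanSpace ℝ (Fin N)) 1, u x ∈ Set.Ioo (-ε) ε) ∧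
    S = {p | ∃ x ∈ sphere (0 : EuclideanSpace ℝ (Fin N)) 1,
          ∃ ρ : ℝ, -1 ≤ ρ ∧ ρ ≤ u x ∧ p = z + (1 + ρ) • x}

section Geometry

variable {E : Type*} [NormedAddCommGroup E] [InnerProductSpace ℝ E]

/-- The part, near the axis of `z`, of the thin shell just outside the unit sphere. -/
def coneShell (ε : ℝ) (z : E) : Set E :=
  {y | ε / 4 * ‖y‖ ≤ ⟪y, z⟫ ∧ 1 ≤ ‖y‖ ∧ ‖y‖ < 1 + ε / 16}

lemma norm_add_lt_iff {r : ℝ} (hr : 0 < r) (y z : E) :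
    ‖y + z‖ < r ↔ ‖y‖ ^ 2 + 2 * ⟪y, z⟫ + ‖z‖ ^ 2 < r ^ 2 := by
  rw [← norm_add_sq_real, sq_lt_sq₀ (norm_nonneg _) hr.le]

lemma norm_sub_lt_iff {r : ℝ} (hr : 0 < r) (y z : E) :
    ‖y - z‖ < r ↔ ‖y‖ ^ 2 - 2 * ⟪y, z⟫ + ‖z‖ ^ 2 < r ^ 2 := by
  rw [← norm_sub_sq_real, sq_lt_sq₀ (norm_nonneg _) hr.le]

lemma indicator_sub_indicator_le {ε : ℝ} (hε : 0 < ε) (hε' : ε < 1 / 10) {z : E}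
    (hz : ‖z‖ = ε / 2) (y : E) :
    {y : E | 0 < ⟪y, z⟫ ∧ ‖y + z‖ < 1 + ε ^ 2}.indicator (fun y => ⟪y, z⟫) y -
      {y : E | 0 < ⟪y, z⟫ ∧ ‖y - z‖ < 1 - ε ^ 2}.indicator (fun y => ⟪y, z⟫) y ≤
    (ball (0 : E) (1 + ε ^ 2) \ ball 0 (1 - 3 * ε ^ 2)).indicator (fun _ => 3 / 2 * ε ^ 2) y -
      (coneShell ε z).indicator (fun _ => ε / 4) y := by
  set P : Set E := {y | 0 < ⟪y, z⟫ ∧ ‖y + z‖ < 1 + ε ^ 2}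
  set Q : Set E := {y | 0 < ⟪y, z⟫ ∧ ‖y - z‖ < 1 - ε ^ 2}
  have hε2 : ε ^ 2 < ε / 10 := by nlinarith
  have hε4 : ε ^ 4 < ε ^ 2 / 100 := by nlinarith [mul_pos hε hε]
  have hε4' : 0 < ε ^ 4 := by positivity
  have hgain : y ∈ coneShell ε z →
      (0 < ⟪y, z⟫ ∧ ‖y - z‖ < 1 - ε ^ 2) ∧ ¬ ‖y + z‖ < 1 + ε ^ 2 ∧ ε / 4 ≤ ⟪y, z⟫ := by
    rintro ⟨h1, h2, h3⟩
    have h4 : ε / 4 ≤ ⟪y, z⟫ := by nlinarith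
    rw [norm_sub_lt_iff (by nlinarith), norm_add_lt_iff (by nlinarith), hz]
    refine ⟨⟨by linarith, ?_⟩, ?_, h4⟩ <;> nlinarith
  have hloss : 0 < ⟪y, z⟫ → ‖y + z‖ < 1 + ε ^ 2 → ¬ ‖y - z‖ < 1 - ε ^ 2 →
      y ∈ ball (0 : E) (1 + ε ^ 2) \ ball 0 (1 - 3 * ε ^ 2) ∧ ⟪y, z⟫ ≤ 3 / 2 * ε ^ 2 := by
    intro h0 h1 h2
    rw [norm_add_lt_iff (by nlinarith), hz] at h1
    rw [norm_sub_lt_iff (by nlinarith), hz] at h2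
    refine ⟨⟨?_, ?_⟩, by nlinarith⟩
    · rw [mem_ball_zero_iff]
      exact lt_of_pow_lt_pow_left₀ 2 (by positivity) (by nlinarith)
    · rw [mem_ball_zero_iff, not_lt]
      exact le_of_sq_le_sq (by nlinarith) (norm_nonneg _)
  have hnonneg : 0 ≤ (ball (0 : E) (1 + ε ^ 2) \ ball 0 (1 - 3 * ε ^ 2)).indicator
      (fun _ => 3 / 2 * ε ^ 2) y := Set.indicator_nonneg (fun _ _ => by positivity) y
  by_cases hG : y ∈ coneShell ε z
  · obtain ⟨hM, hP, hf⟩ := hgain hG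
    rw [Set.indicator_of_mem hG, Set.indicator_of_mem (s := Q) hM,
      Set.indicator_of_notMem (s := P) (fun h => hP h.2)]
    linarith
  · rw [Set.indicator_of_notMem hG]
    by_cases hM : 0 < ⟪y, z⟫ ∧ ‖y - z‖ < 1 - ε ^ 2
    · rw [Set.indicator_of_mem (s := Q) hM]
      have : P.indicator (fun y => ⟪y, z⟫) y ≤ ⟪y, z⟫ :=
        Set.indicator_apply_le' (fun _ => le_rfl) fun _ => hM.1.le
      linarith
    · rw [Set.indicator_of_notMem (s := Q) hM]
      by_cases hP : 0 < ⟪y, z⟫ ∧ ‖y + z‖ < 1 + ε ^ 2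
      · obtain ⟨hS, hf⟩ := hloss hP.1 hP.2 fun h => hM ⟨hP.1, h⟩
        rw [Set.indicator_of_mem (s := P) hP, Set.indicator_of_mem hS]
        linarith
      · rw [Set.indicator_of_notMem (s := P) hP]
        linarith

end Geometry

section Volume

open scoped Pointwise

variable {E : Type*} [NormedAddCommGroup E] [InnerProductSpace ℝ E] [FiniteDimensional ℝ E]
  [MeasurableSpace E] [BorelSpace E]

lemma volume_real_ball_zero [Nontrivial E] {r : ℝ} (hr : 0 ≤ r) :
    volume.real (ball (0 : E) r) = r ^ Module.finrank ℝ E * volume.real (ball (0 : E) 1) := by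
  rw [measureReal_def, Measure.addHaar_ball _ _ hr, ENNReal.toReal_mul,
    ENNReal.toReal_ofReal (by positivity), measureReal_def]

lemma measurableSet_coneShell (ε : ℝ) (z : E) : MeasurableSet (coneShell ε z) := by
  unfold coneShell
  measurability

lemma volume_real_ball_le_volume_real_cone [Nontrivial E] {ε : ℝ} (hε : 0 < ε) {z : E}
    (hz : ‖z‖ = ε / 2) :
    (1 / 8) ^ Module.finrank ℝ E * volume.real (ball (0 : E) 1) ≤
      volume.real ({y : E | ε / 4 * ‖y‖ ≤ ⟪y, z⟫} ∩ ball 0 1) := by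
  rw [← volume_real_ball_zero (by norm_num : (0 : ℝ) ≤ 1 / 8), measureReal_def,
    ← Measure.addHaar_ball_center volume (ε⁻¹ • z), ← measureReal_def]
  refine measureReal_mono ?_
    ((measure_mono Set.inter_subset_right).trans_lt measure_ball_lt_top).ne
  intro y hy
  obtain ⟨w, rfl⟩ : ∃ w, y = ε⁻¹ • z + w := ⟨y - ε⁻¹ • z, by abel⟩
  rw [mem_ball_iff_norm, add_sub_cancel_left] at hy
  have h1 : ‖ε⁻¹ • z‖ = 1 / 2 := by
    rw [norm_smul, hz, Real.norm_of_nonneg (by positivity)]; field_simp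
  have h2 := norm_add_le (ε⁻¹ • z) w
  have h3 : ⟪ε⁻¹ • z, z⟫ = ε / 4 := by
    rw [real_inner_smul_left, real_inner_self_eq_norm_sq, hz]; field_simp; norm_num
  have h4 := neg_le_of_abs_le (abs_real_inner_le_norm w z)
  rw [hz] at h4
  refine ⟨?_, ?_⟩
  · rw [Set.mem_ofPred_eq, inner_add_left, h3]
    nlinarith
  · rw [mem_ball_zero_iff]; linarith

lemma le_volume_real_coneShell [Nontrivial E] {ε : ℝ} (hε : 0 < ε) {z : E}
    (hz : ‖z‖ = ε / 2) :
    ε / 16 * ((1 / 8) ^ Module.finrank ℝ E * volume.real (ball (0 : E) 1)) ≤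
      volume.real (coneShell ε z) := by
  set K : Set E := {y : E | ε / 4 * ‖y‖ ≤ ⟪y, z⟫} with hK
  have hR : 0 < 1 + ε / 16 := by positivity
  have hKm : MeasurableSet K := by rw [hK]; measurability
  have hfin (r : ℝ) : volume (K ∩ ball 0 r) ≠ ⊤ :=
    ((measure_mono Set.inter_subset_right).trans_lt measure_ball_lt_top).ne
  have hsmul : K ∩ ball 0 (1 + ε / 16) = (1 + ε / 16) • (K ∩ ball (0 : E) 1) := by
    ext y
    rw [Set.mem_smul_set_iff_inv_smul_mem₀ hR.ne']
    simp only [hK, Set.mem_inter_iff, Set.mem_ofPred_eq, mem_ball_zero_iff, norm_smul,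
      real_inner_smul_left, norm_inv, Real.norm_of_nonneg hR.le]
    rw [mul_left_comm, mul_le_mul_iff_right₀ (inv_pos.2 hR), inv_mul_lt_iff₀ hR, mul_one]
  have hvol : volume.real (K ∩ ball 0 (1 + ε / 16)) =
      (1 + ε / 16) ^ Module.finrank ℝ E * volume.real (K ∩ ball (0 : E) 1) := by
    rw [hsmul, measureReal_def, Measure.addHaar_smul, ENNReal.toReal_mul,
      ENNReal.toReal_ofReal (abs_nonneg _), abs_of_pos (by positivity), measureReal_def]
  have hdiff : coneShell ε z = (K ∩ ball 0 (1 + ε / 16)) \ (K ∩ ball 0 1) := by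
    ext y
    simp only [coneShell, hK, Set.mem_sdiff, Set.mem_inter_iff, Set.mem_ofPred_eq,
      mem_ball_zero_iff, ← not_lt (a := ‖y‖)]
    tauto
  have hbern : 1 + ε / 16 ≤ (1 + ε / 16) ^ Module.finrank ℝ E :=
    le_self_pow₀ (by linarith) Module.finrank_pos.ne'
  have hcone := volume_real_ball_le_volume_real_cone hε hz
  rw [hdiff, measureReal_sdiff
    (Set.inter_subset_inter_right K (ball_subset_ball (by linarith)))
    (hKm.inter measurableSet_ball) (hfin _), hvol]
  nlinarith [measureReal_nonneg (μ := volume) (s := K ∩ ball (0 : E) 1)]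

lemma integrable_indicator_inner {s : Set E} (hs : MeasurableSet s) (hb : Bornology.IsBounded s)
    (z : E) : Integrable (s.indicator fun y => ⟪y, z⟫) := by
  rw [integrable_indicator_iff hs]
  have hc : Continuous fun y : E => ⟪y, z⟫ := by fun_prop
  exact (hc.continuousOn.integrableOn_compact hb.isCompact_closure).mono_set subset_closure

/-- A set which is small on the side of `z` and large on the opposite side has negative moment
in the direction `z`. -/
lemma setIntegral_inner_neg [Nontrivial E] {ε : ℝ} (hε : 0 < ε) (hε' : ε < 1 / 10)
    (hsmall : (1 + ε ^ 2) ^ Module.finrank ℝ E - (1 - 3 * ε ^ 2) ^ Module.finrank ℝ E <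
      (1 / 8) ^ Module.finrank ℝ E / 96)
    {z : E} (hz : ‖z‖ = ε / 2) {F : Set E} (hF : MeasurableSet F) (hFb : Bornology.IsBounded F)
    (hpos : ∀ y ∈ F, 0 < ⟪y, z⟫ → ‖y + z‖ < 1 + ε ^ 2)
    (hneg : ∀ y, ⟪y, z⟫ < 0 → ‖y + z‖ < 1 - ε ^ 2 → y ∈ F) :
    ∫ y in F, ⟪y, z⟫ < 0 := by
  set P : Set E := {y | 0 < ⟪y, z⟫ ∧ ‖y + z‖ < 1 + ε ^ 2} with hP
  set Q : Set E := {y | 0 < ⟪y, z⟫ ∧ ‖y - z‖ < 1 - ε ^ 2} with hQ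
  set S : Set E := ball (0 : E) (1 + ε ^ 2) \ ball 0 (1 - 3 * ε ^ 2) with hS
  have hPm : MeasurableSet P := by rw [hP]; measurability
  have hQm : MeasurableSet Q := by rw [hQ]; measurability
  have hSm : MeasurableSet S := measurableSet_ball.diff measurableSet_ball
  have hPb : Bornology.IsBounded P := by
    refine (isBounded_ball (x := -z) (r := 1 + ε ^ 2)).subset fun y hy => ?_
    rw [mem_ball_iff_norm, sub_neg_eq_add]; exact hy.2
  have hQb : Bornology.IsBounded Q := by
    refine (isBounded_ball (x := z) (r := 1 - ε ^ 2)).subset fun y hy => ?_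
    rw [mem_ball_iff_norm]; exact hy.2
  have hPi := integrable_indicator_inner hPm hPb z
  have hQi := integrable_indicator_inner hQm hQb z
  have hSfin : volume S ≠ ⊤ :=
    ((measure_mono Set.sdiff_subset).trans_lt measure_ball_lt_top).ne
  have hGfin : volume (coneShell ε z) ≠ ⊤ := by
    refine ((measure_mono fun y hy => ?_).trans_lt
      (measure_ball_lt_top (x := (0 : E)) (r := 1 + ε / 16))).ne
    rw [mem_ball_zero_iff]; exact hy.2.2
  have hSi : Integrable (S.indicator fun _ => 3 / 2 * ε ^ 2) :=
    (integrable_indicator_iff hSm).2 (integrableOn_const hSfin)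
  have hGi : Integrable ((coneShell ε z).indicator fun _ => ε / 4) :=
    (integrable_indicator_iff (measurableSet_coneShell ε z)).2 (integrableOn_const hGfin)
  have hle : ∀ y, F.indicator (fun y => ⟪y, z⟫) y ≤
      P.indicator (fun y => ⟪y, z⟫) y - Q.indicator (fun y => ⟪y, z⟫) (-y) := by
    classical
    intro y
    have hnorm : ‖-y - z‖ = ‖y + z‖ := by rw [← norm_neg]; congr 1; abel
    simp only [Set.indicator_apply, hP, hQ, Set.mem_ofPred_eq, inner_neg_left, hnorm]
    have h1 := hpos y
    have h2 := hneg y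
    by_cases hy : y ∈ F <;> simp only [hy, if_true, if_false] <;> split_ifs <;> grind only
  have hSv : volume.real S = ((1 + ε ^ 2) ^ Module.finrank ℝ E -
      (1 - 3 * ε ^ 2) ^ Module.finrank ℝ E) * volume.real (ball (0 : E) 1) := by
    rw [hS, measureReal_sdiff (ball_subset_ball (by nlinarith)) measurableSet_ball
      measure_ball_lt_top.ne, volume_real_ball_zero (r := 1 + ε ^ 2) (by positivity),
      volume_real_ball_zero (r := 1 - 3 * ε ^ 2) (by nlinarith), sub_mul]
  have hball : 0 < volume.real (ball (0 : E) 1) :=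
    ENNReal.toReal_pos (measure_ball_pos _ _ one_pos).ne' measure_ball_lt_top.ne
  have hG := le_volume_real_coneShell hε hz
  calc ∫ y in F, ⟪y, z⟫ = ∫ y, F.indicator (fun y => ⟪y, z⟫) y := (integral_indicator hF).symm
    _ ≤ ∫ y, (P.indicator (fun y => ⟪y, z⟫) y - Q.indicator (fun y => ⟪y, z⟫) (-y)) :=
        integral_mono (integrable_indicator_inner hF hFb z) (hPi.sub hQi.comp_neg) hle
    _ = ∫ y, (P.indicator (fun y => ⟪y, z⟫) y - Q.indicator (fun y => ⟪y, z⟫) y) := by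
        rw [integral_sub hPi hQi.comp_neg, integral_sub hPi hQi,
          integral_neg_eq_self (Q.indicator fun y => ⟪y, z⟫)]
    _ ≤ ∫ y, (S.indicator (fun _ => 3 / 2 * ε ^ 2) y -
          (coneShell ε z).indicator (fun _ => ε / 4) y) :=
        integral_mono (hPi.sub hQi) (hSi.sub hGi) (indicator_sub_indicator_le hε hε' hz)
    _ = volume.real S * (3 / 2 * ε ^ 2) - volume.real (coneShell ε z) * (ε / 4) := by
        rw [integral_sub hSi hGi, integral_indicator_const _ hSm,
          integral_indicator_const _ (measurableSet_coneShell ε z), smul_eq_mul, smul_eq_mul]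
    _ < 0 := by
        rw [hSv]
        have h1 := mul_lt_mul_of_pos_right hsmall (mul_pos hball (by positivity : 0 < ε ^ 2))
        have h2 := mul_le_mul_of_nonneg_right hG hε.le
        nlinarith

end Volume

lemma IsNearlySpherical.measurableSet_and_isBounded {N : ℕ} (hN : N ≠ 0) {ε : ℝ} (hε : ε < 1)
    {z : EuclideanSpace ℝ (Fin N)} {S : Set (EuclideanSpace ℝ (Fin N))}
    (h : IsNearlySpherical N ε z S) :
    MeasurableSet S ∧ Bornology.IsBounded S := by
  obtain ⟨-, u, hu, hu', rfl⟩ := h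
  have : NeZero N := ⟨hN⟩
  constructor
  · have heq : {p | ∃ x ∈ sphere (0 : EuclideanSpace ℝ (Fin N)) 1,
        ∃ ρ : ℝ, -1 ≤ ρ ∧ ρ ≤ u x ∧ p = z + (1 + ρ) • x} =
        {z} ∪ {p | ‖p - z‖ ≤ 1 + u (‖p - z‖⁻¹ • (p - z))} ∩ {z}ᶜ := by
      ext p
      simp only [Set.mem_ofPred_eq, Set.mem_union, Set.mem_singleton_iff, Set.mem_inter_iff,
        Set.mem_compl_iff]
      constructor
      · rintro ⟨x, hx, ρ, hρ, hρu, rfl⟩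
        rw [mem_sphere_zero_iff_norm] at hx
        rcases hρ.eq_or_lt with rfl | hρ
        · left; simp
        · right
          have h1 : 0 < 1 + ρ := by linarith
          have hn : ‖(1 + ρ) • x‖ = 1 + ρ := by
            rw [norm_smul, hx, mul_one, Real.norm_of_nonneg h1.le]
          rw [add_sub_cancel_left, hn, inv_smul_smul₀ h1.ne']
          refine ⟨by linarith, fun h => ?_⟩
          rw [add_eq_left, ← norm_eq_zero, hn] at h
          exact h1.ne' h
      · rintro (rfl | ⟨h1, h2⟩)
        · obtain ⟨x, hx⟩ := (NormedSpace.sphere_nonempty (x := (0 : EuclideanSpace ℝ (Fin N)))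
            (r := 1)).2 zero_le_one
          exact ⟨x, hx, -1, le_rfl, by linarith [(hu' x hx).1], by simp⟩
        · have h3 : 0 < ‖p - z‖ := norm_pos_iff.2 (sub_ne_zero.2 h2)
          refine ⟨‖p - z‖⁻¹ • (p - z), ?_, ‖p - z‖ - 1, by linarith, by linarith, ?_⟩
          · rw [mem_sphere_zero_iff_norm, norm_smul, norm_inv, norm_norm,
              inv_mul_cancel₀ h3.ne']
          · rw [add_sub_cancel, smul_inv_smul₀ h3.ne', add_sub_cancel]
    rw [heq]
    refine (measurableSet_singleton z).union
      (MeasurableSet.inter (measurableSet_le (by fun_prop) ?_) (measurableSet_singleton z).compl)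
    exact measurable_const.add (hu.comp (by fun_prop))
  · refine (isBounded_closedBall (x := z) (r := 1 + ε)).subset ?_
    rintro p ⟨x, hx, ρ, hρ, hρu, rfl⟩
    rw [mem_sphere_zero_iff_norm] at hx
    rw [mem_closedBall_iff_norm, add_sub_cancel_left, norm_smul, hx, mul_one,
      Real.norm_of_nonneg (by linarith)]
    linarith [(hu' x (by simpa using hx)).2]

lemma inner_barycenter_sub {N : ℕ} {S : Set (EuclideanSpace ℝ (Fin N))}
    (hb : Bornology.IsBounded S) (hS0 : volume S ≠ 0) (z : EuclideanSpace ℝ (Fin N)) :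
    ⟪barycenter N S - z, z⟫ =
      (volume S).toReal⁻¹ * ∫ y in (fun y => y + z) ⁻¹' S, ⟪y, z⟫ := by
  have hfin : volume S ≠ ⊤ := hb.measure_lt_top.ne
  have hpos : (volume S).toReal ≠ 0 := ENNReal.toReal_ne_zero.2 ⟨hS0, hfin⟩
  have hint : IntegrableOn (fun x : EuclideanSpace ℝ (Fin N) => x) S :=
    (continuous_id.continuousOn.integrableOn_compact hb.isCompact_closure).mono_set
      subset_closure
  have hconst : IntegrableOn (fun _ : EuclideanSpace ℝ (Fin N) => z) S := integrableOn_const hfin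
  have hmp := (measurePreserving_add_right (volume : Measure (EuclideanSpace ℝ (Fin N))) z)
  have hcv := hmp.setIntegral_preimage_emb (measurableEmbedding_addRight z)
    (fun x => ⟪x - z, z⟫) S
  simp only [add_sub_cancel_right] at hcv
  have hsub : barycenter N S - z = (volume S).toReal⁻¹ • ∫ x in S, (x - z) := by
    rw [integral_sub hint hconst, setIntegral_const, smul_sub, measureReal_def,
      inv_smul_smul₀ hpos, barycenter]
  have hin := integral_inner (𝕜 := ℝ) (hint.sub hconst) z
  rw [hsub, real_inner_smul_left, hcv, real_inner_comm]
  congr 1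
  exact hin.symm.trans (integral_congr_ae (.of_forall fun x => real_inner_comm _ _))

lemma exists_forall_shell_lt (n : ℕ) {c : ℝ} (hc : 0 < c) :
    ∃ δ : ℝ, 0 < δ ∧ ∀ ε : ℝ, 0 < ε → ε < δ →
      (1 + ε ^ 2) ^ n - (1 - 3 * ε ^ 2) ^ n < c := by
  have hcont : Continuous fun ε : ℝ => (1 + ε ^ 2) ^ n - (1 - 3 * ε ^ 2) ^ n := by fun_prop
  obtain ⟨δ, hδ, h⟩ := Metric.eventually_nhds_iff.1
    (hcont.continuousAt.eventually_lt (x₀ := 0) continuousAt_const (by simpa using hc))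
  exact ⟨δ, hδ, fun ε h0 h1 => h (by simpa [abs_of_pos h0] using h1)⟩

theorem barycenter_moves_toward_origin (N : ℕ) (hN : 2 ≤ N) (α : ℝ) (hα₁ : 1 < α)
    (hα₂ : α < N) :
    ∃ ε₁ : ℝ, 0 < ε₁ ∧ ε₁ < 1 ∧
      ∀ ε : ℝ, 0 < ε → ε < ε₁ →
      ∀ E' : Set (EuclideanSpace ℝ (Fin N)), MeasurableSet E' →
        volume E' = volume (ball (0 : EuclideanSpace ℝ (Fin N)) 1) →
        ball (0 : EuclideanSpace ℝ (Fin N)) (1 - ε ^ 2) ⊆ E' →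
        E' ⊆ ball (0 : EuclideanSpace ℝ (Fin N)) (1 + ε ^ 2) →
        ∀ z : EuclideanSpace ℝ (Fin N), ‖z‖ = ε / 2 →
        ∀ Ez : Set (EuclideanSpace ℝ (Fin N)), IsNearlySpherical N ε z Ez →
          Ez ∩ {x : EuclideanSpace ℝ (Fin N) | ⟪x, z⟫ > ‖z‖ ^ 2} ⊆
            ball (0 : EuclideanSpace ℝ (Fin N)) (1 + ε ^ 2) ∩
              {x : EuclideanSpace ℝ (Fin N) | ⟪x, z⟫ > ‖z‖ ^ 2} →
          ball (0 : EuclideanSpace ℝ (Fin N)) (1 - ε ^ 2) ∩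
              {x : EuclideanSpace ℝ (Fin N) | ⟪x, z⟫ < ‖z‖ ^ 2} ⊆
            Ez ∩ {x : EuclideanSpace ℝ (Fin N) | ⟪x, z⟫ < ‖z‖ ^ 2} →
          ⟪barycenter N Ez - z, z⟫ < 0 := by
  obtain ⟨δ, hδ, hδ'⟩ :=
    exists_forall_shell_lt N (by positivity : (0 : ℝ) < (1 / 8) ^ N / 96)
  refine ⟨min δ (1 / 10), by positivity, (min_le_right _ _).trans_lt (by norm_num), ?_⟩
  intro ε hε hlt E' _ _ _ _ z hz Ez hEz hpos hneg
  have hε' : ε < 1 / 10 := hlt.trans_le (min_le_right _ _)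
  have : NeZero N := ⟨by omega⟩
  obtain ⟨hm, hb⟩ := hEz.measurableSet_and_isBounded (by omega) (by linarith)
  have h0 : volume Ez ≠ 0 := by
    rw [hEz.1]; exact (measure_ball_pos _ _ one_pos).ne'
  have hinner (y : EuclideanSpace ℝ (Fin N)) : ⟪y + z, z⟫ = ⟪y, z⟫ + ‖z‖ ^ 2 := by
    rw [inner_add_left, real_inner_self_eq_norm_sq]
  rw [inner_barycenter_sub hb h0]
  refine mul_neg_of_pos_of_neg
    (inv_pos.2 (ENNReal.toReal_pos h0 hb.measure_lt_top.ne)) ?_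
  refine setIntegral_inner_neg hε hε' ?_ hz (hm.preimage (by fun_prop)) ?_ ?_ ?_
  · rw [finrank_euclideanSpace_fin]
    exact hδ' ε hε (hlt.trans_le (min_le_left _ _))
  · obtain ⟨R, hR⟩ := hb.subset_ball z
    refine (isBounded_ball (x := (0 : EuclideanSpace ℝ (Fin N))) (r := R)).subset fun y hy => ?_
    simpa [mem_ball_iff_norm] using hR hy
  · intro y hy hyz
    exact mem_ball_zero_iff.1 (hpos ⟨hy, by rw [Set.mem_ofPred_eq, hinner]; linarith⟩).1
  · intro y hyz hy
    exact (hneg ⟨mem_ball_zero_iff.2 hy, by rw [Set.mem_ofPred_eq, hinner]; linarith⟩).1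
end
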